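/- Inverse Counting Lemma: let F = (f_n)_{n∈ℕ} be a convergence determining sequence. Let U, W ∈ 𝒲₁ be probability-graphons, let k ≥ 2 be an integer and n₀ ∈ ℕ*. Assume that |t(F^g, U) − t(F^g, W)| ≤ 2^{−k−n₀k²} for every complete directed graph F on k vertices and every edge-decoration g = (g_e) in which each g_e is a product, without repetition of factors, of functions among f₁, …, f_{n₀}, 1−f₁, …, 1−f_{n₀}. Then δ_{□,F}(U, W) ≤ 44/√(log k) + 2^{−n₀} (where log denotes the natural logarithm). -/

import Mathlib

open MeasureTheory Filter Topology
open scoped ENNReal NNReal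

noncomputable section

namespace PG

/-- The unit square `[0,1]²`, with its product Lebesgue measure. -/
abbrev Sq : Type := unitInterval × unitInterval

variable {Z : Type*} [MeasurableSpace Z] [TopologicalSpace Z]

/-! ### Measure-valued kernels and probability-graphons -/

/-- `W(A;·) = ∫_A W(x,y;·) dx dy` for a measure-valued kernel. -/
def kernelInt (W : Sq → Measure Z) (A : Set Sq) : Measure Z :=
  ((volume : Measure Sq).restrict A).bind W

/-- The measure `M_W = W([0,1]²;·)` associated with a (positive) measure-valued kernel. -/
def MW (W : Sq → Measure Z) : Measure Z := (volume : Measure Sq).bind W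

/-- A probability-graphon: a measurable map from `[0,1]²` to probability measures on `Z`. -/
def IsProbGraphon (W : Sq → Measure Z) : Prop :=
  (∀ A : Set Z, MeasurableSet A → Measurable fun p => W p A) ∧
    ∀ p, IsProbabilityMeasure (W p)

/-- Essential supremum of the total mass of a positive measure-valued kernel. -/
def TVboundPos (W : Sq → Measure Z) : ℝ≥0∞ :=
  essSup (fun p => W p Set.univ) (volume : Measure Sq)

/-- A (positive) measure-valued kernel: measurable and essentially bounded. -/
def IsPosKernel (W : Sq → Measure Z) : Prop :=
  (∀ A : Set Z, MeasurableSet A → Measurable fun p => W p A) ∧ TVboundPos W < ⊤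

/-- Relabeling `W^φ` of a kernel by a map `φ : [0,1] → [0,1]`. -/
def relabel (W : Sq → Measure Z) (φ : unitInterval → unitInterval) : Sq → Measure Z :=
  fun p => W (φ p.1, φ p.2)

/-- `φ` is a Lebesgue-measure-preserving map of `[0,1]`. -/
def IsMP (φ : unitInterval → unitInterval) : Prop :=
  MeasurePreserving φ (volume : Measure unitInterval) (volume : Measure unitInterval)

/-- Weak convergence of a sequence of (finite) measures on `Z`. -/
def WeakTendsto (μ : ℕ → Measure Z) (ν : Measure Z) : Prop :=
  ∀ f : BoundedContinuousFunction Z ℝ,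
    Tendsto (fun n => ∫ x, f x ∂(μ n)) atTop (𝓝 (∫ x, f x ∂ν))

/-- The cut distance `d_{□,m}` associated with a distance `d_m` on measures. -/
def cutDist (dm : Measure Z → Measure Z → ℝ) (U W : Sq → Measure Z) : ℝ :=
  ⨆ ST : {p : Set unitInterval × Set unitInterval // MeasurableSet p.1 ∧ MeasurableSet p.2},
    dm (kernelInt U (ST.val.1 ×ˢ ST.val.2)) (kernelInt W (ST.val.1 ×ˢ ST.val.2))

/-- The unlabeled cut distance `δ_□` associated with a distance `d` on kernels:
`δ_□(U,W) = inf_{φ ∈ S_{[0,1]}} d(U, W^φ)`. -/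
def deltaCut (d : (Sq → Measure Z) → (Sq → Measure Z) → ℝ) (U W : Sq → Measure Z) : ℝ :=
  ⨅ φ : {φ : unitInterval → unitInterval // IsMP φ ∧ Function.Bijective φ},
    d U (relabel W φ.val)

/-- Weak isomorphism of kernels: `U^φ = W^ψ` a.e. for some measure-preserving `φ, ψ`. -/
def WeakIso (U W : Sq → Measure Z) : Prop :=
  ∃ φ ψ : unitInterval → unitInterval, IsMP φ ∧ IsMP ψ ∧
    relabel U φ =ᵐ[(volume : Measure Sq)] relabel W ψ

/-- A family of kernels is tight if the family of measures `{M_W}` is tight. -/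
def TightFamily (K : Set (Sq → Measure Z)) : Prop :=
  ∀ ε : ℝ≥0∞, 0 < ε → ∃ K₀ : Set Z, IsCompact K₀ ∧ ∀ W ∈ K, MW W K₀ᶜ ≤ ε

/-- Invariance of a distance on probability-graphons under bijective
measure-preserving relabelings. -/
def Invariant (d : (Sq → Measure Z) → (Sq → Measure Z) → ℝ) : Prop :=
  ∀ U W : Sq → Measure Z, IsProbGraphon U → IsProbGraphon W →
    ∀ φ : unitInterval → unitInterval, IsMP φ → Function.Bijective φ →
      d (relabel U φ) (relabel W φ) = d U W

/-- Smoothness of a distance on probability-graphons: a.e. weak convergence implies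
convergence in `d`. -/
def Smooth (d : (Sq → Measure Z) → (Sq → Measure Z) → ℝ) : Prop :=
  ∀ (Wn : ℕ → Sq → Measure Z) (W : Sq → Measure Z),
    (∀ n, IsProbGraphon (Wn n)) → IsProbGraphon W →
    (∀ᵐ p ∂(volume : Measure Sq), WeakTendsto (fun n => Wn n p) (W p)) →
    Tendsto (fun n => d (Wn n) W) atTop (𝓝 0)

/-- `d` is a distance on the space `𝒲₁` of probability-graphons (where kernels that
agree a.e. are identified). -/
def IsGraphonDist (d : (Sq → Measure Z) → (Sq → Measure Z) → ℝ) : Prop :=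
  (∀ U W, IsProbGraphon U → IsProbGraphon W → d U W = d W U) ∧
  (∀ U W, IsProbGraphon U → IsProbGraphon W → 0 ≤ d U W) ∧
  (∀ U V W, IsProbGraphon U → IsProbGraphon V → IsProbGraphon W → d U W ≤ d U V + d V W) ∧
  (∀ U W, IsProbGraphon U → IsProbGraphon W →
    (d U W = 0 ↔ U =ᵐ[(volume : Measure Sq)] W))

/-- Distance axioms for `d` on a subset `M`. -/
def IsDistOnSet {α : Type*} (M : Set α) (d : α → α → ℝ) : Prop :=
  (∀ x ∈ M, ∀ y ∈ M, d x y = d y x) ∧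
  (∀ x ∈ M, ∀ y ∈ M, 0 ≤ d x y) ∧
  (∀ x ∈ M, ∀ y ∈ M, ∀ z ∈ M, d x z ≤ d x y + d y z) ∧
  (∀ x ∈ M, ∀ y ∈ M, (d x y = 0 ↔ x = y))

/-- The set `ℳ≤1(Z)` of measures of total mass at most one. -/
def SubProb (Z : Type*) [MeasurableSpace Z] : Set (Measure Z) := {μ | μ Set.univ ≤ 1}

/-- `d_m` is a distance on `ℳ≤1(Z)`. -/
def IsDistOnSubProb (dm : Measure Z → Measure Z → ℝ) : Prop :=
  IsDistOnSet (SubProb Z) dm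

/-- `d_m` induces the weak topology on `ℳ≤1(Z)` (sequential formulation; the weak
topology on `ℳ≤1(Z)` is metrizable, so it is characterized by its convergent
sequences). -/
def InducesWeakTopologySub (dm : Measure Z → Measure Z → ℝ) : Prop :=
  ∀ (μn : ℕ → Measure Z) (μ : Measure Z), (∀ n, μn n ∈ SubProb Z) → μ ∈ SubProb Z →
    (Tendsto (fun n => dm (μn n) μ) atTop (𝓝 0) ↔ WeakTendsto μn μ)

/-- Quasi-convexity of a distance on the convex set `ℳ₊(Z)` of finite measures. -/
def QuasiConvexPos (dm : Measure Z → Measure Z → ℝ) : Prop :=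
  ∀ μ₁ μ₂ ν₁ ν₂ : Measure Z, IsFiniteMeasure μ₁ → IsFiniteMeasure μ₂ →
    IsFiniteMeasure ν₁ → IsFiniteMeasure ν₂ → ∀ a : ℝ≥0∞, a ≤ 1 →
    dm (a • μ₁ + (1 - a) • μ₂) (a • ν₁ + (1 - a) • ν₂) ≤ max (dm μ₁ ν₁) (dm μ₂ ν₂)

/-! ### Finite partitions of `[0,1]` and the stepping operator -/

/-- A finite measurable partition of `[0,1]` (possibly with empty classes). -/
structure FinPartition : Type where
  n : ℕ
  part : Fin n → Set unitInterval
  measurableSet : ∀ i, MeasurableSet (part i)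
  disjoint : ∀ i j, i ≠ j → Disjoint (part i) (part j)
  covers : (⋃ i, part i) = Set.univ

/-- `P` refines `Q`: every class of `P` is included in a class of `Q`. -/
def FinPartition.Refines (P Q : FinPartition) : Prop :=
  ∀ i, ∃ j, P.part i ⊆ Q.part j

/-- The stepping `W_𝒫` of a (positive) measure-valued kernel `W` with respect to a
finite partition `𝒫`: on `S_i × S_j` it equals `W(S_i×S_j;·)/(λ(S_i)λ(S_j))`
(and the zero measure on classes of zero measure). -/
def stepping (W : Sq → Measure Z) (P : FinPartition) : Sq → Measure Z :=
  fun p => ∑ i : Fin P.n, ∑ j : Fin P.n,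
    Set.indicator (P.part i ×ˢ P.part j)
      (fun _ => ((volume (P.part i)) * (volume (P.part j)))⁻¹ •
        kernelInt W (P.part i ×ˢ P.part j)) p

/-- Weak regularity of a distance on probability-graphons. -/
def WeaklyRegular (d : (Sq → Measure Z) → (Sq → Measure Z) → ℝ) : Prop :=
  ∀ K : Set (Sq → Measure Z), (∀ W ∈ K, IsProbGraphon W) → TightFamily K →
    ∀ ε : ℝ, 0 < ε → ∃ m : ℕ, 0 < m ∧
      ∀ W ∈ K, ∀ Q : FinPartition, ∃ P : FinPartition,
        P.Refines Q ∧ P.n ≤ m * Q.n ∧ d W (stepping W P) < ε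

/-- Regularity of a distance on probability-graphons with respect to the stepping
operator. -/
def SteppingRegular (d : (Sq → Measure Z) → (Sq → Measure Z) → ℝ) : Prop :=
  ∃ C₀ : ℝ, 0 < C₀ ∧ ∀ W U : Sq → Measure Z, IsProbGraphon W → IsProbGraphon U →
    ∀ P : FinPartition, d W (stepping W P) ≤ C₀ * d W (stepping U P)

/-! ### Signed measure-valued kernels -/

/-- The signed measure associated with a finite measure (and junk value `0` on
non-finite measures). -/
def toSigned (μ : Measure Z) : SignedMeasure Z :=
  letI := Classical.dec (IsFiniteMeasure μ)
  if h : IsFiniteMeasure μ then @Measure.toSignedMeasure Z _ μ h else 0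

/-- `W(A;·)` for a signed measure-valued kernel. -/
def skernelInt (W : Sq → SignedMeasure Z) (A : Set Sq) : SignedMeasure Z :=
  toSigned (((volume : Measure Sq).restrict A).bind
      fun p => (W p).toJordanDecomposition.posPart)
    - toSigned (((volume : Measure Sq).restrict A).bind
      fun p => (W p).toJordanDecomposition.negPart)

/-- Total mass `‖s‖_TV` of the total variation of a signed measure. -/
def TVnorm (s : SignedMeasure Z) : ℝ≥0∞ := s.totalVariation Set.univ

/-- `‖W‖∞`, the essential supremum of the total variation masses of a signed
measure-valued kernel. -/
def TVbound (W : Sq → SignedMeasure Z) : ℝ≥0∞ :=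
  essSup (fun p => TVnorm (W p)) (volume : Measure Sq)

/-- A signed measure-valued kernel: measurable in `(x,y)` and essentially bounded in
total variation. -/
def IsSignedKernel (W : Sq → SignedMeasure Z) : Prop :=
  (∀ A : Set Z, MeasurableSet A → Measurable fun p => W p A) ∧ TVbound W < ⊤

/-- The measure `M_W = ∫ |W|(x,y;·) dx dy` of a signed measure-valued kernel. -/
def MWs (W : Sq → SignedMeasure Z) : Measure Z :=
  (volume : Measure Sq).bind fun p => (W p).totalVariation

/-- Tightness for a family of signed measure-valued kernels. -/
def TightFamilyS (K : Set (Sq → SignedMeasure Z)) : Prop :=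
  ∀ ε : ℝ≥0∞, 0 < ε → ∃ K₀ : Set Z, IsCompact K₀ ∧ ∀ W ∈ K, MWs W K₀ᶜ ≤ ε

/-- Integral of a bounded continuous function against a signed measure. -/
def sint (f : BoundedContinuousFunction Z ℝ) (s : SignedMeasure Z) : ℝ :=
  ∫ x, f x ∂s.toJordanDecomposition.posPart - ∫ x, f x ∂s.toJordanDecomposition.negPart

/-- Weak convergence of signed measures. -/
def WeakTendstoS (s : ℕ → SignedMeasure Z) (t : SignedMeasure Z) : Prop :=
  ∀ f : BoundedContinuousFunction Z ℝ,
    Tendsto (fun n => sint f (s n)) atTop (𝓝 (sint f t))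

/-- Stepping of a signed measure-valued kernel with respect to a finite partition. -/
def steppingS (W : Sq → SignedMeasure Z) (P : FinPartition) : Sq → SignedMeasure Z :=
  fun p => ∑ i : Fin P.n, ∑ j : Fin P.n,
    Set.indicator (P.part i ×ˢ P.part j)
      (fun _ => (((volume (P.part i)).toReal * (volume (P.part j)).toReal)⁻¹ : ℝ) •
        skernelInt W (P.part i ×ˢ P.part j)) p

/-- Cut distance for signed measure-valued kernels associated with a distance `d_m`
on signed measures. -/
def cutDistS (dm : SignedMeasure Z → SignedMeasure Z → ℝ) (U W : Sq → SignedMeasure Z) : ℝ :=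
  ⨆ ST : {p : Set unitInterval × Set unitInterval // MeasurableSet p.1 ∧ MeasurableSet p.2},
    dm (skernelInt U (ST.val.1 ×ˢ ST.val.2)) (skernelInt W (ST.val.1 ×ˢ ST.val.2))

/-- Quasi-convexity of a distance on a convex subset `M` of signed measures. -/
def QuasiConvexOn (M : Set (SignedMeasure Z)) (dm : SignedMeasure Z → SignedMeasure Z → ℝ) :
    Prop :=
  ∀ x₁ ∈ M, ∀ x₂ ∈ M, ∀ y₁ ∈ M, ∀ y₂ ∈ M, ∀ a : ℝ, 0 ≤ a → a ≤ 1 →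
    dm (a • x₁ + (1 - a) • x₂) (a • y₁ + (1 - a) • y₂) ≤ max (dm x₁ y₁) (dm x₂ y₂)

/-! ### Convergence determining sequences and the associated norms -/

/-- `F` is a convergence determining sequence: `[0,1]`-valued bounded continuous
functions, `F 0 = 1`, such that convergence of all moments `μ(f_k)` implies weak
convergence (for finite positive measures). -/
def IsConvDet (F : ℕ → BoundedContinuousFunction Z ℝ) : Prop :=
  F 0 = 1 ∧ (∀ k x, F k x ∈ Set.Icc (0:ℝ) 1) ∧
  ∀ (μn : ℕ → Measure Z) (μ : Measure Z), (∀ n, IsFiniteMeasure (μn n)) → IsFiniteMeasure μ →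
    (∀ k, Tendsto (fun n => ∫ x, F k x ∂(μn n)) atTop (𝓝 (∫ x, F k x ∂μ))) →
    WeakTendsto μn μ

/-- `‖μ − ν‖_F = Σ_k 2^{-k} |μ(f_k) − ν(f_k)|` for positive measures. -/
def Fdist (F : ℕ → BoundedContinuousFunction Z ℝ) (μ ν : Measure Z) : ℝ :=
  ∑' k : ℕ, (1/2 : ℝ) ^ k * |∫ x, F k x ∂μ - ∫ x, F k x ∂ν|

/-- The cut distance `d_{□,F}(U,W) = ‖U − W‖_{□,F}` on measure-valued kernels. -/
def cutDistF (F : ℕ → BoundedContinuousFunction Z ℝ) (U W : Sq → Measure Z) : ℝ :=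
  ⨆ ST : {p : Set unitInterval × Set unitInterval // MeasurableSet p.1 ∧ MeasurableSet p.2},
    Fdist F (kernelInt U (ST.val.1 ×ˢ ST.val.2)) (kernelInt W (ST.val.1 ×ˢ ST.val.2))

/-- The norm `‖s‖_F` of a signed measure. -/
def FnormS (F : ℕ → BoundedContinuousFunction Z ℝ) (s : SignedMeasure Z) : ℝ :=
  ∑' k : ℕ, (1/2 : ℝ) ^ k * |sint (F k) s|

/-- The cut norm `‖W‖_{□,F}` of a signed measure-valued kernel. -/
def cutNormFS (F : ℕ → BoundedContinuousFunction Z ℝ) (W : Sq → SignedMeasure Z) : ℝ :=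
  ⨆ ST : {p : Set unitInterval × Set unitInterval // MeasurableSet p.1 ∧ MeasurableSet p.2},
    FnormS F (skernelInt W (ST.val.1 ×ˢ ST.val.2))

/-- The norm `‖W‖_{2,F}` of a signed measure-valued kernel. -/
def norm2F (F : ℕ → BoundedContinuousFunction Z ℝ) (W : Sq → SignedMeasure Z) : ℝ :=
  Real.sqrt (∑' k : ℕ, (1/2 : ℝ) ^ k * ∫ p, (sint (F k) (W p)) ^ 2 ∂(volume : Measure Sq))

/-! ### Homomorphism densities and sampling -/

/-- The homomorphism density `t(F^g, W)` of a `C_b(Z)`-decorated finite directed graph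
with vertex set `Fin v` and edge set `E` in a measure-valued kernel `W`. -/
def homDensity {v : ℕ} (E : Finset (Fin v × Fin v))
    (g : Fin v × Fin v → BoundedContinuousFunction Z ℝ) (W : Sq → Measure Z) : ℝ :=
  ∫ x : Fin v → unitInterval,
    (∏ e ∈ E, ∫ z, g e z ∂(W (x e.1, x e.2))) ∂(volume : Measure (Fin v → unitInterval))

/-- The edge set of the complete directed graph on `k` vertices. -/
def completeEdges (k : ℕ) : Finset (Fin k × Fin k) :=
  Finset.univ.filter fun e => e.1 ≠ e.2

/-- The `i`-th step `((i)/k, (i+1)/k]` of the uniform partition of `[0,1]` into `k`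
intervals. -/
def stepSet (k : ℕ) (i : Fin k) : Set unitInterval :=
  {t | (i : ℝ) / k < (t : ℝ) ∧ (t : ℝ) ≤ ((i : ℝ) + 1) / k}

/-- The stepfunction `W_x` sampled from `W` at the points `x = (x₁, …, x_k)`. -/
def sample (W : Sq → Measure Z) {k : ℕ} (x : Fin k → unitInterval) : Sq → Measure Z :=
  fun p => ∑ i : Fin k, ∑ j : Fin k,
    Set.indicator (stepSet k i ×ˢ stepSet k j) (fun _ => W (x i, x j)) p

/-- The probability-graphon associated with the `Z`-weighted complete graph on `k`
vertices with weights `β`. -/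
def graphonOfWeights {k : ℕ} (β : Fin k × Fin k → Z) : Sq → Measure Z :=
  fun p => ∑ i : Fin k, ∑ j : Fin k,
    Set.indicator (stepSet k i ×ˢ stepSet k j) (fun _ => Measure.dirac (β (i, j))) p

/-- The joint law of `(X, (β_{ij}))` where `X` is uniform on `[0,1]^k` and, given `X`,
the weights `β_{ij}` are independent with respective laws `W(X_i, X_j;·)`. -/
def sampleLaw (W : Sq → Measure Z) (k : ℕ) :
    Measure ((Fin k → unitInterval) × (Fin k × Fin k → Z)) :=
  (volume : Measure (Fin k → unitInterval)).bind fun x =>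
    (Measure.pi fun e : Fin k × Fin k => W (x e.1, x e.2)).map (Prod.mk x)

/-! ### Expectations under finite product laws -/

section FiniteProb

variable {I J β γ Θ ι X Y : Type*}

/-- The expectation of `f` when the coordinates `b i` are independent with laws `q i`. -/
def pE [Fintype I] [DecidableEq I] [Fintype β] (q : I → β → ℝ) (f : (I → β) → ℝ) : ℝ :=
  ∑ b : I → β, (∏ i, q i (b i)) * f b

/-- `q` is a family of probability vectors. -/
def IsLaw [Fintype β] (q : I → β → ℝ) : Prop :=
  (∀ i ω, 0 ≤ q i ω) ∧ ∀ i, ∑ ω, q i ω = 1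

/-- The family of uniform laws on `β`. -/
def unif (I β : Type*) [Fintype β] : I → β → ℝ := fun _ _ => (Fintype.card β : ℝ)⁻¹

lemma isLaw_unif [Fintype β] [Nonempty β] : IsLaw (unif I β) := by
  refine ⟨fun i ω => by unfold unif; positivity, fun i => ?_⟩
  simp [unif]

section pE
variable [Fintype I] [DecidableEq I] [Fintype β] {q : I → β → ℝ}

lemma pE_prod (q : I → β → ℝ) (h : I → β → ℝ) :
    pE q (fun b => ∏ i, h i (b i)) = ∏ i, ∑ ω, q i ω * h i ω := by
  rw [Finset.prod_univ_sum]
  simp [pE, Finset.prod_mul_distrib]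

lemma pE_mono (hq : IsLaw q) {f g : (I → β) → ℝ} (h : ∀ b, f b ≤ g b) : pE q f ≤ pE q g :=
  Finset.sum_le_sum fun b _ =>
    mul_le_mul_of_nonneg_left (h b) (Finset.prod_nonneg fun i _ => hq.1 i _)

lemma pE_const (hq : IsLaw q) (c : ℝ) : pE q (fun _ => c) = c := by
  have h := pE_prod q (fun _ _ => 1)
  simp only [Finset.prod_const_one, mul_one, hq.2] at h
  unfold pE at h ⊢
  rw [← Finset.sum_mul]
  simp only [mul_one] at h
  rw [h, one_mul]

lemma pE_add (q : I → β → ℝ) (f g : (I → β) → ℝ) :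
    pE q (fun b => f b + g b) = pE q f + pE q g := by
  simp [pE, mul_add, Finset.sum_add_distrib]

lemma pE_const_mul (q : I → β → ℝ) (c : ℝ) (f : (I → β) → ℝ) :
    pE q (fun b => c * f b) = c * pE q f := by
  simp only [pE, Finset.mul_sum]
  exact Finset.sum_congr rfl fun b _ => by ring

lemma pE_neg (q : I → β → ℝ) (f : (I → β) → ℝ) :
    pE q (fun b => - f b) = - pE q f := by
  simp [pE]

lemma pE_sub (q : I → β → ℝ) (f g : (I → β) → ℝ) :
    pE q (fun b => f b - g b) = pE q f - pE q g := by
  simp [pE, mul_sub, Finset.sum_sub_distrib]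

lemma pE_sum (q : I → β → ℝ) (s : Finset Θ) (f : Θ → (I → β) → ℝ) :
    pE q (fun b => ∑ t ∈ s, f t b) = ∑ t ∈ s, pE q (f t) := by
  simp only [pE, Finset.mul_sum]
  exact Finset.sum_comm

lemma pE_nonneg (hq : IsLaw q) {f : (I → β) → ℝ} (h : ∀ b, 0 ≤ f b) : 0 ≤ pE q f :=
  Finset.sum_nonneg fun b _ => mul_nonneg (Finset.prod_nonneg fun i _ => hq.1 i _) (h b)

lemma pE_comm [Fintype J] [DecidableEq J] [Fintype γ] (q : I → β → ℝ) (q' : J → γ → ℝ)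
    (f : (I → β) → (J → γ) → ℝ) :
    pE q (fun b => pE q' (fun c => f b c)) = pE q' (fun c => pE q (fun b => f b c)) := by
  simp only [pE, Finset.mul_sum]
  rw [Finset.sum_comm]
  exact Finset.sum_congr rfl fun c _ => Finset.sum_congr rfl fun b _ => by ring

lemma pE_abs_le (hq : IsLaw q) (f : (I → β) → ℝ) : |pE q f| ≤ pE q (fun b => |f b|) := by
  rw [abs_le, ← pE_neg]
  exact ⟨pE_mono hq fun b => neg_abs_le _, pE_mono hq fun b => le_abs_self _⟩

/-- The expectation of a function of a single coordinate. -/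
lemma pE_eval (hq : IsLaw q) (i : I) (h : β → ℝ) :
    pE q (fun b => h (b i)) = ∑ ω, q i ω * h ω := by
  have := pE_prod q (fun j ω => if j = i then h ω else 1)
  simp only [Finset.prod_ite_eq', Finset.mem_univ, if_true] at this
  rw [this, Finset.prod_eq_single i]
  · simp
  · intro j _ hj
    simp [hj, hq.2]
  · simp

/-- Exchanging the coordinates outside `A` between two independent copies. -/
lemma pE_pE_mix (q : I → β → ℝ) (A : I → Bool) (G : (I → β) → (I → β) → ℝ) :
    pE q (fun x => pE q (fun y => G x y)) =
      pE q (fun x => pE q (fun y =>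
        G (fun i => if A i then x i else y i) (fun i => if A i then y i else x i))) := by
  let e : (I → β) × (I → β) ≃ (I → β) × (I → β) :=
    Function.Involutive.toPerm
      (fun p => (fun i => if A i then p.1 i else p.2 i, fun i => if A i then p.2 i else p.1 i))
      (by
        intro p
        ext i <;> by_cases h : A i <;> simp [h])
  have he : ∀ p, e p =
      (fun i => if A i then p.1 i else p.2 i, fun i => if A i then p.2 i else p.1 i) :=
    fun _ => rfl
  have key : ∀ H : (I → β) → (I → β) → ℝ, pE q (fun x => pE q (fun y => H x y)) =
      ∑ p : (I → β) × (I → β), (∏ i, q i (p.1 i) * q i (p.2 i)) * H p.1 p.2 := by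
    intro H
    rw [Fintype.sum_prod_type]
    simp only [pE, Finset.mul_sum, Finset.prod_mul_distrib]
    exact Finset.sum_congr rfl fun c _ => Finset.sum_congr rfl fun b _ => by ring
  rw [key, key, ← Equiv.sum_comp e]
  refine Finset.sum_congr rfl fun p _ => ?_
  simp only [he]
  congr 1
  refine Finset.prod_congr rfl fun i _ => ?_
  by_cases h : A i
  · simp [h]
  · simp [h, mul_comm]

/-- If `G x y` depends on `x` only inside `A` and on `y` only outside `A`, then its diagonal
expectation is its expectation over two independent copies. -/
lemma pE_diag (hq : IsLaw q) (A : I → Bool) (G : (I → β) → (I → β) → ℝ)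
    (hG : ∀ x x' y y', (∀ i, A i = true → x i = x' i) → (∀ i, A i = false → y i = y' i) →
      G x y = G x' y') :
    pE q (fun x => G x x) = pE q (fun x => pE q (fun y => G x y)) := by
  have h1 : pE q (fun x => G x x) = pE q (fun x => pE q (fun _ => G x x)) := by
    simp only [pE_const hq]
  rw [h1, pE_pE_mix q A]
  congr 1; ext x; congr 1; ext y
  apply hG
  · intro i hi; simp [hi]
  · intro i hi; simp [hi]

end pE

/-- The value of an element of a finite family is at most the supremum. -/
lemma le_sup_fin [Finite Θ] (f : Θ → ℝ) (t : Θ) : f t ≤ ⨆ t, f t :=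
  le_ciSup (Set.finite_range f).bddAbove t

/-- A maximal inequality for sums of independent centred bounded variables. -/
lemma pE_sup_le [Fintype I] [DecidableEq I] [Fintype β] {q : I → β → ℝ} (hq : IsLaw q)
    [Fintype Θ] [Nonempty Θ] (h : Θ → I → β → ℝ) (hb : ∀ t i ω, |h t i ω| ≤ 1)
    (hm : ∀ t i, ∑ ω, q i ω * h t i ω = 0) {l : ℝ} (hl : 0 < l) (hl1 : l ≤ 1) :
    pE q (fun b => ⨆ t, ∑ i, h t i (b i)) ≤
      (Real.log (Fintype.card Θ) + l ^ 2 * Fintype.card I) / l := by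
  set C : ℝ := Fintype.card Θ * Real.exp (l ^ 2 * Fintype.card I) with hC
  have hcard : (0 : ℝ) < Fintype.card Θ := by exact_mod_cast Fintype.card_pos
  have hC0 : 0 < C := by positivity
  have hlog : Real.log C = Real.log (Fintype.card Θ) + l ^ 2 * Fintype.card I := by
    rw [hC, Real.log_mul hcard.ne' (Real.exp_ne_zero _), Real.log_exp]
  rw [le_div_iff₀ hl, ← hlog, mul_comm, ← pE_const_mul]
  have hmgf : ∀ t, pE q (fun b => Real.exp (l * ∑ i, h t i (b i))) ≤
      Real.exp (l ^ 2 * Fintype.card I) := by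
    intro t
    have h1 : ∀ b : I → β, Real.exp (l * ∑ i, h t i (b i)) = ∏ i, Real.exp (l * h t i (b i)) := by
      intro b; rw [Finset.mul_sum, Real.exp_sum]
    simp only [h1]
    rw [pE_prod q (fun i ω => Real.exp (l * h t i ω))]
    calc ∏ i, ∑ ω, q i ω * Real.exp (l * h t i ω) ≤ ∏ _i : I, Real.exp (l ^ 2) := by
          refine Finset.prod_le_prod (fun i _ => Finset.sum_nonneg fun ω _ =>
            mul_nonneg (hq.1 i ω) (Real.exp_pos _).le) fun i _ => ?_
          calc ∑ ω, q i ω * Real.exp (l * h t i ω)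
              ≤ ∑ ω, (q i ω * (1 + l ^ 2) + l * (q i ω * h t i ω)) := by
                refine Finset.sum_le_sum fun ω _ => ?_
                have hx : |l * h t i ω| ≤ 1 := by
                  rw [abs_mul, abs_of_pos hl]
                  exact mul_le_one₀ hl1 (abs_nonneg _) (hb t i ω)
                have h2 := (abs_le.1 (Real.abs_exp_sub_one_sub_id_le hx)).2
                have h3 : (l * h t i ω) ^ 2 ≤ l ^ 2 := by
                  rw [mul_pow]
                  have : (h t i ω) ^ 2 ≤ 1 := by
                    rw [← sq_abs]; exact pow_le_one₀ (abs_nonneg _) (hb t i ω)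
                  nlinarith [sq_nonneg l]
                have := mul_le_mul_of_nonneg_left
                  (show Real.exp (l * h t i ω) ≤ (1 + l ^ 2) + l * h t i ω by linarith) (hq.1 i ω)
                linarith
            _ = 1 + l ^ 2 := by
                rw [Finset.sum_add_distrib, ← Finset.sum_mul, ← Finset.mul_sum, hq.2, hm]; ring
            _ ≤ Real.exp (l ^ 2) := by linarith [Real.add_one_le_exp (l ^ 2)]
      _ = Real.exp (l ^ 2 * Fintype.card I) := by
          rw [Finset.prod_const, ← Real.exp_nat_mul, Finset.card_univ, mul_comm]
  have hpt : ∀ b : I → β, l * (⨆ t, ∑ i, h t i (b i)) ≤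
      (Real.log C - 1) + C⁻¹ * ∑ t, Real.exp (l * ∑ i, h t i (b i)) := by
    intro b
    obtain ⟨t, ht⟩ := exists_eq_ciSup_of_finite (f := fun t => ∑ i, h t i (b i))
    rw [← ht]
    have h1 : Real.exp (l * ∑ i, h t i (b i)) ≤ ∑ t, Real.exp (l * ∑ i, h t i (b i)) :=
      Finset.single_le_sum (f := fun t => Real.exp (l * ∑ i, h t i (b i)))
        (fun _ _ => (Real.exp_pos _).le) (Finset.mem_univ t)
    have h2 := Real.add_one_le_exp (l * ∑ i, h t i (b i) - Real.log C)
    rw [Real.exp_sub, Real.exp_log hC0, div_eq_inv_mul] at h2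
    have := mul_le_mul_of_nonneg_left h1 (inv_nonneg.2 hC0.le)
    linarith
  refine (pE_mono hq hpt).trans ?_
  rw [pE_add, pE_const hq, pE_const_mul, pE_sum]
  have : ∑ t, pE q (fun b => Real.exp (l * ∑ i, h t i (b i))) ≤ C := by
    refine (Finset.sum_le_sum fun t _ => hmgf t).trans ?_
    rw [Finset.sum_const, Finset.card_univ, nsmul_eq_mul]
  have := mul_le_mul_of_nonneg_left this (inv_nonneg.2 hC0.le)
  rw [inv_mul_cancel₀ hC0.ne'] at this
  linarith

/-- The mean absolute value of a sum of independent centred bounded variables. -/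
lemma pE_abs_sum_le [Fintype I] [DecidableEq I] [Fintype β] {q : I → β → ℝ} (hq : IsLaw q)
    (h : I → β → ℝ) {M : ℝ} (hM : 0 < M) (hb : ∀ i ω, |h i ω| ≤ M)
    (hm : ∀ i, ∑ ω, q i ω * h i ω = 0) :
    pE q (fun b => |∑ i, h i (b i)|) ≤ 2 * M * √(Fintype.card I) := by
  rcases isEmpty_or_nonempty I with hI | hI
  · simp [pE]
  have hc : (1 : ℝ) ≤ Fintype.card I := by exact_mod_cast Fintype.card_pos
  have hs : 1 ≤ √(Fintype.card I : ℝ) := Real.one_le_sqrt.2 hc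
  have hss : √(Fintype.card I : ℝ) * √(Fintype.card I : ℝ) = Fintype.card I :=
    Real.mul_self_sqrt (by positivity)
  have key := pE_sup_le hq (Θ := Bool) (fun t i ω => (if t then 1 else -1) * (h i ω / M))
    (by
      intro t i ω
      have : |h i ω / M| ≤ 1 := by
        rw [abs_div, abs_of_pos hM]; exact (div_le_one hM).2 (hb i ω)
      cases t <;> simpa using this)
    (by
      intro t i
      have : ∑ ω, q i ω * ((if t then 1 else -1) * (h i ω / M)) =
          (if t then 1 else -1) / M * ∑ ω, q i ω * h i ω := by
        rw [Finset.mul_sum]; exact Finset.sum_congr rfl fun ω _ => by ring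
      rw [this, hm, mul_zero])
    (l := (√(Fintype.card I : ℝ))⁻¹) (by positivity) (inv_le_one_of_one_le₀ hs)
  have hpt : ∀ b : I → β, |∑ i, h i (b i)| ≤
      M * ⨆ t : Bool, ∑ i, (if t then 1 else -1) * (h i (b i) / M) := by
    intro b
    have hle : ∀ t : Bool, (if t then 1 else -1) * ∑ i, h i (b i) ≤
        M * ⨆ t : Bool, ∑ i, (if t then 1 else -1) * (h i (b i) / M) := by
      intro t
      have h1 := le_sup_fin (fun t : Bool => ∑ i, (if t then (1:ℝ) else -1) * (h i (b i) / M)) t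
      have h2 := mul_le_mul_of_nonneg_left h1 hM.le
      refine le_trans (le_of_eq ?_) h2
      simp only [Finset.mul_sum]
      refine Finset.sum_congr rfl fun i _ => ?_
      field_simp
    rw [abs_le']
    have h1 := hle true
    have h2 := hle false
    simp only [if_true, Bool.false_eq_true, if_false, one_mul, neg_mul] at h1 h2
    exact ⟨by simpa using h1, by simpa using h2⟩
  refine (pE_mono hq hpt).trans ?_
  rw [pE_const_mul, mul_comm 2 M, mul_assoc]
  refine mul_le_mul_of_nonneg_left (key.trans ?_) hM.le
  rw [div_inv_eq_mul, inv_pow, Real.sq_sqrt (by positivity), inv_mul_cancel₀ (by positivity)]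
  have : Real.log (Fintype.card Bool : ℕ) ≤ 1 := by
    have := Real.log_two_lt_d9
    simp only [Fintype.card_bool, Nat.cast_ofNat]; linarith
  exact mul_le_mul_of_nonneg_right (by linarith) (by positivity)

end FiniteProb

/-! ### Symmetrization and contraction -/

section Symmetrization

variable {I β Θ ι X Y : Type*} [Fintype I] [DecidableEq I]

/-- The sign encoded by a Boolean. -/
def sg (b : Bool) : ℝ := if b then 1 else -1

@[simp] lemma sg_not (b : Bool) : sg (!b) = - sg b := by cases b <;> simp [sg]

@[simp] lemma abs_sg (b : Bool) : |sg b| = 1 := by cases b <;> simp [sg]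

omit [Fintype I] [DecidableEq I] in
lemma sum_unif_bool_sg (i : I) : ∑ e, unif I Bool i e * sg e = 0 := by
  simp [unif, sg]

lemma exists_sg_mul_eq_abs (a : ℝ) : ∃ b, sg b * a = |a| := by
  rcases le_total 0 a with h | h
  · exact ⟨true, by simp [sg, abs_of_nonneg h]⟩
  · exact ⟨false, by simp [sg, abs_of_nonpos h]⟩

lemma sg_mul_le_abs (b : Bool) (a : ℝ) : sg b * a ≤ |a| := by
  cases b
  · simpa [sg] using neg_le_abs a
  · simpa [sg] using le_abs_self a

lemma pE_unif_equiv [Fintype β] (σ : (I → β) ≃ (I → β)) (f : (I → β) → ℝ) :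
    pE (unif I β) (fun b => f (σ b)) = pE (unif I β) f := by
  simp only [pE, unif, Finset.prod_const, ← Finset.mul_sum]
  rw [Equiv.sum_comp σ f]

/-- Flipping the sign of one coordinate. -/
def flipAt (j : I) : (I → Bool) ≃ (I → Bool) :=
  Function.Involutive.toPerm (fun e => Function.update e j (!e j)) (by intro e; simp)

omit [Fintype I] in
lemma flipAt_same (j : I) (e : I → Bool) : flipAt j e j = !e j := by
  change Function.update e j (!e j) j = _
  simp

omit [Fintype I] in
lemma flipAt_ne {i j : I} (h : i ≠ j) (e : I → Bool) : flipAt j e i = e i := by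
  change Function.update e j (!e j) i = _
  simp [h]

lemma sup_add_sup_two_point [Finite Θ] [Nonempty Θ] (h f φ : Θ → ℝ)
    (hφ : ∀ t t', |φ t - φ t'| ≤ |f t - f t'|) :
    (⨆ t, h t + φ t) + (⨆ t, h t + -φ t) ≤ (⨆ t, h t + f t) + (⨆ t, h t + -f t) := by
  obtain ⟨t, ht⟩ := exists_eq_ciSup_of_finite (f := fun t => h t + φ t)
  obtain ⟨t', ht'⟩ := exists_eq_ciSup_of_finite (f := fun t => h t + -φ t)
  rw [← ht, ← ht']
  have h1 := le_sup_fin (fun t => h t + f t) t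
  have h2 := le_sup_fin (fun t => h t + f t) t'
  have h3 := le_sup_fin (fun t => h t + -f t) t
  have h4 := le_sup_fin (fun t => h t + -f t) t'
  have h5 := (le_abs_self _).trans (hφ t t')
  rcases abs_cases (f t - f t') with ⟨ha, _⟩ | ⟨ha, _⟩ <;> linarith

lemma pE_contraction_step [Finite Θ] [Nonempty Θ] (j : I) (h : Θ → (I → Bool) → ℝ)
    (hh : ∀ t e, h t (flipAt j e) = h t e) (f φ : Θ → ℝ)
    (hφ : ∀ t t', |φ t - φ t'| ≤ |f t - f t'|) :
    pE (unif I Bool) (fun e => ⨆ t, h t e + sg (e j) * φ t) ≤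
      pE (unif I Bool) (fun e => ⨆ t, h t e + sg (e j) * f t) := by
  have key : ∀ g : Θ → ℝ, 2 * pE (unif I Bool) (fun e => ⨆ t, h t e + sg (e j) * g t) =
      pE (unif I Bool) (fun e => (⨆ t, h t e + sg (e j) * g t) +
        ⨆ t, h t e + sg (!e j) * g t) := by
    intro g
    have h1 := pE_unif_equiv (flipAt j) (fun e => ⨆ t, h t e + sg (e j) * g t)
    simp only [flipAt_same, hh] at h1
    rw [pE_add, h1]; ring
  suffices 2 * pE (unif I Bool) (fun e => ⨆ t, h t e + sg (e j) * φ t) ≤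
      2 * pE (unif I Bool) (fun e => ⨆ t, h t e + sg (e j) * f t) by linarith
  rw [key, key]
  refine pE_mono isLaw_unif fun e => ?_
  have := sup_add_sup_two_point (fun t => h t e) f φ hφ
  cases e j
  · simp only [sg, Bool.false_eq_true, if_false, Bool.not_false, if_true, one_mul, neg_mul]
    linarith
  · simpa only [sg, Bool.false_eq_true, if_false, Bool.not_true, if_true, one_mul, neg_mul]

/-- The contraction principle for the positive part. -/
lemma pE_contraction [Finite Θ] [Nonempty Θ] (f : Θ → I → ℝ) :
    pE (unif I Bool) (fun e => ⨆ t, ∑ i, sg (e i) * max (f t i) 0) ≤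
      pE (unif I Bool) (fun e => ⨆ t, ∑ i, sg (e i) * f t i) := by
  have key : ∀ J : Finset I, pE (unif I Bool) (fun e => ⨆ t, ∑ i, sg (e i) * max (f t i) 0) ≤
      pE (unif I Bool) (fun e => ⨆ t, ∑ i, sg (e i) * if i ∈ J then f t i else max (f t i) 0) := by
    intro J
    induction J using Finset.induction_on with
    | empty => simp
    | insert j J hj ih =>
      refine ih.trans ?_
      have split : ∀ (e : I → Bool) (a : I → ℝ), ∑ i, sg (e i) * a i =
          ∑ i ∈ Finset.univ.erase j, sg (e i) * a i + sg (e j) * a j := by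
        intro e a
        rw [Finset.sum_erase_add _ _ (Finset.mem_univ j)]
      simp only [split]
      have hrest : ∀ (e : I → Bool) t, ∑ i ∈ Finset.univ.erase j,
            sg (e i) * (if i ∈ insert j J then f t i else max (f t i) 0) =
          ∑ i ∈ Finset.univ.erase j, sg (e i) * (if i ∈ J then f t i else max (f t i) 0) := by
        intro e t
        refine Finset.sum_congr rfl fun i hi => ?_
        simp [Finset.ne_of_mem_erase hi]
      simp only [hrest, hj, if_false, Finset.mem_insert_self, if_true]
      refine pE_contraction_step j _ (fun t e => ?_) _ _ fun t t' => ?_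
      · refine Finset.sum_congr rfl fun i hi => ?_
        rw [flipAt_ne (Finset.ne_of_mem_erase hi)]
      · exact abs_max_sub_max_le_abs _ _ _
  simpa using key Finset.univ

/-- Symmetrization for suprema of empirical sums. -/
lemma pE_symmetrization [Fintype β] {q : I → β → ℝ} (hq : IsLaw q) [Finite Θ] [Nonempty Θ]
    (φ : Θ → I → β → ℝ) :
    pE q (fun x => ⨆ t, (∑ i, φ t i (x i) - ∑ i, ∑ ω, q i ω * φ t i ω)) ≤
      2 * pE q (fun x => pE (unif I Bool) (fun e => ⨆ t, ∑ i, sg (e i) * φ t i (x i))) := by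
  set D : (I → β) → (I → β) → ℝ := fun x y => ⨆ t, ∑ i, (φ t i (x i) - φ t i (y i)) with hD
  set R : (I → β) → (I → Bool) → ℝ := fun x e => ⨆ t, ∑ i, sg (e i) * φ t i (x i) with hR
  have h1 : pE q (fun x => ⨆ t, (∑ i, φ t i (x i) - ∑ i, ∑ ω, q i ω * φ t i ω)) ≤
      pE q (fun x => pE q (fun y => D x y)) := by
    refine pE_mono hq fun x => ciSup_le fun t => ?_
    have : ∑ i, φ t i (x i) - ∑ i, ∑ ω, q i ω * φ t i ω =
        pE q (fun y => ∑ i, (φ t i (x i) - φ t i (y i))) := by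
      simp only [Finset.sum_sub_distrib]
      rw [pE_sub, pE_const hq, pE_sum]
      simp only [pE_eval hq]
    rw [this]
    exact pE_mono hq fun y => le_sup_fin (fun t => ∑ i, (φ t i (x i) - φ t i (y i))) t
  have h2 : ∀ e : I → Bool, pE q (fun x => pE q (fun y => D x y)) ≤
      pE q (fun x => R x e) + pE q (fun y => R y (fun i => !e i)) := by
    intro e
    rw [pE_pE_mix q e]
    have h3 : pE q (fun x => R x e) + pE q (fun y => R y (fun i => !e i)) =
        pE q (fun x => pE q (fun y => R x e + R y (fun i => !e i))) := by
      simp only [pE_add, pE_const hq]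
    rw [h3]
    refine pE_mono hq fun x => pE_mono hq fun y => ciSup_le fun t => ?_
    refine le_trans (le_of_eq ?_) (add_le_add
      (le_sup_fin (fun t => ∑ i, sg (e i) * φ t i (x i)) t)
      (le_sup_fin (fun t => ∑ i, sg (!e i) * φ t i (y i)) t))
    rw [← Finset.sum_add_distrib]
    refine Finset.sum_congr rfl fun i _ => ?_
    by_cases h : e i = true
    · simp [h, sg]; ring
    · simp only [Bool.not_eq_true] at h
      simp [h, sg]; ring
  have h4 : pE q (fun x => pE q (fun y => D x y)) ≤
      pE (unif I Bool) (fun e => pE q (fun x => R x e) + pE q (fun y => R y (fun i => !e i))) := by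
    rw [← pE_const (isLaw_unif (I := I) (β := Bool)) (pE q (fun x => pE q (fun y => D x y)))]
    exact pE_mono isLaw_unif h2
  have h5 : pE (unif I Bool) (fun e => pE q (fun y => R y (fun i => !e i))) =
      pE (unif I Bool) (fun e => pE q (fun y => R y e)) :=
    pE_unif_equiv (Equiv.piCongrRight fun _ => Equiv.boolNot) (fun e => pE q (fun y => R y e))
  refine h1.trans (h4.trans (le_of_eq ?_))
  rw [pE_add, h5, pE_comm q]
  ring

end Symmetrization

/-! ### Cut norms of families of matrices -/

section Cut

variable {I J β Θ ι X Y X' Y' : Type*}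

/-- The (unnormalized) weighted cut norm of a finite family of matrices. -/
def cut [Fintype ι] (wt : ι → ℝ) (V : ι → Y → X → ℝ) : ℝ :=
  ⨆ ST : Finset Y × Finset X, ∑ n, wt n * |∑ y ∈ ST.1, ∑ x ∈ ST.2, V n y x|

variable [Fintype ι] {wt : ι → ℝ}

lemma le_cut [Finite X] [Finite Y] (wt : ι → ℝ) (V : ι → Y → X → ℝ) (S : Finset Y)
    (T : Finset X) : ∑ n, wt n * |∑ y ∈ S, ∑ x ∈ T, V n y x| ≤ cut wt V :=
  le_sup_fin (fun ST : Finset Y × Finset X =>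
    ∑ n, wt n * |∑ y ∈ ST.1, ∑ x ∈ ST.2, V n y x|) (S, T)

lemma cut_le {V : ι → Y → X → ℝ} {c : ℝ}
    (h : ∀ S T, ∑ n, wt n * |∑ y ∈ S, ∑ x ∈ T, V n y x| ≤ c) : cut wt V ≤ c :=
  ciSup_le fun ST => h ST.1 ST.2

lemma cut_nonneg [Finite X] [Finite Y] (V : ι → Y → X → ℝ) : 0 ≤ cut wt V := by
  simpa using le_cut wt V ∅ ∅

lemma cut_add_le [Finite X] [Finite Y] (hwt : ∀ n, 0 ≤ wt n) (V V' : ι → Y → X → ℝ) :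
    cut wt (fun n y x => V n y x + V' n y x) ≤ cut wt V + cut wt V' := by
  refine cut_le fun S T => ?_
  refine le_trans ?_ (add_le_add (le_cut wt V S T) (le_cut wt V' S T))
  rw [← Finset.sum_add_distrib]
  refine Finset.sum_le_sum fun n _ => ?_
  rw [← mul_add]
  refine mul_le_mul_of_nonneg_left ?_ (hwt n)
  simp only [Finset.sum_add_distrib]
  exact abs_add_le _ _

lemma cut_le_of_sum_abs_le [Fintype X] [Fintype Y] (hwt : ∀ n, 0 ≤ wt n) (hwt1 : ∑ n, wt n ≤ 1)
    (V : ι → Y → X → ℝ) {c : ℝ} (hc : 0 ≤ c) (h : ∀ n, ∑ y, ∑ x, |V n y x| ≤ c) :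
    cut wt V ≤ c := by
  refine cut_le fun S T => ?_
  calc ∑ n, wt n * |∑ y ∈ S, ∑ x ∈ T, V n y x| ≤ ∑ n, wt n * c := by
        refine Finset.sum_le_sum fun n _ => mul_le_mul_of_nonneg_left ?_ (hwt n)
        refine le_trans ?_ (h n)
        refine (Finset.abs_sum_le_sum_abs _ _).trans ?_
        refine (Finset.sum_le_sum fun y _ => Finset.abs_sum_le_sum_abs _ _).trans ?_
        refine (Finset.sum_le_sum_of_subset_of_nonneg (Finset.subset_univ S) fun y _ _ =>
          Finset.sum_nonneg fun _ _ => abs_nonneg _).trans ?_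
        exact Finset.sum_le_sum fun y _ => Finset.sum_le_sum_of_subset_of_nonneg
          (Finset.subset_univ T) fun _ _ _ => abs_nonneg _
    _ ≤ c := by rw [← Finset.sum_mul]; exact mul_le_of_le_one_left hc hwt1

lemma cut_pE_le [Fintype I] [DecidableEq I] [Fintype β] {q : I → β → ℝ} (hq : IsLaw q)
    [Finite X] [Finite Y] (hwt : ∀ n, 0 ≤ wt n) (V : (I → β) → ι → Y → X → ℝ) :
    cut wt (fun n y x => pE q (fun b => V b n y x)) ≤ pE q (fun b => cut wt (V b)) := by
  refine cut_le fun S T => ?_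
  refine le_trans ?_ (pE_mono hq fun b => le_cut wt (V b) S T)
  rw [pE_sum]
  refine Finset.sum_le_sum fun n _ => ?_
  rw [pE_const_mul]
  refine mul_le_mul_of_nonneg_left ?_ (hwt n)
  simp only [← pE_sum]
  exact pE_abs_le hq _

/-- Relabelling rows and columns along equivalences does not change the cut norm. -/
lemma cut_comp_equiv_le [Finite X] [Finite Y] (e : Y' ≃ Y) (e' : X' ≃ X) (V : ι → Y → X → ℝ) :
    cut wt (fun n y x => V n (e y) (e' x)) ≤ cut wt V := by
  refine cut_le fun S T => ?_
  refine le_trans (le_of_eq ?_) (le_cut wt V (S.map e.toEmbedding) (T.map e'.toEmbedding))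
  simp

lemma cut_swap_le [Finite X] [Finite Y] (V : ι → Y → X → ℝ) :
    cut wt (fun n x y => V n y x) ≤ cut wt V := by
  refine cut_le fun S T => ?_
  refine le_trans (le_of_eq ?_) (le_cut wt V T S)
  refine Finset.sum_congr rfl fun n _ => ?_
  rw [Finset.sum_comm]

/-- Linear functionals in the sign vector and the row set appearing in the cut norm. -/
def rowForm (wt : ι → ℝ) (V : ι → Y → X → ℝ) (t : (ι → Bool) × Finset Y) (x : X) : ℝ :=
  ∑ n, wt n * (sg (t.1 n) * ∑ y ∈ t.2, V n y x)

lemma sum_rowForm (V : ι → Y → X → ℝ) (t : (ι → Bool) × Finset Y) (T : Finset X) :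
    ∑ x ∈ T, rowForm wt V t x = ∑ n, wt n * (sg (t.1 n) * ∑ y ∈ t.2, ∑ x ∈ T, V n y x) := by
  unfold rowForm
  rw [Finset.sum_comm]
  refine Finset.sum_congr rfl fun n _ => ?_
  rw [Finset.sum_comm (s := t.2), Finset.mul_sum, Finset.mul_sum]

lemma cut_le_sup_rowForm [Finite Y] [Fintype X] (V : ι → Y → X → ℝ) :
    cut wt V ≤ ⨆ t, ∑ x, max (rowForm wt V t x) 0 := by
  refine cut_le fun S T => ?_
  choose s hs using fun n => exists_sg_mul_eq_abs (∑ y ∈ S, ∑ x ∈ T, V n y x)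
  have h := le_sup_fin (fun t => ∑ x, max (rowForm wt V t x) 0) (s, S)
  refine le_trans ?_ h
  calc ∑ n, wt n * |∑ y ∈ S, ∑ x ∈ T, V n y x| = ∑ x ∈ T, rowForm wt V (s, S) x := by
        rw [sum_rowForm]; simp [hs]
    _ ≤ ∑ x ∈ T, max (rowForm wt V (s, S) x) 0 := Finset.sum_le_sum fun x _ => le_max_left _ _
    _ ≤ _ := Finset.sum_le_sum_of_subset_of_nonneg (Finset.subset_univ T)
        fun _ _ _ => le_max_right _ _

lemma sum_max_rowForm_le_cut [Finite Y] [Fintype X] (hwt : ∀ n, 0 ≤ wt n) (V : ι → Y → X → ℝ)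
    (t : (ι → Bool) × Finset Y) : ∑ x, max (rowForm wt V t x) 0 ≤ cut wt V := by
  classical
  have : ∑ x, max (rowForm wt V t x) 0 =
      ∑ x ∈ Finset.univ.filter (fun x => 0 ≤ rowForm wt V t x), rowForm wt V t x := by
    rw [Finset.sum_filter]
    refine Finset.sum_congr rfl fun x _ => ?_
    split_ifs with h
    · exact max_eq_left h
    · exact max_eq_right (not_le.1 h).le
  rw [this, sum_rowForm]
  refine le_trans ?_ (le_cut wt V t.2 (Finset.univ.filter (fun x => 0 ≤ rowForm wt V t x)))
  exact Finset.sum_le_sum fun n _ => mul_le_mul_of_nonneg_left (sg_mul_le_abs _ _) (hwt n)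

/-- Sampling the columns of a family of matrices uniformly at random does not increase the
normalized cut norm by much. -/
lemma pE_cut_sample_cols_le [Fintype I] [DecidableEq I] [Fintype X] [Nonempty X] [Fintype Y]
    (hwt : ∀ n, 0 ≤ wt n) (hwt1 : ∑ n, wt n ≤ 1) (V : ι → Y → X → ℝ) {M : ℝ} (hM : 0 < M)
    (hV : ∀ n y x, |V n y x| ≤ M) :
    pE (unif I X) (fun x => cut wt (fun n y i => V n y (x i))) ≤
      Fintype.card I / Fintype.card X * cut wt V +
        4 * Fintype.card Y * M * √(Fintype.card I) := by
  set f := rowForm wt V with hf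
  set c : ℝ := Fintype.card I / Fintype.card X * cut wt V with hc
  have hmean : ∀ t, ∑ i : I, ∑ x, unif I X i x * max (f t x) 0 ≤ c := by
    intro t
    simp only [unif, ← Finset.mul_sum, Finset.sum_const, Finset.card_univ, nsmul_eq_mul]
    rw [← mul_assoc, inv_mul_eq_div]
    exact mul_le_mul_of_nonneg_left (sum_max_rowForm_le_cut hwt V t) (by positivity)
  have h1 : ∀ x : I → X, cut wt (fun n y i => V n y (x i)) ≤
      c + ⨆ t, (∑ i, max (f t (x i)) 0 - ∑ i : I, ∑ x, unif I X i x * max (f t x) 0) := by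
    intro x
    refine (cut_le_sup_rowForm _).trans (ciSup_le fun t => ?_)
    have h2 := le_sup_fin (fun t => ∑ i, max (f t (x i)) 0 -
      ∑ i : I, ∑ x, unif I X i x * max (f t x) 0) t
    have h3 := hmean t
    have h4 : ∀ i, rowForm wt (fun n y i => V n y (x i)) t i = f t (x i) := fun i => rfl
    simp only [h4]
    linarith
  refine (pE_mono isLaw_unif h1).trans ?_
  rw [pE_add, pE_const isLaw_unif]
  refine add_le_add le_rfl ?_
  refine (pE_symmetrization isLaw_unif (fun t (_ : I) x => max (f t x) 0)).trans ?_
  have h5 : pE (unif I X) (fun x => pE (unif I Bool) (fun e =>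
      ⨆ t, ∑ i, sg (e i) * max (f t (x i)) 0)) ≤ 2 * Fintype.card Y * M * √(Fintype.card I) := by
    rw [← pE_const (isLaw_unif (I := I) (β := X)) (2 * Fintype.card Y * M * √(Fintype.card I))]
    refine pE_mono isLaw_unif fun x => ?_
    refine (pE_contraction (fun t i => f t (x i))).trans ?_
    have h6 : ∀ e : I → Bool, (⨆ t, ∑ i, sg (e i) * f t (x i)) ≤
        ∑ n, wt n * ∑ y, |∑ i, sg (e i) * V n y (x i)| := by
      intro e
      refine ciSup_le fun t => ?_
      have h7 : ∑ i, sg (e i) * f t (x i) =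
          ∑ n, wt n * (sg (t.1 n) * ∑ y ∈ t.2, ∑ i, sg (e i) * V n y (x i)) := by
        simp only [hf, rowForm, Finset.mul_sum]
        rw [Finset.sum_comm]
        refine Finset.sum_congr rfl fun n _ => ?_
        rw [Finset.sum_comm]
        refine Finset.sum_congr rfl fun y _ => Finset.sum_congr rfl fun i _ => by ring
      rw [h7]
      refine Finset.sum_le_sum fun n _ => mul_le_mul_of_nonneg_left ?_ (hwt n)
      refine (sg_mul_le_abs _ _).trans ((Finset.abs_sum_le_sum_abs _ _).trans ?_)
      exact Finset.sum_le_sum_of_subset_of_nonneg (Finset.subset_univ _)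
        fun _ _ _ => abs_nonneg _
    refine (pE_mono isLaw_unif h6).trans ?_
    rw [pE_sum]
    have h8 : ∀ n, pE (unif I Bool) (fun e => wt n * ∑ y, |∑ i, sg (e i) * V n y (x i)|) ≤
        wt n * (2 * Fintype.card Y * M * √(Fintype.card I)) := by
      intro n
      rw [pE_const_mul, pE_sum]
      refine mul_le_mul_of_nonneg_left ?_ (hwt n)
      refine (Finset.sum_le_sum fun y _ => pE_abs_sum_le (M := M) isLaw_unif
        (fun i e => sg e * V n y (x i)) hM ?_ ?_).trans ?_
      · intro i ω; rw [abs_mul, abs_sg, one_mul]; exact hV _ _ _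
      · intro i
        have := sum_unif_bool_sg i
        simp only [← mul_assoc, ← Finset.sum_mul, this, zero_mul]
      · rw [Finset.sum_const, Finset.card_univ, nsmul_eq_mul]
        exact le_of_eq (by ring)
    refine (Finset.sum_le_sum fun n _ => h8 n).trans ?_
    rw [← Finset.sum_mul]
    exact mul_le_of_le_one_left (by positivity) hwt1
  linarith

end Cut

section CutMore

variable {ι X Y X' Y' : Type*} [Fintype ι] {wt : ι → ℝ}

lemma cut_neg_le [Finite X] [Finite Y] (V : ι → Y → X → ℝ) :
    cut wt (fun n y x => -V n y x) ≤ cut wt V := by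
  refine cut_le fun S T => ?_
  refine le_trans (le_of_eq ?_) (le_cut wt V S T)
  simp [Finset.sum_neg_distrib]

/-- Restricting to a rectangle does not increase the cut norm. -/
lemma cut_ite_le [Finite X] [Finite Y] (P : Y → Bool) (Q : X → Bool) (V : ι → Y → X → ℝ)
    {c : ℝ} (hc : 0 ≤ c) :
    cut wt (fun n y x => c * if P y = true ∧ Q x = true then V n y x else 0) ≤ c * cut wt V := by
  refine cut_le fun S T => ?_
  refine le_trans (le_of_eq ?_) (mul_le_mul_of_nonneg_left
    (le_cut wt V (S.filter fun y => P y = true) (T.filter fun x => Q x = true)) hc)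
  rw [Finset.mul_sum]
  refine Finset.sum_congr rfl fun n _ => ?_
  have : ∑ y ∈ S, ∑ x ∈ T, (c * if P y = true ∧ Q x = true then V n y x else 0) =
      c * ∑ y ∈ S with P y = true, ∑ x ∈ T with Q x = true, V n y x := by
    rw [Finset.sum_filter, Finset.mul_sum]
    refine Finset.sum_congr rfl fun y _ => ?_
    rw [← Finset.mul_sum]
    congr 1
    by_cases h : P y = true <;> simp [h, Finset.sum_filter]
  rw [this, abs_mul, abs_of_nonneg hc]
  ring

/-- The cut norm controls all bilinear forms with coefficients in `[0, 1]`. -/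
lemma sum_abs_frac_le_cut [Fintype X] [Fintype Y] (hwt : ∀ n, 0 ≤ wt n) (V : ι → Y → X → ℝ)
    {s : Y → ℝ} {t : X → ℝ} (hs : ∀ y, s y ∈ Set.Icc (0 : ℝ) 1)
    (ht : ∀ x, t x ∈ Set.Icc (0 : ℝ) 1) :
    ∑ n, wt n * |∑ y, ∑ x, s y * t x * V n y x| ≤ cut wt V := by
  classical
  let q : Y → Bool → ℝ := fun y b => if b then s y else 1 - s y
  let q' : X → Bool → ℝ := fun x b => if b then t x else 1 - t x
  have hq : IsLaw q := by
    refine ⟨fun y b => ?_, fun y => by simp [q]⟩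
    have := hs y
    cases b <;> simp [q, this.1, this.2]
  have hq' : IsLaw q' := by
    refine ⟨fun y b => ?_, fun y => by simp [q']⟩
    have := ht y
    cases b <;> simp [q', this.1, this.2]
  have h1 : ∀ n, ∑ y, ∑ x, s y * t x * V n y x = pE q (fun b => pE q' (fun b' =>
      ∑ y with b y = true, ∑ x with b' x = true, V n y x)) := by
    intro n
    simp only [Finset.sum_filter]
    simp only [pE_sum]
    refine Finset.sum_congr rfl fun y _ => ?_
    have : ∀ b : Y → Bool, pE q' (fun b' => if b y = true then
        ∑ x, (if b' x = true then V n y x else 0) else 0) =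
        if b y = true then ∑ x, t x * V n y x else 0 := by
      intro b
      by_cases h : b y = true
      · simp only [h, if_true, pE_sum]
        refine Finset.sum_congr rfl fun x _ => ?_
        rw [pE_eval hq' x (fun c => if c = true then V n y x else 0)]
        simp [q']
      · simp [h, pE]
    simp only [this]
    rw [pE_eval hq y (fun c => if c = true then ∑ x, t x * V n y x else 0)]
    simp [q, Finset.mul_sum, mul_assoc]
  calc ∑ n, wt n * |∑ y, ∑ x, s y * t x * V n y x|
      ≤ ∑ n, wt n * pE q (fun b => pE q' (fun b' =>
        |∑ y with b y = true, ∑ x with b' x = true, V n y x|)) := by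
        refine Finset.sum_le_sum fun n _ => mul_le_mul_of_nonneg_left ?_ (hwt n)
        rw [h1]
        exact (pE_abs_le hq _).trans (pE_mono hq fun b => pE_abs_le hq' _)
    _ = pE q (fun b => pE q' (fun b' =>
        ∑ n, wt n * |∑ y with b y = true, ∑ x with b' x = true, V n y x|)) := by
        simp only [pE_sum, pE_const_mul]
    _ ≤ pE q (fun b => pE q' (fun b' => cut wt V)) :=
        pE_mono hq fun b => pE_mono hq' fun b' => le_cut wt V _ _
    _ = cut wt V := by rw [pE_const hq', pE_const hq]

/-- Blowing up every vertex into `card B` copies. -/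
lemma cut_blowup_le {I B : Type*} [Fintype I] [Fintype B]
    (hwt : ∀ n, 0 ≤ wt n) (V : ι → I → I → ℝ) :
    cut wt (fun n (y y' : I × B) => V n y.1 y'.1) ≤ (Fintype.card B : ℝ) ^ 2 * cut wt V := by
  classical
  refine cut_le fun S T => ?_
  set M : ℝ := (Fintype.card B : ℝ) with hM
  let cnt : Finset (I × B) → I → ℝ := fun S i => ∑ β : B, if (i, β) ∈ S then 1 else 0
  have hcnt0 : ∀ S i, 0 ≤ cnt S i := fun S i =>
    Finset.sum_nonneg fun β _ => by split_ifs <;> norm_num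
  have hcnt : ∀ S i, cnt S i ≤ M := by
    intro S i
    refine (Finset.sum_le_sum (g := fun _ => (1 : ℝ)) fun β _ => ?_).trans (by simp [hM])
    split_ifs <;> norm_num
  have hfrac : ∀ S i, cnt S i / M ∈ Set.Icc (0 : ℝ) 1 := fun S i =>
    ⟨div_nonneg (hcnt0 S i) (by positivity), div_le_one_of_le₀ (hcnt S i) (by positivity)⟩
  have hdiv : ∀ S i, cnt S i = M * (cnt S i / M) := by
    intro S i
    rcases eq_or_ne M 0 with h | h
    · have := hcnt S i
      have := hcnt0 S i
      rw [h] at *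
      simp; linarith
    · field_simp
  have hsum : ∀ (S : Finset (I × B)) (f : I → ℝ), ∑ y ∈ S, f y.1 = ∑ i, cnt S i * f i := by
    intro S f
    simp only [cnt, Finset.sum_mul]
    rw [← Fintype.sum_prod_type' (f := fun i β => (if (i, β) ∈ S then (1 : ℝ) else 0) * f i)]
    simp [ite_mul, Finset.sum_ite_mem]
  refine le_trans (le_of_eq ?_) (mul_le_mul_of_nonneg_left
    (sum_abs_frac_le_cut hwt V (hfrac S) (hfrac T)) (by positivity))
  rw [Finset.mul_sum]
  refine Finset.sum_congr rfl fun n _ => ?_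
  have : ∑ y ∈ S, ∑ y' ∈ T, V n y.1 y'.1 =
      M ^ 2 * ∑ i, ∑ j, cnt S i / M * (cnt T j / M) * V n i j := by
    rw [hsum S (fun i => ∑ y' ∈ T, V n i y'.1), Finset.mul_sum]
    refine Finset.sum_congr rfl fun i _ => ?_
    rw [hsum T (fun j => V n i j), Finset.mul_sum, Finset.mul_sum]
    refine Finset.sum_congr rfl fun j _ => ?_
    conv_lhs => rw [hdiv S i, hdiv T j]
    ring
  rw [this, abs_mul, abs_of_nonneg (by positivity : (0:ℝ) ≤ M ^ 2)]
  ring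

end CutMore

section Regularity

variable {ι X : Type*} [Fintype ι] {wt : ι → ℝ}

lemma sq_sum_wt_le (hwt : ∀ n, 0 ≤ wt n) (hwt1 : ∑ n, wt n ≤ 1) (a : ι → ℝ) :
    (∑ n, wt n * a n) ^ 2 ≤ ∑ n, wt n * a n ^ 2 := by
  have h := Finset.sum_mul_sq_le_sq_mul_sq Finset.univ (fun n => √(wt n))
    (fun n => √(wt n) * a n)
  have e1 : ∀ n, √(wt n) * (√(wt n) * a n) = wt n * a n := fun n => by
    rw [← mul_assoc, Real.mul_self_sqrt (hwt n)]
  simp only [e1, mul_pow, Real.sq_sqrt (hwt _)] at h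
  refine h.trans (mul_le_of_le_one_left ?_ hwt1)
  exact Finset.sum_nonneg fun n _ => mul_nonneg (hwt n) (sq_nonneg _)

/-- Subtracting the average over a rectangle decreases the energy. -/
lemma sum_sq_sub_rectangle_le [Fintype X] [Nonempty X] (D : X → X → ℝ) (S T : Finset X)
    [DecidableEq X] {c : ℝ}
    (hc : c = (∑ x ∈ S, ∑ y ∈ T, D x y) / (Fintype.card X : ℝ) ^ 2) :
    ∑ x, ∑ y, (D x y - c * if x ∈ S ∧ y ∈ T then 1 else 0) ^ 2 ≤
      ∑ x, ∑ y, D x y ^ 2 - c ^ 2 * (Fintype.card X : ℝ) ^ 2 := by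
  have hN : (0 : ℝ) < Fintype.card X := by exact_mod_cast Fintype.card_pos
  set N : ℝ := (Fintype.card X : ℝ)
  have e1 : ∀ f : X → X → ℝ, ∑ x, ∑ y, (if x ∈ S ∧ y ∈ T then f x y else 0) =
      ∑ x ∈ S, ∑ y ∈ T, f x y := by
    intro f
    rw [← Finset.sum_subset (Finset.subset_univ S)]
    · refine Finset.sum_congr rfl fun x hx => ?_
      rw [← Finset.sum_subset (Finset.subset_univ T)]
      · exact Finset.sum_congr rfl fun y hy => by simp [hx, hy]
      · intro y _ hy; simp [hy]
    · intro x _ hx; simp [hx]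
  have e2 : ∀ x y, (D x y - c * if x ∈ S ∧ y ∈ T then 1 else 0) ^ 2 =
      D x y ^ 2 + if x ∈ S ∧ y ∈ T then (c ^ 2 - 2 * c * D x y) else 0 := by
    intro x y
    split_ifs <;> ring
  simp only [e2, Finset.sum_add_distrib, e1]
  simp only [Finset.sum_sub_distrib, ← Finset.mul_sum, Finset.sum_const, nsmul_eq_mul]
  have e3 : ∑ x ∈ S, ∑ y ∈ T, D x y = c * N ^ 2 := by rw [hc]; field_simp
  rw [e3]
  have hS : (S.card : ℝ) ≤ N := Nat.cast_le.2 (Finset.card_le_univ S)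
  have hT : (T.card : ℝ) ≤ N := Nat.cast_le.2 (Finset.card_le_univ T)
  have h4 : (S.card : ℝ) * T.card ≤ N * N := mul_le_mul hS hT (Nat.cast_nonneg _) hN.le
  nlinarith [sq_nonneg c, mul_le_mul_of_nonneg_left h4 (sq_nonneg c)]

/-- A partition into at most `4 ^ r` classes with a step approximation which lowers the energy
of the remainder by `r ε²`. -/
def StepApprox [Fintype X] (wt : ι → ℝ) (u : ι → X → X → ℝ) (ε : ℝ) (r : ℕ)
    (p : X → Fin r → Bool × Bool)
    (γ : ι → (Fin r → Bool × Bool) → (Fin r → Bool × Bool) → ℝ) : Prop :=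
  (∀ n a b, |γ n a b| ≤ r) ∧
  (∀ n, ∑ x, ∑ y, (u n x y - γ n (p x) (p y)) ^ 2 ≤ (Fintype.card X : ℝ) ^ 2) ∧
  ∑ n, wt n * ∑ x, ∑ y, (u n x y - γ n (p x) (p y)) ^ 2 ≤
    (Fintype.card X : ℝ) ^ 2 * (1 - r * ε ^ 2)

/-- The weak regularity lemma for finite weighted families of matrices. -/
lemma exists_stepApprox [Fintype X] [Nonempty X] (hwt : ∀ n, 0 ≤ wt n) (hwt1 : ∑ n, wt n ≤ 1)
    (u : ι → X → X → ℝ) (hu : ∀ n x y, u n x y ∈ Set.Icc (0 : ℝ) 1) {ε : ℝ} (hε : 0 < ε)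
    {R : ℕ} (hR : 1 < (R + 1) * ε ^ 2) :
    ∃ r ≤ R, ∃ (p : X → Fin r → Bool × Bool)
      (γ : ι → (Fin r → Bool × Bool) → (Fin r → Bool × Bool) → ℝ),
      (∀ n a b, |γ n a b| ≤ r) ∧
      cut wt (fun n x y => u n x y - γ n (p x) (p y)) ≤ ε * (Fintype.card X : ℝ) ^ 2 := by
  classical
  have hN : (0 : ℝ) < Fintype.card X := by exact_mod_cast Fintype.card_pos
  by_contra! hcon
  have key : ∀ r ≤ R + 1, ∃ p γ, StepApprox wt u ε r p γ := by
    intro r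
    induction r with
    | zero =>
      intro _
      have h0 : ∀ n, ∑ x, ∑ y, (u n x y) ^ 2 ≤ (Fintype.card X : ℝ) ^ 2 := by
        intro n
        calc ∑ x, ∑ y, (u n x y) ^ 2 ≤ ∑ x : X, ∑ y : X, (1 : ℝ) :=
              Finset.sum_le_sum fun x _ => Finset.sum_le_sum fun y _ =>
                pow_le_one₀ (hu n x y).1 (hu n x y).2
          _ = _ := by simp [sq]
      refine ⟨fun _ => Fin.elim0, fun _ _ _ => 0, by simp, by simpa using h0, ?_⟩
      simp only [sub_zero, Nat.cast_zero, zero_mul, mul_one]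
      refine (Finset.sum_le_sum fun n _ => mul_le_mul_of_nonneg_left (h0 n) (hwt n)).trans ?_
      rw [← Finset.sum_mul]
      exact mul_le_of_le_one_left (by positivity) hwt1
    | succ r ih =>
      intro hr
      obtain ⟨p, γ, h1, h2, h3⟩ := ih (by omega)
      have hlt := hcon r (by omega) p γ h1
      obtain ⟨⟨S, T⟩, hST⟩ := exists_eq_ciSup_of_finite (f := fun ST : Finset X × Finset X =>
        ∑ n, wt n * |∑ y ∈ ST.1, ∑ x ∈ ST.2, (u n y x - γ n (p y) (p x))|)
      change _ = cut wt _ at hST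
      rw [← hST] at hlt
      simp only at hlt
      set c : ι → ℝ := fun n =>
        (∑ x ∈ S, ∑ y ∈ T, (u n x y - γ n (p x) (p y))) / (Fintype.card X : ℝ) ^ 2 with hc
      have hcc : ∀ n, |∑ x ∈ S, ∑ y ∈ T, (u n x y - γ n (p x) (p y))| =
          |c n| * (Fintype.card X : ℝ) ^ 2 := by
        intro n
        rw [hc, abs_div, abs_of_pos (by positivity : (0:ℝ) < (Fintype.card X : ℝ) ^ 2)]
        field_simp
      have hstep := fun n => sum_sq_sub_rectangle_le (fun x y => u n x y - γ n (p x) (p y)) S T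
        (c := c n) rfl
      simp only [hcc, ← mul_assoc, ← Finset.sum_mul] at hlt
      have hlt2 : ε < ∑ n, wt n * |c n| := lt_of_mul_lt_mul_right hlt (by positivity)
      have hsq : ε ^ 2 ≤ ∑ n, wt n * c n ^ 2 := by
        have := sq_sum_wt_le hwt hwt1 (fun n => |c n|)
        simp only [sq_abs] at this
        nlinarith
      have hc1 : ∀ n, |c n| ≤ 1 := by
        intro n
        have := hstep n
        have h0 : 0 ≤ ∑ x, ∑ y, (u n x y - γ n (p x) (p y) -
            c n * if x ∈ S ∧ y ∈ T then 1 else 0) ^ 2 :=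
          Finset.sum_nonneg fun _ _ => Finset.sum_nonneg fun _ _ => sq_nonneg _
        have h4 := h2 n
        have h5 : c n ^ 2 * (Fintype.card X : ℝ) ^ 2 ≤ 1 * (Fintype.card X : ℝ) ^ 2 := by linarith
        exact (sq_le_one_iff_abs_le_one _).1 (le_of_mul_le_mul_right h5 (by positivity))
      refine ⟨fun x => Fin.cons (decide (x ∈ S), decide (x ∈ T)) (p x),
        fun n a b => γ n (Fin.tail a) (Fin.tail b) +
          c n * if (a 0).1 = true ∧ (b 0).2 = true then 1 else 0, ?_, ?_, ?_⟩
      · intro n a b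
        refine (abs_add_le _ _).trans ?_
        push_cast
        refine add_le_add (h1 _ _ _) ?_
        split_ifs
        · simpa using hc1 n
        · simp
      · intro n
        simp only [Fin.tail_cons, Fin.cons_zero, decide_eq_true_eq, ← sub_sub]
        have := hstep n
        have := h2 n
        have : 0 ≤ c n ^ 2 * (Fintype.card X : ℝ) ^ 2 := by positivity
        linarith
      · simp only [Fin.tail_cons, Fin.cons_zero, decide_eq_true_eq, ← sub_sub]
        refine (Finset.sum_le_sum fun n _ =>
          mul_le_mul_of_nonneg_left (hstep n) (hwt n)).trans ?_
        simp only [mul_sub, Finset.sum_sub_distrib, ← mul_assoc, ← Finset.sum_mul]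
        push_cast
        have := mul_le_mul_of_nonneg_right hsq
          (by positivity : (0:ℝ) ≤ (Fintype.card X : ℝ) ^ 2)
        linarith
  obtain ⟨p, γ, -, -, h⟩ := key (R + 1) le_rfl
  have h0 : 0 ≤ ∑ n, wt n * ∑ x, ∑ y, (u n x y - γ n (p x) (p y)) ^ 2 :=
    Finset.sum_nonneg fun n _ => mul_nonneg (hwt n) <|
      Finset.sum_nonneg fun _ _ => Finset.sum_nonneg fun _ _ => sq_nonneg _
  push_cast at h
  have : (Fintype.card X : ℝ) ^ 2 * (1 - (R + 1) * ε ^ 2) < 0 :=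
    mul_neg_of_pos_of_neg (by positivity) (by linarith)
  linarith

end Regularity

section Sampling

variable {ι I X : Type*} [Fintype ι] {wt : ι → ℝ} [Fintype I] [DecidableEq I]

lemma pE_bool_split {i j : I} (h : i ≠ j) (a : ℝ) :
    pE (unif I Bool) (fun A => 4 * if A i = true ∧ (!A j) = true then a else 0) = a := by
  have h1 : ∀ A : I → Bool, (4 * if A i = true ∧ (!A j) = true then a else 0) =
      a * ((1 + sg (A i)) * (1 - sg (A j))) := by
    intro A
    cases A i <;> cases A j <;> simp [sg] <;> ring
  have h2 : ∀ A : I → Bool, ((1 + sg (A i)) * (1 - sg (A j))) =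
      ∏ l, (if l = i then 1 + sg (A l) else if l = j then 1 - sg (A l) else 1) := by
    intro A
    rw [← Finset.mul_prod_erase _ _ (Finset.mem_univ i),
      ← Finset.mul_prod_erase _ _ (Finset.mem_erase.2 ⟨h.symm, Finset.mem_univ j⟩),
      Finset.prod_eq_one]
    · simp [h.symm]
    · intro l hl
      simp only [Finset.mem_erase] at hl
      simp [hl.1, hl.2.1]
  simp only [h1, pE_const_mul, h2]
  rw [pE_prod (unif I Bool)
    (fun l e => if l = i then 1 + sg e else if l = j then 1 - sg e else 1), Finset.prod_eq_one]
  · simp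
  · intro l _
    split_ifs <;> norm_num [unif, sg]

/-- Sampling rows and columns with independent samples. -/
lemma pE_cut_sample_le [Fintype X] [Nonempty X] (hwt : ∀ n, 0 ≤ wt n) (hwt1 : ∑ n, wt n ≤ 1)
    (V : ι → X → X → ℝ) {M : ℝ} (hM : 0 < M) (hV : ∀ n y x, |V n y x| ≤ M) :
    pE (unif I X) (fun x => pE (unif I X) (fun y => cut wt (fun n i j => V n (x i) (y j)))) ≤
      (Fintype.card I / Fintype.card X : ℝ) ^ 2 * cut wt V +
        8 * Fintype.card I * M * √(Fintype.card I) := by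
  have hN : (0 : ℝ) < Fintype.card X := by exact_mod_cast Fintype.card_pos
  have h1 : ∀ x : I → X, pE (unif I X) (fun y => cut wt (fun n i j => V n (x i) (y j))) ≤
      Fintype.card I / Fintype.card X * cut wt (fun n z i => V n (x i) z) +
        4 * Fintype.card I * M * √(Fintype.card I) := by
    intro x
    refine (pE_cut_sample_cols_le hwt hwt1 (fun n i z => V n (x i) z) hM
      fun n i z => hV _ _ _).trans ?_
    have := cut_swap_le (wt := wt) (fun n z i => V n (x i) z)
    gcongr
  refine (pE_mono isLaw_unif h1).trans ?_
  rw [pE_add, pE_const isLaw_unif, pE_const_mul]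
  have h2 := pE_cut_sample_cols_le (I := I) hwt hwt1 (fun n z z' => V n z' z) hM
    fun n i z => hV _ _ _
  have h3 : (Fintype.card I / Fintype.card X : ℝ) *
      pE (unif I X) (fun x => cut wt (fun n z i => V n (x i) z)) ≤
      Fintype.card I / Fintype.card X * (Fintype.card I / Fintype.card X * cut wt V +
        4 * Fintype.card X * M * √(Fintype.card I)) := by
    refine mul_le_mul_of_nonneg_left (h2.trans ?_) (by positivity)
    have := cut_swap_le (wt := wt) V
    gcongr
  have h4 : (Fintype.card I / Fintype.card X : ℝ) * (Fintype.card I / Fintype.card X * cut wt V +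
        4 * Fintype.card X * M * √(Fintype.card I)) =
      (Fintype.card I / Fintype.card X : ℝ) ^ 2 * cut wt V +
        4 * Fintype.card I * M * √(Fintype.card I) := by
    field_simp
  linarith

/-- The first sampling lemma: the off-diagonal part of a random square submatrix. -/
lemma pE_cut_offDiag_le [Fintype X] [Nonempty X] (hwt : ∀ n, 0 ≤ wt n) (hwt1 : ∑ n, wt n ≤ 1)
    (V : ι → X → X → ℝ) {M : ℝ} (hM : 0 < M) (hV : ∀ n y x, |V n y x| ≤ M) :
    pE (unif I X) (fun x => cut wt (fun n i j => if i = j then 0 else V n (x i) (x j))) ≤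
      4 * ((Fintype.card I / Fintype.card X : ℝ) ^ 2 * cut wt V +
        8 * Fintype.card I * M * √(Fintype.card I)) := by
  have h1 : ∀ x : I → X, cut wt (fun n i j => if i = j then 0 else V n (x i) (x j)) ≤
      pE (unif I Bool) (fun A => cut wt (fun n i j =>
        4 * if A i = true ∧ (!A j) = true then V n (x i) (x j) else 0)) := by
    intro x
    refine le_trans (le_of_eq ?_) (cut_pE_le isLaw_unif hwt _)
    congr 1
    ext n i j
    split_ifs with h
    · subst h
      simp [pE]
    · rw [pE_bool_split h]
  refine (pE_mono isLaw_unif h1).trans ?_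
  rw [pE_comm]
  rw [← pE_const (isLaw_unif (I := I) (β := Bool)) (4 * _)]
  refine pE_mono isLaw_unif fun A => ?_
  rw [pE_diag isLaw_unif A (fun x y => cut wt (fun n i j =>
        4 * if A i = true ∧ (!A j) = true then V n (x i) (y j) else 0))]
  · refine le_trans ?_ (mul_le_mul_of_nonneg_left
      (pE_cut_sample_le (I := I) hwt hwt1 V hM hV) (by norm_num))
    simp only [← pE_const_mul]
    exact pE_mono isLaw_unif fun x => pE_mono isLaw_unif fun y =>
      cut_ite_le (fun i => A i) (fun j => !A j) (fun n i j => V n (x i) (y j)) (by norm_num)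
  · intro x x' y y' hx hy
    congr 1
    ext n i j
    by_cases h : A i = true ∧ (!A j) = true
    · rw [if_pos h, if_pos h, hx i h.1, hy j (by simpa using h.2)]
    · rw [if_neg h, if_neg h]

/-- Concentration of the class sizes of a uniform sample. -/
lemma pE_count_le {A : Type*} [Fintype A] [DecidableEq A] [Fintype X] [Nonempty X] (p : X → A) :
    pE (unif I X) (fun x => ∑ a, |((Finset.univ.filter fun i => p (x i) = a).card : ℝ) -
      Fintype.card I * ((Finset.univ.filter fun z => p z = a).card : ℝ) / Fintype.card X|) ≤
      Fintype.card A * (2 * √(Fintype.card I)) := by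
  have hN : (0 : ℝ) < Fintype.card X := by exact_mod_cast Fintype.card_pos
  rw [pE_sum]
  refine (Finset.sum_le_sum (g := fun _ => 2 * √(Fintype.card I)) fun a _ => ?_).trans
    (by simp)
  set c : ℝ := ((Finset.univ.filter fun z => p z = a).card : ℝ) / Fintype.card X with hc
  have hc0 : 0 ≤ c := by positivity
  have hc1 : c ≤ 1 := div_le_one_of_le₀ (by exact_mod_cast Finset.card_le_univ _) hN.le
  have h := pE_abs_sum_le (I := I) (isLaw_unif (β := X))
    (fun _ z => (if p z = a then 1 else 0) - c) (M := 1) one_pos ?_ ?_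
  · refine le_trans (le_of_eq ?_) (h.trans (by linarith))
    congr 1
    ext x
    congr 1
    simp [Finset.sum_sub_distrib, hc]
    ring
  · intro i z
    rw [abs_le]
    split_ifs <;> constructor <;> linarith
  · intro i
    simp only [unif, ← Finset.mul_sum, Finset.sum_sub_distrib]
    simp [hc]
    field_simp
    ring

/-- Concentration of a matrix with independent entries in the cut norm. -/
lemma pE_cut_noise_le {Ω : Type*} [Fintype Ω] (hwt : ∀ n, 0 ≤ wt n) (hwt1 : ∑ n, wt n ≤ 1)
    [Nonempty I] {q : I × I → Ω → ℝ} (hq : IsLaw q) (h : ι → Ω → ℝ)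
    (hh : ∀ n ω, h n ω ∈ Set.Icc (0 : ℝ) 1) :
    pE q (fun b => cut wt (fun n i j =>
      if i = j then 0 else h n (b (i, j)) - ∑ ω, q (i, j) ω * h n ω)) ≤
      4 * Fintype.card I * √(Fintype.card I) := by
  have hk : (1 : ℝ) ≤ Fintype.card I := by exact_mod_cast Fintype.card_pos
  set k : ℝ := (Fintype.card I : ℝ) with hkdef
  have hk0 : 0 < k := by linarith
  have hs : 0 < √k := Real.sqrt_pos.2 hk0
  let d : ι → I × I → Ω → ℝ := fun n e ω =>
    if e.1 = e.2 then 0 else h n ω - ∑ ω, q e ω * h n ω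
  have hmean : ∀ n e, ∑ ω, q e ω * h n ω ∈ Set.Icc (0 : ℝ) 1 := by
    intro n e
    refine ⟨Finset.sum_nonneg fun ω _ => mul_nonneg (hq.1 _ _) (hh _ _).1, ?_⟩
    rw [← hq.2 e]
    exact Finset.sum_le_sum fun ω _ => mul_le_of_le_one_right (hq.1 _ _) (hh _ _).2
  have hd1 : ∀ n e ω, |d n e ω| ≤ 1 := by
    intro n e ω
    simp only [d]
    split_ifs
    · simp
    · have h1 := hmean n e
      have h2 := hh n ω
      rw [abs_le]
      constructor <;> linarith [h1.1, h1.2, h2.1, h2.2]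
  have hd0 : ∀ n e, ∑ ω, q e ω * d n e ω = 0 := by
    intro n e
    simp only [d]
    split_ifs
    · simp
    · simp only [mul_sub, Finset.sum_sub_distrib, ← Finset.sum_mul, hq.2]
      simp
  let f : ι → (Bool × Finset I × Finset I) → I × I → Ω → ℝ := fun n t e ω =>
    sg t.1 * if e.1 ∈ t.2.1 ∧ e.2 ∈ t.2.2 then d n e ω else 0
  have hsum : ∀ n (b : I × I → Ω) s (S T : Finset I), ∑ e, f n (s, S, T) e (b e) =
      sg s * ∑ i ∈ S, ∑ j ∈ T, d n (i, j) (b (i, j)) := by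
    intro n b s S T
    simp only [f, ← Finset.mul_sum]
    congr 1
    rw [← Finset.sum_product', ← Finset.sum_filter]
    refine Finset.sum_congr ?_ fun _ _ => rfl
    ext e; simp
  have h1 : ∀ b : I × I → Ω, cut wt (fun n i j =>
      if i = j then 0 else h n (b (i, j)) - ∑ ω, q (i, j) ω * h n ω) ≤
      ∑ n, wt n * ⨆ t, ∑ e, f n t e (b e) := by
    intro b
    refine cut_le fun S T => Finset.sum_le_sum fun n _ => mul_le_mul_of_nonneg_left ?_ (hwt n)
    obtain ⟨s, hs⟩ := exists_sg_mul_eq_abs (∑ i ∈ S, ∑ j ∈ T, d n (i, j) (b (i, j)))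
    refine le_trans (le_of_eq ?_) (le_sup_fin (fun t => ∑ e, f n t e (b e)) (s, S, T))
    rw [hsum, hs]
  refine (pE_mono hq h1).trans ?_
  rw [pE_sum]
  have h2 : ∀ n, pE q (fun b => wt n * ⨆ t, ∑ e, f n t e (b e)) ≤ wt n * (4 * k * √k) := by
    intro n
    rw [pE_const_mul]
    refine mul_le_mul_of_nonneg_left ?_ (hwt n)
    refine (pE_sup_le hq (f n) ?_ ?_ (l := (√k)⁻¹) (by positivity)
      (inv_le_one_of_one_le₀ (Real.one_le_sqrt.2 hk))).trans ?_
    · intro t e ω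
      simp only [f, abs_mul, abs_sg, one_mul]
      split_ifs
      · exact hd1 _ _ _
      · simp
    · intro t e
      simp only [f]
      by_cases ht : e.1 ∈ t.2.1 ∧ e.2 ∈ t.2.2
      · simp only [ht, and_self, if_true]
        have := hd0 n e
        calc ∑ ω, q e ω * (sg t.1 * d n e ω) = sg t.1 * ∑ ω, q e ω * d n e ω := by
              rw [Finset.mul_sum]; exact Finset.sum_congr rfl fun _ _ => by ring
          _ = 0 := by rw [this, mul_zero]
      · simp [ht]
    · have hlog : Real.log (Fintype.card (Bool × Finset I × Finset I)) ≤ 3 * k := by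
        have : ((Fintype.card (Bool × Finset I × Finset I) : ℕ) : ℝ) =
            2 ^ (1 + 2 * Fintype.card I) := by
          simp only [Fintype.card_prod, Fintype.card_bool, Fintype.card_finset]
          push_cast
          ring
        rw [this, Real.log_pow]
        push_cast
        have := Real.log_two_lt_d9
        have := Real.log_pos one_lt_two
        nlinarith
      have hsq : (√k) ^ 2 = k := Real.sq_sqrt hk0.le
      have hcard : ((Fintype.card (I × I) : ℕ) : ℝ) = k * k := by
        rw [Fintype.card_prod, Nat.cast_mul]
      rw [div_inv_eq_mul, hcard, inv_pow, hsq]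
      have : k⁻¹ * (k * k) = k := by field_simp
      rw [this]
      nlinarith
  refine (Finset.sum_le_sum fun n _ => h2 n).trans ?_
  rw [← Finset.sum_mul]
  exact mul_le_of_le_one_left (by positivity) hwt1

/-- Two labelled sets of the same size can be matched with few label mismatches. -/
lemma exists_equiv_mismatch_le {X Y A : Type*} [Fintype X] [Fintype Y] [DecidableEq X]
    [DecidableEq Y] [Fintype A] [DecidableEq A] (e₀ : X ≃ Y) (p : X → A) (q : Y → A) :
    ∃ σ : X ≃ Y, ((Finset.univ.filter fun z => p z ≠ q (σ z)).card : ℝ) ≤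
      ∑ a, |((Finset.univ.filter fun z => p z = a).card : ℝ) -
        ((Finset.univ.filter fun y => q y = a).card : ℝ)| := by
  have : Nonempty (X ≃ Y) := ⟨e₀⟩
  obtain ⟨σ, hσ⟩ := Finite.exists_min
    (fun σ : X ≃ Y => (Finset.univ.filter fun z => p z ≠ q (σ z)).card)
  refine ⟨σ, ?_⟩
  have hcount : ∀ a, ((Finset.univ.filter fun y => q y = a).card) =
      (Finset.univ.filter fun z => q (σ z) = a).card := by
    intro a
    rw [← Finset.card_map σ.toEmbedding]
    congr 1
    ext y
    simp only [Finset.mem_filter, Finset.mem_univ, true_and, Finset.mem_map_equiv,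
      Equiv.apply_symm_apply]
  have hcase : ∀ a, (∀ z, p z = a → q (σ z) = a) ∨ (∀ z, q (σ z) = a → p z = a) := by
    intro a
    by_contra! hcon
    obtain ⟨⟨z, hz, hz'⟩, z', hz1, hz1'⟩ := hcon
    have hne : z ≠ z' := by rintro rfl; exact hz1' hz
    refine absurd (hσ ((Equiv.swap z z').trans σ)) (not_le.2 ?_)
    refine Finset.card_lt_card ?_
    have hmem : ∀ (τ : X ≃ Y) w, w ∈ (Finset.univ.filter fun z => p z ≠ q (τ z)) ↔
        p w ≠ q (τ w) := fun τ w => by simp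
    refine (Finset.ssubset_iff_of_subset fun w => ?_).2 ⟨z, ?_, ?_⟩
    · rw [hmem, hmem, Equiv.trans_apply]
      by_cases hw : w = z
      · subst hw; rw [hz]; exact fun _ => hz'.symm
      by_cases hw' : w = z'
      · subst hw'; intro _; rw [hz1]; exact hz1'
      · rw [Equiv.swap_apply_of_ne_of_ne hw hw']; exact id
    · rw [hmem, hz]; exact hz'.symm
    · rw [hmem, Equiv.trans_apply, Equiv.swap_apply_left, hz, hz1]; simp
  have hsplit : ((Finset.univ.filter fun z => p z ≠ q (σ z)).card : ℝ) =
      ∑ a, ((Finset.univ.filter fun z => p z = a ∧ q (σ z) ≠ a).card : ℝ) := by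
    rw [Finset.card_eq_sum_card_fiberwise (f := p) (t := Finset.univ) (by simp)]
    push_cast
    refine Finset.sum_congr rfl fun a _ => ?_
    congr 2
    ext z
    simp only [Finset.mem_filter, Finset.mem_univ, true_and]
    constructor
    · rintro ⟨h1, h2⟩; exact ⟨h2, fun h => h1 (h2.trans h.symm)⟩
    · rintro ⟨h1, h2⟩; exact ⟨fun h => h2 (h.symm.trans h1), h1⟩
  rw [hsplit]
  refine Finset.sum_le_sum fun a _ => ?_
  rw [hcount a]
  rcases hcase a with h | h
  · rw [Finset.card_eq_zero.2]
    · simp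
    · simp only [Finset.filter_eq_empty_iff, Finset.mem_univ, true_implies]
      rintro z ⟨h1, h2⟩; exact h2 (h z h1)
  · refine le_trans ?_ (le_abs_self _)
    have h3 : (Finset.univ.filter fun z => p z = a).card =
        (Finset.univ.filter fun z => q (σ z) = a).card +
        (Finset.univ.filter fun z => p z = a ∧ q (σ z) ≠ a).card := by
      rw [← Finset.card_union_of_disjoint]
      · congr 1
        ext z
        simp only [Finset.mem_filter, Finset.mem_univ, true_and, Finset.mem_union]
        have := h z
        tauto
      · rw [Finset.disjoint_filter]
        intro z _ h1 h2
        exact h2.2 h1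
    rw [h3]
    push_cast
    linarith

end Sampling

section InverseCounting

variable {ι I B X Ω : Type*} [Fintype ι] {wt : ι → ℝ} [Fintype I] [DecidableEq I] [Fintype B]
  [Fintype X] [Fintype Ω]

/-- The means of the test functions `h n` under the laws `u`. -/
def mix (u : X → X → Ω → ℝ) (h : ι → Ω → ℝ) : ι → X → X → ℝ :=
  fun n z z' => ∑ ω, u z z' ω * h n ω

/-- The laws of the edge weights of a sampled graph; loops carry uniform weights. -/
def edgeLaw (u : X → X → Ω → ℝ) (x : I → X) : I × I → Ω → ℝ :=
  fun e ω => if e.1 = e.2 then (Fintype.card Ω : ℝ)⁻¹ else u (x e.1) (x e.2) ω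

/-- The distance from the family `u` to the blow-up of a weighted graph, up to relabelling. -/
def matchCut (B : Type*) (wt : ι → ℝ) (u : X → X → Ω → ℝ) (h : ι → Ω → ℝ) (b : I × I → Ω) : ℝ :=
  ⨅ σ : X ≃ I × B, cut wt (fun n z z' => mix u h n z z' - h n (b ((σ z).1, (σ z').1)))

omit [Fintype ι] [Fintype X] in
lemma mix_mem_Icc {u : X → X → Ω → ℝ} (hu : ∀ z, IsLaw (u z)) {h : ι → Ω → ℝ}
    (hh : ∀ n ω, h n ω ∈ Set.Icc (0 : ℝ) 1) (n : ι) (z z' : X) :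
    mix u h n z z' ∈ Set.Icc (0 : ℝ) 1 := by
  refine ⟨Finset.sum_nonneg fun ω _ => mul_nonneg ((hu z).1 _ _) (hh _ _).1, ?_⟩
  rw [← (hu z).2 z']
  exact Finset.sum_le_sum fun ω _ => mul_le_of_le_one_right ((hu z).1 _ _) (hh _ _).2

omit [Fintype I] [Fintype X] in
lemma isLaw_edgeLaw [Nonempty Ω] {u : X → X → Ω → ℝ} (hu : ∀ z, IsLaw (u z)) (x : I → X) :
    IsLaw (edgeLaw u x) := by
  refine ⟨fun e ω => ?_, fun e => ?_⟩
  · unfold edgeLaw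
    split_ifs
    · positivity
    · exact (hu _).1 _ _
  · unfold edgeLaw
    split_ifs
    · simp
    · exact (hu _).2 _

omit [Fintype I] [DecidableEq I] [Fintype B] in
lemma matchCut_nonneg (u : X → X → Ω → ℝ) (h : ι → Ω → ℝ) (b : I × I → Ω) :
    0 ≤ matchCut B wt u h b :=
  Real.iInf_nonneg fun _ => cut_nonneg _

omit [Fintype I] [DecidableEq I] [Fintype B] in
lemma matchCut_le (u : X → X → Ω → ℝ) (h : ι → Ω → ℝ) (b : I × I → Ω) (σ : X ≃ I × B) :
    matchCut B wt u h b ≤ cut wt (fun n z z' => mix u h n z z' - h n (b ((σ z).1, (σ z').1))) :=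
  ciInf_le ⟨0, by rintro _ ⟨σ, rfl⟩; exact cut_nonneg _⟩ σ

/-- The error made by replacing `u` by the blow-up of the graph with weights `b` sampled at `x`,
in terms of a step approximation of `u`. -/
lemma matchCut_le_of_stepApprox [DecidableEq X] [DecidableEq B] {A : Type*} [Fintype A]
    [DecidableEq A] (hwt : ∀ n, 0 ≤ wt n) (hwt1 : ∑ n, wt n ≤ 1)
    {u : X → X → Ω → ℝ} {h : ι → Ω → ℝ}
    (hh : ∀ n ω, h n ω ∈ Set.Icc (0 : ℝ) 1) (e₀ : X ≃ I × B)
    (p : X → A) (γ : ι → A → A → ℝ) {r : ℝ} (hr : 0 ≤ r) (hγ : ∀ n a a', |γ n a a'| ≤ r)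
    (x : I → X) (b : I × I → Ω) :
    matchCut B wt u h b ≤ cut wt (fun n z z' => mix u h n z z' - γ n (p z) (p z')) +
      4 * r * Fintype.card X * ∑ a, |((Finset.univ.filter fun z => p z = a).card : ℝ) -
        Fintype.card B * ((Finset.univ.filter fun i => p (x i) = a).card : ℝ)| +
      (Fintype.card B : ℝ) ^ 2 * cut wt (fun n i j => if i = j then 0 else
        γ n (p (x i)) (p (x j)) - mix u h n (x i) (x j)) +
      (Fintype.card B : ℝ) ^ 2 * cut wt (fun n i j => if i = j then 0 else
        h n (b (i, j)) - mix u h n (x i) (x j)) +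
      (r + 1) * Fintype.card X * Fintype.card B := by
  obtain ⟨σ, hσ⟩ := exists_equiv_mismatch_le e₀ p (fun y : I × B => p (x y.1))
  have hcnt : ∀ a, ((Finset.univ.filter fun y : I × B => p (x y.1) = a).card : ℝ) =
      Fintype.card B * ((Finset.univ.filter fun i => p (x i) = a).card : ℝ) := by
    intro a
    have : (Finset.univ.filter fun y : I × B => p (x y.1) = a) =
        (Finset.univ.filter fun i => p (x i) = a) ×ˢ Finset.univ := by
      ext y; simp
    rw [this, Finset.card_product, Nat.cast_mul, mul_comm]
    rfl
  simp only [hcnt] at hσ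
  refine (matchCut_le u h b σ).trans ?_
  set V1 : ι → X → X → ℝ := fun n z z' => mix u h n z z' - γ n (p z) (p z')
  set V2 : ι → X → X → ℝ := fun n z z' => γ n (p z) (p z') - γ n (p (x (σ z).1)) (p (x (σ z').1))
  set V3 : ι → I → I → ℝ := fun n i j => if i = j then 0 else
        γ n (p (x i)) (p (x j)) - mix u h n (x i) (x j)
  set V4 : ι → I → I → ℝ := fun n i j => if i = j then 0 else
        h n (b (i, j)) - mix u h n (x i) (x j)
  set V5 : ι → I × B → I × B → ℝ := fun n y y' => if y.1 = y'.1 then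
        γ n (p (x y.1)) (p (x y'.1)) - h n (b (y.1, y'.1)) else 0
  have hdecomp : (fun n z z' => mix u h n z z' - h n (b ((σ z).1, (σ z').1))) =
      fun n z z' => (((V1 n z z' + V2 n z z') + V3 n (σ z).1 (σ z').1) +
        -V4 n (σ z).1 (σ z').1) + V5 n (σ z) (σ z') := by
    ext n z z'
    simp only [V1, V2, V3, V4, V5]
    split_ifs <;> ring
  rw [hdecomp]
  refine (cut_add_le hwt _ _).trans (add_le_add ((cut_add_le hwt _ _).trans
    (add_le_add ((cut_add_le hwt _ _).trans (add_le_add ((cut_add_le hwt _ _).trans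
      (add_le_add le_rfl ?_)) ?_)) ?_)) ?_)
  · refine (cut_le_of_sum_abs_le hwt hwt1 V2
      (c := 4 * r * Fintype.card X *
        ((Finset.univ.filter fun z => p z ≠ p (x (σ z).1)).card : ℝ)) (by positivity) ?_).trans
        (mul_le_mul_of_nonneg_left hσ (by positivity))
    intro n
    let g : X → ℝ := fun z => if p z ≠ p (x (σ z).1) then 1 else 0
    have hg : ∀ z, 0 ≤ g z := fun z => by simp only [g]; split_ifs <;> norm_num
    have hle : ∀ z z', |V2 n z z'| ≤ 2 * r * (g z + g z') := by
      intro z z'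
      by_cases h1 : p z = p (x (σ z).1)
      · by_cases h2 : p z' = p (x (σ z').1)
        · have : V2 n z z' = 0 := by simp only [V2]; rw [← h1, ← h2, sub_self]
          rw [this, abs_zero]
          exact mul_nonneg (by positivity) (add_nonneg (hg _) (hg _))
        · have h3 : g z' = 1 := by simp [g, h2]
          have h4 : |V2 n z z'| ≤ r + r := (abs_sub _ _).trans (add_le_add (hγ _ _ _) (hγ _ _ _))
          have := hg z
          rw [h3]; nlinarith
      · have h3 : g z = 1 := by simp [g, h1]
        have h4 : |V2 n z z'| ≤ r + r := (abs_sub _ _).trans (add_le_add (hγ _ _ _) (hγ _ _ _))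
        have := hg z'
        rw [h3]; nlinarith
    refine (Finset.sum_le_sum fun z _ => Finset.sum_le_sum fun z' _ => hle z z').trans
      (le_of_eq ?_)
    have hgs : ∑ z, g z = ((Finset.univ.filter fun z => p z ≠ p (x (σ z).1)).card : ℝ) := by
      simp only [g]
      rw [Finset.sum_boole]
    simp only [← Finset.mul_sum, Finset.sum_add_distrib, Finset.sum_const, Finset.card_univ,
      nsmul_eq_mul, hgs]
    ring
  · exact (cut_comp_equiv_le σ σ (fun n y y' => V3 n y.1 y'.1)).trans (cut_blowup_le hwt V3)
  · refine (cut_neg_le _).trans ?_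
    exact (cut_comp_equiv_le σ σ (fun n y y' => V4 n y.1 y'.1)).trans (cut_blowup_le hwt V4)
  · refine (cut_comp_equiv_le σ σ V5).trans
      (cut_le_of_sum_abs_le hwt hwt1 V5 (by positivity) fun n => ?_)
    have hle : ∀ y y' : I × B, |V5 n y y'| ≤ (r + 1) * if y.1 = y'.1 then 1 else 0 := by
      intro y y'
      simp only [V5]
      split_ifs
      · rw [mul_one]
        refine (abs_sub _ _).trans (add_le_add (hγ _ _ _) ?_)
        rw [abs_of_nonneg (hh _ _).1]
        exact (hh _ _).2
      · simp
    refine (Finset.sum_le_sum fun y _ => Finset.sum_le_sum fun y' _ => hle y y').trans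
      (le_of_eq ?_)
    have hin : ∀ y : I × B, ∑ y' : I × B, (if y.1 = y'.1 then (1 : ℝ) else 0) =
        Fintype.card B := by
      intro y
      rw [Fintype.sum_prod_type_right]
      simp
    simp only [← Finset.mul_sum, hin, Finset.sum_const, Finset.card_univ, nsmul_eq_mul,
      Fintype.card_congr e₀]
    ring

/-- The normalised sampling error. -/
def samplingErr (ε : ℝ) (R : ℕ) (k : ℝ) : ℝ := 5 * ε + 45 * (R + 1) * 4 ^ R / √k

/-- A random sampled graph is close to the family it is sampled from. -/
lemma pE_matchCut_le [Nonempty X] [Nonempty I] [Nonempty Ω]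
    (hwt : ∀ n, 0 ≤ wt n) (hwt1 : ∑ n, wt n ≤ 1)
    {u : X → X → Ω → ℝ} (hu : ∀ z, IsLaw (u z)) {h : ι → Ω → ℝ}
    (hh : ∀ n ω, h n ω ∈ Set.Icc (0 : ℝ) 1) (e₀ : X ≃ I × B) {ε : ℝ} (hε : 0 < ε) {R : ℕ}
    (hR : 1 < (R + 1) * ε ^ 2) :
    pE (unif I X) (fun x => pE (edgeLaw u x) (fun b => matchCut B wt u h b)) ≤
      (Fintype.card X : ℝ) ^ 2 * samplingErr ε R (Fintype.card I) := by
  classical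
  obtain ⟨r, hrR, p, γ, hγ, hcut⟩ := exists_stepApprox hwt hwt1 (mix u h)
    (fun n z z' => mix_mem_Icc hu hh n z z') hε hR
  have hX : (Fintype.card X : ℝ) = Fintype.card I * Fintype.card B := by
    rw [Fintype.card_congr e₀, Fintype.card_prod, Nat.cast_mul]
  have hNpos : (0 : ℝ) < Fintype.card X := by exact_mod_cast Fintype.card_pos
  have hkpos : (0 : ℝ) < Fintype.card I := by exact_mod_cast Fintype.card_pos
  have hk1 : (1 : ℝ) ≤ Fintype.card I := by exact_mod_cast Fintype.card_pos
  set N : ℝ := (Fintype.card X : ℝ) with hN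
  set k : ℝ := (Fintype.card I : ℝ) with hk
  set M : ℝ := (Fintype.card B : ℝ) with hM
  have hMpos : 0 < M := by
    by_contra hcon
    have : k * M ≤ 0 := mul_nonpos_of_nonneg_of_nonpos hkpos.le (not_lt.1 hcon)
    linarith
  have hs : 0 < √k := Real.sqrt_pos.2 hkpos
  have hsk : √k * √k = k := Real.mul_self_sqrt hkpos.le
  have hs1 : 1 ≤ √k := Real.one_le_sqrt.2 hk1
  set C : (I → X) → ℝ := fun x => ∑ a, |((Finset.univ.filter fun i => p (x i) = a).card : ℝ) -
      k * ((Finset.univ.filter fun z => p z = a).card : ℝ) / N| with hC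
  set V3 : (I → X) → ι → I → I → ℝ := fun x n i j => if i = j then 0 else
        γ n (p (x i)) (p (x j)) - mix u h n (x i) (x j) with hV3
  have hpt : ∀ x b, matchCut B wt u h b ≤ (ε * N ^ 2 + 4 * r * N * (M * C x) +
      M ^ 2 * cut wt (V3 x) + (r + 1) * N * M) +
      M ^ 2 * cut wt (fun n i j => if i = j then 0 else
        h n (b (i, j)) - ∑ ω, edgeLaw u x (i, j) ω * h n ω) := by
    intro x b
    have h1 := matchCut_le_of_stepApprox (B := B) hwt hwt1 (u := u) hh e₀ p γ (r := r)
      (by positivity)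
      hγ x b
    have h2 : ∀ a, |((Finset.univ.filter fun z => p z = a).card : ℝ) -
        M * ((Finset.univ.filter fun i => p (x i) = a).card : ℝ)| =
        M * |((Finset.univ.filter fun i => p (x i) = a).card : ℝ) -
      k * ((Finset.univ.filter fun z => p z = a).card : ℝ) / N| := by
      intro a
      rw [abs_sub_comm, ← abs_of_pos hMpos, ← abs_mul, abs_of_pos hMpos, hX]
      congr 1
      field_simp
    simp only [← hM, ← hN] at h1
    simp only [h2, ← Finset.mul_sum] at h1
    have h3 : (fun (n : ι) (i j : I) => if i = j then 0 else
        h n (b (i, j)) - mix u h n (x i) (x j)) = fun n i j => if i = j then 0 else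
        h n (b (i, j)) - ∑ ω, edgeLaw u x (i, j) ω * h n ω := by
      ext n i j
      split_ifs with hij
      · rfl
      · simp [edgeLaw, hij, mix]
    rw [h3] at h1
    linarith
  have hin : ∀ x, pE (edgeLaw u x) (fun b => matchCut B wt u h b) ≤
      (ε * N ^ 2 + 4 * r * N * (M * C x) + M ^ 2 * cut wt (V3 x) + (r + 1) * N * M) +
      M ^ 2 * (4 * k * √k) := by
    intro x
    have hq := isLaw_edgeLaw hu x
    refine (pE_mono hq (hpt x)).trans ?_
    rw [pE_add, pE_const hq, pE_const_mul]
    have := pE_cut_noise_le hwt hwt1 hq h hh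
    gcongr
  refine (pE_mono isLaw_unif hin).trans ?_
  have h4 : pE (unif I X) C ≤ 4 ^ r * (2 * √k) := by
    have := pE_count_le (I := I) p
    simpa [Fintype.card_prod, Fintype.card_bool, show (2 : ℝ) * 2 = 4 by norm_num] using this
  have h5 : pE (unif I X) (fun x => cut wt (V3 x)) ≤
      4 * ((k / N) ^ 2 * (ε * N ^ 2) + 8 * k * (r + 1) * √k) := by
    refine (pE_cut_offDiag_le (I := I) hwt hwt1 (fun n z z' => γ n (p z) (p z') - mix u h n z z')
      (M := r + 1) (by positivity) ?_).trans ?_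
    · intro n z z'
      refine (abs_sub _ _).trans (add_le_add (hγ _ _ _) ?_)
      have := mix_mem_Icc hu hh n z z'
      rw [abs_of_nonneg this.1]
      exact this.2
    · have h6 := cut_neg_le (wt := wt) (fun n z z' => mix u h n z z' - γ n (p z) (p z'))
      simp only [neg_sub] at h6
      have := h6.trans hcut
      gcongr
  have h6 : pE (unif I X) (fun x => (ε * N ^ 2 + 4 * r * N * (M * C x) + M ^ 2 * cut wt (V3 x) +
      (r + 1) * N * M) + M ^ 2 * (4 * k * √k)) =
      ε * N ^ 2 + 4 * r * N * M * pE (unif I X) C +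
      M ^ 2 * pE (unif I X) (fun x => cut wt (V3 x)) + (r + 1) * N * M + M ^ 2 * (4 * k * √k) := by
    simp only [pE_add, pE_const isLaw_unif, pE_const_mul]
    ring
  rw [h6]
  have h7 : ε * N ^ 2 + 4 * r * N * M * (4 ^ r * (2 * √k)) +
      M ^ 2 * (4 * ((k / N) ^ 2 * (ε * N ^ 2) + 8 * k * (r + 1) * √k)) + (r + 1) * N * M +
      M ^ 2 * (4 * k * √k) =
      N ^ 2 * (5 * ε + (8 * r * 4 ^ r + 32 * (r + 1) + (r + 1) / √k + 4) / √k) := by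
    rw [hX]
    have hk2 : k = √k * √k := hsk.symm
    generalize √k = s at *
    rw [hk2]
    field_simp
    ring
  have hr4 : (1 : ℝ) ≤ 4 ^ r := one_le_pow₀ (by norm_num)
  have h8 : 8 * r * 4 ^ r + 32 * (r + 1) + (r + 1) / √k + 4 ≤ (45 * (R + 1) * 4 ^ R : ℝ) := by
    have h9 : ((r : ℝ) + 1) / √k ≤ r + 1 := div_le_self (by positivity) hs1
    have h10 : 8 * r * 4 ^ r + 32 * (r + 1) + (r + 1) + 4 ≤ (45 * (r + 1) * 4 ^ r : ℝ) := by
      have hr0 : (0 : ℝ) ≤ r := by positivity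
      nlinarith [mul_nonneg hr0 (sub_nonneg.2 hr4)]
    have h11 : (45 * (r + 1) * 4 ^ r : ℝ) ≤ 45 * (R + 1) * 4 ^ R := by
      have : (r : ℝ) ≤ R := by exact_mod_cast hrR
      have : (4 : ℝ) ^ r ≤ 4 ^ R := pow_le_pow_right₀ (by norm_num) hrR
      gcongr
    linarith
  calc _ ≤ ε * N ^ 2 + 4 * r * N * M * (4 ^ r * (2 * √k)) +
      M ^ 2 * (4 * ((k / N) ^ 2 * (ε * N ^ 2) + 8 * k * (r + 1) * √k)) + (r + 1) * N * M +
      M ^ 2 * (4 * k * √k) := by gcongr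
    _ ≤ _ := by
      rw [h7, samplingErr]
      gcongr

/-- The off-diagonal edge-weight probabilities of a sampled graph. -/
def sampleProb (u : X → X → Ω → ℝ) (b : I × I → Ω) : ℝ :=
  pE (unif I X) (fun x => ∏ e with e.1 ≠ e.2, u (x e.1) (x e.2) (b e))

/-- If two families give rise to almost the same sampled graphs, they are close in cut norm after
relabelling. -/
theorem exists_perm_cut_le [Nonempty X] [Nonempty I] [Nonempty Ω]
    (hwt : ∀ n, 0 ≤ wt n) (hwt1 : ∑ n, wt n ≤ 1)
    {u w : X → X → Ω → ℝ} (hu : ∀ z, IsLaw (u z)) (hw : ∀ z, IsLaw (w z)) {h : ι → Ω → ℝ}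
    (hh : ∀ n ω, h n ω ∈ Set.Icc (0 : ℝ) 1) (e₀ : X ≃ I × B) {ε : ℝ} (hε : 0 < ε) {R : ℕ}
    (hR : 1 < (R + 1) * ε ^ 2) {τ : ℝ}
    (hτ : ∀ b : I × I → Ω, |sampleProb u b - sampleProb w b| ≤ τ) :
    ∃ σ : Equiv.Perm X, cut wt (fun n z z' => mix u h n z z' - mix w h n (σ z) (σ z')) ≤
      (Fintype.card X : ℝ) ^ 2 * (2 * samplingErr ε R (Fintype.card I) +
        (Fintype.card Ω : ℝ) ^ (Fintype.card I ^ 2) * τ) := by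
  classical
  have : Nonempty (X ≃ I × B) := ⟨e₀⟩
  set N : ℝ := (Fintype.card X : ℝ) with hN
  let P : (X → X → Ω → ℝ) → (I × I → Ω) → ℝ := fun u b =>
    pE (unif I X) (fun x => ∏ e, edgeLaw u x e (b e))
  have hPdef : ∀ u b, P u b = (∏ e : I × I with ¬ e.1 ≠ e.2, (Fintype.card Ω : ℝ)⁻¹) *
      sampleProb u b := by
    intro u b
    simp only [P, sampleProb]
    rw [← pE_const_mul]
    congr 1
    ext x
    rw [← Finset.prod_filter_mul_prod_filter_not Finset.univ (fun e : I × I => e.1 ≠ e.2), mul_comm]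
    congr 1
    · refine Finset.prod_congr rfl fun e he => ?_
      simp only [Finset.mem_filter, Finset.mem_univ, true_and, not_not] at he
      simp [edgeLaw, he]
    · refine Finset.prod_congr rfl fun e he => ?_
      simp only [Finset.mem_filter, Finset.mem_univ, true_and] at he
      simp [edgeLaw, he]
  have hΩ : (1 : ℝ) ≤ Fintype.card Ω := by exact_mod_cast Fintype.card_pos
  have hPdiff : ∀ b, |P u b - P w b| ≤ τ := by
    intro b
    rw [hPdef, hPdef, ← mul_sub, abs_mul]
    refine (mul_le_of_le_one_left (abs_nonneg _) ?_).trans (hτ b)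
    rw [abs_of_nonneg (Finset.prod_nonneg fun _ _ => by positivity)]
    exact Finset.prod_le_one (fun _ _ => by positivity) fun _ _ => inv_le_one_of_one_le₀ hΩ
  have hPsum : ∀ (u : X → X → Ω → ℝ) (f : (I × I → Ω) → ℝ),
      pE (unif I X) (fun x => pE (edgeLaw u x) f) = ∑ b, P u b * f b := by
    intro u f
    simp only [P, pE]
    simp only [Finset.mul_sum, Finset.sum_mul]
    rw [Finset.sum_comm]
    exact Finset.sum_congr rfl fun b _ => Finset.sum_congr rfl fun x _ => by ring
  have hP0 : ∀ b, 0 ≤ P u b := fun b => pE_nonneg isLaw_unif fun x =>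
    Finset.prod_nonneg fun e _ => (isLaw_edgeLaw hu x).1 _ _
  have hP1 : ∑ b, P u b = 1 := by
    have h1 := hPsum u (fun _ => 1)
    simp only [mul_one] at h1
    rw [← h1]
    simp only [pE_const (isLaw_edgeLaw hu _), pE_const isLaw_unif]
  have hmw : ∀ b : I × I → Ω, matchCut B wt w h b ≤ N ^ 2 := by
    intro b
    refine (matchCut_le w h b e₀).trans
      (cut_le_of_sum_abs_le hwt hwt1 _ (by positivity) fun n => ?_)
    calc _ ≤ ∑ z : X, ∑ z' : X, (1 : ℝ) := by
          refine Finset.sum_le_sum fun z _ => Finset.sum_le_sum fun z' _ => ?_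
          have h1 := mix_mem_Icc hw hh n z z'
          have h2 := hh n (b ((e₀ z).1, (e₀ z').1))
          rw [abs_le]
          constructor <;> linarith [h1.1, h1.2, h2.1, h2.2]
      _ = N ^ 2 := by simp [sq, hN]
  set Err := samplingErr ε R (Fintype.card I) with hErr
  have hU := pE_matchCut_le (B := B) hwt hwt1 hu hh e₀ hε hR
  have hW := pE_matchCut_le (B := B) hwt hwt1 hw hh e₀ hε hR
  rw [hPsum] at hU hW
  have hcross : ∑ b, P u b * matchCut B wt w h b ≤ ∑ b, P w b * matchCut B wt w h b +
      (Fintype.card Ω : ℝ) ^ (Fintype.card I ^ 2) * (τ * N ^ 2) := by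
    have h1 : ∀ b, P u b * matchCut B wt w h b ≤ P w b * matchCut B wt w h b + τ * N ^ 2 := by
      intro b
      have h2 := (le_abs_self _).trans (hPdiff b)
      have h3 := mul_le_mul_of_nonneg_right h2 (matchCut_nonneg (B := B) (wt := wt) w h b)
      have h4 : τ * matchCut B wt w h b ≤ τ * N ^ 2 :=
        mul_le_mul_of_nonneg_left (hmw b) ((abs_nonneg _).trans (hPdiff b))
      linarith
    refine (Finset.sum_le_sum fun b _ => h1 b).trans (le_of_eq ?_)
    rw [Finset.sum_add_distrib, Finset.sum_const, nsmul_eq_mul, Finset.card_univ]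
    simp [Fintype.card_prod, sq]
  have hex : ∃ b : I × I → Ω, matchCut B wt u h b + matchCut B wt w h b ≤
      N ^ 2 * (2 * Err + (Fintype.card Ω : ℝ) ^ (Fintype.card I ^ 2) * τ) := by
    by_contra! hcon
    set c := N ^ 2 * (2 * Err + (Fintype.card Ω : ℝ) ^ (Fintype.card I ^ 2) * τ) with hc
    have h1 : c < ∑ b, P u b * (matchCut B wt u h b + matchCut B wt w h b) := by
      obtain ⟨b₀, -, hb₀⟩ : ∃ b ∈ Finset.univ, (0 : ℝ) < P u b :=
        Finset.exists_lt_of_sum_lt (by simp [hP1])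
      calc c = ∑ b, P u b * c := by rw [← Finset.sum_mul, hP1, one_mul]
        _ < _ := Finset.sum_lt_sum (fun b _ => mul_le_mul_of_nonneg_left (hcon b).le (hP0 b))
            ⟨b₀, Finset.mem_univ _, mul_lt_mul_of_pos_left (hcon b₀) hb₀⟩
    simp only [mul_add, Finset.sum_add_distrib] at h1
    have : c = N ^ 2 * Err + N ^ 2 * Err +
      (Fintype.card Ω : ℝ) ^ (Fintype.card I ^ 2) * (τ * N ^ 2) := by rw [hc]; ring
    linarith
  obtain ⟨b, hb⟩ := hex
  obtain ⟨σ, hσ⟩ := exists_eq_ciInf_of_finite (f := fun σ : X ≃ I × B =>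
    cut wt (fun n z z' => mix u h n z z' - h n (b ((σ z).1, (σ z').1))))
  obtain ⟨ρ, hρ⟩ := exists_eq_ciInf_of_finite (f := fun σ : X ≃ I × B =>
    cut wt (fun n z z' => mix w h n z z' - h n (b ((σ z).1, (σ z').1))))
  refine ⟨σ.trans ρ.symm, le_trans ?_ hb⟩
  unfold matchCut
  rw [← hσ, ← hρ]
  set V : ι → X → X → ℝ := fun n z z' => mix w h n z z' - h n (b ((ρ z).1, (ρ z').1)) with hV
  refine le_trans ?_ (add_le_add le_rfl ((cut_comp_equiv_le (σ.trans ρ.symm) (σ.trans ρ.symm)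
    (fun n z z' => -V n z z')).trans (cut_neg_le V)))
  refine le_trans (le_of_eq ?_) (cut_add_le hwt _ _)
  congr 1
  ext n z z'
  simp [hV]

end InverseCounting

section Cells

/-- The map of the line permuting the intervals `[z / N, (z + 1) / N)` by translations. -/
def shuffle (N : ℕ) (τ : Equiv.Perm ℤ) (x : ℝ) : ℝ :=
  x + ((τ ⌊N * x⌋ : ℝ) - ⌊N * x⌋) / N

lemma floor_shuffle {N : ℕ} (hN : 0 < N) (τ : Equiv.Perm ℤ) (x : ℝ) :
    ⌊N * shuffle N τ x⌋ = τ ⌊N * x⌋ := by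
  have : (N : ℝ) * shuffle N τ x = N * x + ((τ ⌊N * x⌋ - ⌊N * x⌋ : ℤ) : ℝ) := by
    unfold shuffle
    push_cast
    field_simp
  rw [this, Int.floor_add_intCast]
  ring

lemma shuffle_symm_shuffle {N : ℕ} (hN : 0 < N) (τ : Equiv.Perm ℤ) (x : ℝ) :
    shuffle N τ.symm (shuffle N τ x) = x := by
  rw [shuffle, floor_shuffle hN, Equiv.symm_apply_apply, shuffle]
  ring

lemma measurable_shuffle (N : ℕ) (τ : Equiv.Perm ℤ) : Measurable (shuffle N τ) := by
  unfold shuffle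
  have h : Measurable fun x : ℝ => ⌊(N : ℝ) * x⌋ := (measurable_const.mul measurable_id).floor
  have h2 : Measurable fun z : ℤ => (((τ z : ℝ) - z) / N : ℝ) := measurable_from_top
  exact measurable_id.add (h2.comp h)

lemma measurePreserving_shuffle {N : ℕ} (hN : 0 < N) (τ : Equiv.Perm ℤ) :
    MeasurePreserving (shuffle N τ) := by
  refine ⟨measurable_shuffle N τ, ?_⟩
  have hf : Measurable fun x : ℝ => ⌊(N : ℝ) * x⌋ := (measurable_const.mul measurable_id).floor
  have key : ∀ A : Set ℝ, MeasurableSet A →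
      volume A = ∑' z : ℤ, volume (A ∩ (fun x : ℝ => ⌊(N : ℝ) * x⌋) ⁻¹' {z}) := by
    intro A hA
    rw [← measure_iUnion]
    · congr 1
      ext x
      simp
    · intro z z' hz
      refine Set.disjoint_left.2 fun x hx hx' => hz ?_
      exact hx.2.symm.trans hx'.2
    · exact fun z => hA.inter (hf (measurableSet_singleton z))
  ext A hA
  rw [Measure.map_apply (measurable_shuffle N τ) hA, key A hA,
    key _ (measurable_shuffle N τ hA)]
  refine (tsum_congr fun z => ?_).trans
    (τ.tsum_eq fun z => volume (A ∩ (fun x : ℝ => ⌊(N : ℝ) * x⌋) ⁻¹' {z}))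
  have : shuffle N τ ⁻¹' A ∩ (fun x : ℝ => ⌊(N : ℝ) * x⌋) ⁻¹' {z} =
      (fun x => x + ((τ z : ℝ) - z) / N) ⁻¹'
        (A ∩ (fun x : ℝ => ⌊(N : ℝ) * x⌋) ⁻¹' {τ z}) := by
    ext x
    simp only [Set.mem_inter_iff, Set.mem_preimage, Set.mem_singleton_iff]
    have h1 : (N : ℝ) * (x + ((τ z : ℝ) - z) / N) = N * x + ((τ z - z : ℤ) : ℝ) := by
      push_cast
      field_simp
    rw [h1, Int.floor_add_intCast]
    constructor
    · rintro ⟨h, rfl⟩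
      exact ⟨h, by ring⟩
    · rintro ⟨h, h'⟩
      have : ⌊(N : ℝ) * x⌋ = z := by omega
      refine ⟨?_, this⟩
      rw [shuffle, this]
      exact h
  rw [this, measure_preimage_add_right]

variable {N : ℕ}

/-- Extension of a permutation of `{0, …, N - 1}` to the integers by the identity. -/
def intPerm (σ : Equiv.Perm (Fin N)) : Equiv.Perm ℤ :=
  σ.extendDomain (p := fun z : ℤ => 0 ≤ z ∧ z < N)
    { toFun := fun i => ⟨(i : ℕ), by omega⟩
      invFun := fun z => ⟨z.1.toNat, by have := z.2; omega⟩
      left_inv := fun i => by ext; simp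
      right_inv := fun z => by ext; have := z.2; simp; omega }

lemma intPerm_apply (σ : Equiv.Perm (Fin N)) (i : Fin N) :
    intPerm σ ((i : ℕ) : ℤ) = ((σ i : ℕ) : ℤ) := by
  unfold intPerm
  exact Equiv.Perm.extendDomain_apply_image σ _ i

lemma intPerm_apply_of_le (σ : Equiv.Perm (Fin N)) {z : ℤ} (hz : (N : ℤ) ≤ z) :
    intPerm σ z = z := by
  unfold intPerm
  exact Equiv.Perm.extendDomain_apply_not_subtype σ _ (by omega)

lemma shuffle_one (σ : Equiv.Perm (Fin N)) : shuffle N (intPerm σ) 1 = 1 := by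
  simp [shuffle, intPerm_apply_of_le]

/-- The index of the interval of length `1 / N` that contains a point of `[0,1]`. -/
def cell (N : ℕ) [NeZero N] (x : unitInterval) : Fin N :=
  ⟨min ⌊(N : ℝ) * x⌋₊ (N - 1), by have := NeZero.pos N; omega⟩

variable [NeZero N]

lemma measurable_cell : Measurable (cell N) := by
  have h : Measurable fun x : unitInterval => ⌊(N : ℝ) * x⌋₊ :=
    (measurable_const.mul measurable_subtype_coe).nat_floor
  have h2 : Measurable fun n : ℕ => (⟨min n (N - 1), by have := NeZero.pos N; omega⟩ : Fin N) :=
    measurable_from_top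
  exact h2.comp h

lemma cell_of_lt {x : unitInterval} (hx : x < 1) : ((cell N x : ℕ) : ℤ) = ⌊(N : ℝ) * x⌋ := by
  have hN : (0 : ℝ) < N := Nat.cast_pos.2 (NeZero.pos N)
  have h1 : (x : ℝ) < 1 := hx
  have h0 : 0 ≤ (N : ℝ) * x := mul_nonneg hN.le x.2.1
  have h2 : ⌊(N : ℝ) * x⌋₊ < N := by
    rw [Nat.floor_lt h0]
    nlinarith
  have h3 : (cell N x : ℕ) = ⌊(N : ℝ) * x⌋₊ := by
    simp only [cell]; omega
  rw [h3]
  exact Int.natCast_floor_eq_floor h0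

lemma cell_bounds (x : unitInterval) :
    ((cell N x : ℕ) : ℝ) ≤ N * x ∧ (N : ℝ) * x ≤ (cell N x : ℕ) + 1 := by
  have hN : (0 : ℝ) < N := Nat.cast_pos.2 (NeZero.pos N)
  have h0 : 0 ≤ (N : ℝ) * x := mul_nonneg hN.le x.2.1
  constructor
  · refine le_trans ?_ (Nat.floor_le h0)
    exact_mod_cast min_le_left _ _
  · rcases le_total ⌊(N : ℝ) * x⌋₊ (N - 1) with h | h
    · have : (cell N x : ℕ) = ⌊(N : ℝ) * x⌋₊ := min_eq_left h
      rw [this]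
      exact (Nat.lt_floor_add_one _).le
    · have : (cell N x : ℕ) = N - 1 := min_eq_right h
      rw [this, Nat.cast_sub (NeZero.pos N)]
      have := x.2.2
      push_cast
      nlinarith

lemma dist_le_of_cell_eq {x y : unitInterval} (h : cell N x = cell N y) :
    dist x y ≤ 1 / N := by
  have hN : (0 : ℝ) < N := Nat.cast_pos.2 (NeZero.pos N)
  have hx := cell_bounds (N := N) x
  have hy := cell_bounds (N := N) y
  rw [h] at hx
  rw [Subtype.dist_eq, Real.dist_eq, abs_le, neg_le, le_div_iff₀ hN, le_div_iff₀ hN]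
  constructor <;> nlinarith

lemma shuffle_mem_Ico (σ : Equiv.Perm (Fin N)) {x : ℝ} (hx : x ∈ Set.Ico (0 : ℝ) 1) :
    shuffle N (intPerm σ) x ∈ Set.Ico (0 : ℝ) 1 := by
  have hN : (0 : ℝ) < N := Nat.cast_pos.2 (NeZero.pos N)
  have h := floor_shuffle (NeZero.pos N) (intPerm σ) x
  rw [← cell_of_lt (N := N) (x := ⟨x, hx.1, hx.2.le⟩) hx.2, intPerm_apply, Int.floor_eq_iff] at h
  have h2 : ((σ (cell N ⟨x, hx.1, hx.2.le⟩) : ℕ) : ℝ) + 1 ≤ N := by exact_mod_cast Fin.is_lt _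
  have h3 : (0 : ℝ) ≤ ((σ (cell N ⟨x, hx.1, hx.2.le⟩) : ℕ) : ℝ) := Nat.cast_nonneg _
  push_cast at h
  constructor
  · by_contra! hc
    nlinarith
  · by_contra! hc
    nlinarith

lemma shuffle_mem (σ : Equiv.Perm (Fin N)) {x : ℝ} (hx : x ∈ unitInterval) :
    shuffle N (intPerm σ) x ∈ unitInterval := by
  rcases hx.2.lt_or_eq with h | h
  · exact Set.Ico_subset_Icc_self (shuffle_mem_Ico σ ⟨hx.1, h⟩)
  · rw [h, shuffle_one]
    exact unitInterval.one_mem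

/-- The permutation of `[0,1]` translating the cells according to a permutation of them. -/
def cellPerm (σ : Equiv.Perm (Fin N)) : Equiv.Perm unitInterval where
  toFun x := ⟨shuffle N (intPerm σ) x, shuffle_mem σ x.2⟩
  invFun x := ⟨shuffle N (intPerm σ.symm) x, shuffle_mem σ.symm x.2⟩
  left_inv x := Subtype.ext (shuffle_symm_shuffle (NeZero.pos N) (intPerm σ) x)
  right_inv x := Subtype.ext (shuffle_symm_shuffle (NeZero.pos N) (intPerm σ.symm) x)

lemma cell_cellPerm (σ : Equiv.Perm (Fin N)) {x : unitInterval} (hx : x < 1) :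
    cell N (cellPerm σ x) = σ (cell N x) := by
  have h := floor_shuffle (NeZero.pos N) (intPerm σ) x
  have h1 : cellPerm σ x < 1 := (shuffle_mem_Ico σ ⟨x.2.1, hx⟩).2
  rw [← cell_of_lt (N := N) hx, intPerm_apply] at h
  have h2 := cell_of_lt (N := N) h1
  have h3 : ⌊(N : ℝ) * (cellPerm σ x : unitInterval)⌋ = ((σ (cell N x) : ℕ) : ℤ) := h
  ext
  exact_mod_cast h2.trans h3

lemma measurePreserving_cellPerm (σ : Equiv.Perm (Fin N)) :
    MeasurePreserving (cellPerm σ) := by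
  refine ⟨((measurable_shuffle N _).comp measurable_subtype_coe).subtype_mk, ?_⟩
  ext A hA
  have hm : Measurable (cellPerm σ) :=
    ((measurable_shuffle N _).comp measurable_subtype_coe).subtype_mk
  rw [Measure.map_apply hm hA, Measure.Subtype.volume_def,
    comap_subtype_coe_apply measurableSet_Icc, comap_subtype_coe_apply measurableSet_Icc,
    ← (measurePreserving_shuffle (NeZero.pos N) (intPerm σ)).measure_preimage
      (measurableSet_Icc.subtype_image hA).nullMeasurableSet]
  congr 1
  ext x
  simp only [Set.mem_image, Set.mem_preimage]
  constructor
  · rintro ⟨y, hy, rfl⟩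
    exact ⟨_, hy, rfl⟩
  · rintro ⟨y, hy, hyx⟩
    refine ⟨(cellPerm σ).symm y, by simpa using hy, ?_⟩
    have := shuffle_symm_shuffle (NeZero.pos N) (intPerm σ) x
    rw [← hyx] at this
    exact this

lemma ae_lt_one : ∀ᵐ x : unitInterval, x < 1 := by
  have : ∀ᵐ x : unitInterval, x ≠ 1 := by simp [ae_iff]
  filter_upwards [this] with x hx
  exact lt_of_le_of_ne x.2.2 hx

lemma cell_cellPerm_ae (σ : Equiv.Perm (Fin N)) :
    ∀ᵐ x : unitInterval, cell N (cellPerm σ x) = σ (cell N x) :=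
  ae_lt_one.mono fun _ hx => cell_cellPerm σ hx

lemma measureReal_cell (z : Fin N) :
    (volume : Measure unitInterval).real (cell N ⁻¹' {z}) = 1 / N := by
  have hm : ∀ z, MeasurableSet (cell N ⁻¹' {z}) := fun z =>
    measurable_cell (measurableSet_singleton z)
  have hsym : ∀ z z' : Fin N, (volume : Measure unitInterval).real (cell N ⁻¹' {z}) =
      (volume : Measure unitInterval).real (cell N ⁻¹' {z'}) := by
    intro z z'
    rw [measureReal_def, measureReal_def,
      ← (measurePreserving_cellPerm (Equiv.swap z z')).measure_preimage (hm z').nullMeasurableSet]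
    congr 1
    refine measure_congr ?_
    filter_upwards [cell_cellPerm_ae (Equiv.swap z z')] with x hx
    refine propext ?_
    change cell N x = z ↔ cell N (cellPerm _ x) = z'
    rw [hx, Equiv.swap_apply_eq_iff, Equiv.swap_apply_right]
  have hsum : ∑ z : Fin N, (volume : Measure unitInterval).real (cell N ⁻¹' {z}) = 1 := by
    rw [← measureReal_biUnion_finset]
    · have : (⋃ z ∈ (Finset.univ : Finset (Fin N)), cell N ⁻¹' {z}) = Set.univ := by
        ext x; simp
      rw [this]
      simp
    · intro z _ z' _ h
      exact Set.disjoint_left.2 fun x hx hx' => h (hx.symm.trans hx')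
    · exact fun z _ => hm z
  rw [Finset.sum_congr rfl fun z' _ => hsym z' z] at hsum
  have hN : (0 : ℝ) < N := Nat.cast_pos.2 (NeZero.pos N)
  simp only [Finset.sum_const, Finset.card_univ, Fintype.card_fin, nsmul_eq_mul] at hsum
  field_simp
  linarith

end Cells

section CellAverage

variable {N : ℕ} [NeZero N]

/-- The pair of cells containing the coordinates of a point of the unit square. -/
def cells (N : ℕ) [NeZero N] (p : unitInterval × unitInterval) : Fin N × Fin N :=
  (cell N p.1, cell N p.2)

lemma measurable_cells : Measurable (cells N) :=
  (measurable_cell.comp measurable_fst).prodMk (measurable_cell.comp measurable_snd)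

lemma cells_preimage (a : Fin N × Fin N) :
    cells N ⁻¹' {a} = (cell N ⁻¹' {a.1}) ×ˢ (cell N ⁻¹' {a.2}) := by
  ext p
  simp [cells, Prod.ext_iff]

lemma measureReal_cells (a : Fin N × Fin N) :
    (volume : Measure (unitInterval × unitInterval)).real (cells N ⁻¹' {a}) = 1 / (N : ℝ) ^ 2 := by
  rw [cells_preimage, Measure.volume_eq_prod, measureReal_prod_prod, measureReal_cell,
    measureReal_cell]
  ring

lemma setIntegral_eq_sum_cells {f : unitInterval × unitInterval → ℝ} (hf : Integrable f)
    {A : Set (unitInterval × unitInterval)} (hA : MeasurableSet A) :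
    ∫ p in A, f p = ∑ a, ∫ p in A ∩ cells N ⁻¹' {a}, f p := by
  have : A = ⋃ a ∈ (Finset.univ : Finset (Fin N × Fin N)), A ∩ cells N ⁻¹' {a} := by
    ext p; simp
  conv_lhs => rw [this]
  refine integral_biUnion_finset _ (fun a _ =>
    hA.inter (measurable_cells (measurableSet_singleton a)))
    (fun a _ b _ h => ?_) fun a _ => hf.integrableOn
  exact Set.disjoint_left.2 fun x hx hx' => h (hx.2.symm.trans hx'.2)

/-- The average of a function over a product of two cells. -/
def cellAvg (N : ℕ) [NeZero N] (f : unitInterval × unitInterval → ℝ) (a : Fin N × Fin N) : ℝ :=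
  (N : ℝ) ^ 2 * ∫ p in cells N ⁻¹' {a}, f p

lemma integrable_comp_cells (G : Fin N × Fin N → ℝ) : Integrable fun p => G (cells N p) := by
  have hm : Measurable fun p => G (cells N p) := (measurable_of_countable G).comp measurable_cells
  refine Integrable.of_bound hm.aestronglyMeasurable (∑ a, |G a|) (ae_of_all _ fun p => ?_)
  exact Finset.single_le_sum (f := fun a => |G a|) (fun _ _ => abs_nonneg _) (Finset.mem_univ _)

lemma setIntegral_comp_cells (G : Fin N × Fin N → ℝ) {A : Set (unitInterval × unitInterval)}
    (hA : MeasurableSet A) : ∫ p in A, G (cells N p) =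
      ∑ a, (volume : Measure (unitInterval × unitInterval)).real (A ∩ cells N ⁻¹' {a}) * G a := by
  rw [setIntegral_eq_sum_cells (N := N) (integrable_comp_cells G) hA]
  refine Finset.sum_congr rfl fun a _ => ?_
  rw [setIntegral_congr_fun (g := fun _ => G a)
    (hA.inter (measurable_cells (measurableSet_singleton a))), setIntegral_const, smul_eq_mul]
  intro p hp
  have : cells N p = a := hp.2
  simp only [this]

lemma integral_abs_cellAvg_le {f : unitInterval × unitInterval → ℝ} (hf : Integrable f) :
    ∫ p, |cellAvg N f (cells N p)| ≤ ∫ p, |f p| := by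
  have hN : (0 : ℝ) < N := Nat.cast_pos.2 (NeZero.pos N)
  rw [← setIntegral_univ, ← setIntegral_univ (f := fun p => |f p|),
    setIntegral_comp_cells (fun a => |cellAvg N f a|) MeasurableSet.univ,
    setIntegral_eq_sum_cells (N := N) hf.abs MeasurableSet.univ]
  refine Finset.sum_le_sum fun a _ => ?_
  rw [Set.univ_inter, measureReal_cells, cellAvg, abs_mul, abs_of_pos (by positivity),
    ← mul_assoc, one_div_mul_cancel (by positivity), one_mul]
  exact abs_integral_le_integral_abs

lemma cellAvg_sub {f g : unitInterval × unitInterval → ℝ} (hf : Integrable f) (hg : Integrable g)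
    (a : Fin N × Fin N) : cellAvg N (fun p => f p - g p) a = cellAvg N f a - cellAvg N g a := by
  rw [cellAvg, integral_sub hf.integrableOn hg.integrableOn, mul_sub]
  rfl

lemma cellAvg_sum {Ω : Type*} [Fintype Ω] {f : Ω → unitInterval × unitInterval → ℝ}
    (hf : ∀ ω, Integrable (f ω)) (a : Fin N × Fin N) :
    ∑ ω, cellAvg N (f ω) a = cellAvg N (fun p => ∑ ω, f ω p) a := by
  rw [cellAvg, integral_finsetSum _ fun ω _ => (hf ω).integrableOn, Finset.mul_sum]
  rfl

lemma cellAvg_const (c : ℝ) (a : Fin N × Fin N) : cellAvg N (fun _ => c) a = c := by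
  have hN : (0 : ℝ) < N := Nat.cast_pos.2 (NeZero.pos N)
  rw [cellAvg, setIntegral_const, measureReal_cells, smul_eq_mul]
  field_simp

lemma cellAvg_nonneg {f : unitInterval × unitInterval → ℝ} (hf : ∀ p, 0 ≤ f p)
    (a : Fin N × Fin N) : 0 ≤ cellAvg N f a :=
  mul_nonneg (by positivity) (integral_nonneg hf)

lemma abs_sub_cellAvg_le {g : unitInterval × unitInterval → ℝ} (hg : Integrable g) {η : ℝ}
    (h : ∀ p q, cells N p = cells N q → |g p - g q| ≤ η) (p : unitInterval × unitInterval) :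
    |g p - cellAvg N g (cells N p)| ≤ η := by
  have hN : (0 : ℝ) < N := Nat.cast_pos.2 (NeZero.pos N)
  have h1 : g p - cellAvg N g (cells N p) = cellAvg N (fun q => g p - g q) (cells N p) := by
    rw [cellAvg_sub (integrable_const _) hg, cellAvg_const]
  rw [h1, cellAvg, abs_mul, abs_of_pos (by positivity)]
  have h2 := norm_setIntegral_le_of_norm_le_const (μ := volume) (f := fun q => g p - g q)
    (s := cells N ⁻¹' {cells N p}) (C := η) (measure_lt_top _ _)
    (fun q hq => h p q (Eq.symm hq))
  rw [measureReal_cells, Real.norm_eq_abs] at h2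
  calc (N : ℝ) ^ 2 * |∫ q in cells N ⁻¹' {cells N p}, (g p - g q)|
      ≤ (N : ℝ) ^ 2 * (η * (1 / (N : ℝ) ^ 2)) := by gcongr
    _ = η := by field_simp

/-- Averages over small cells approximate an integrable function in mean. -/
lemma exists_integral_sub_cellAvg_le {f : unitInterval × unitInterval → ℝ} (hf : Integrable f)
    {η : ℝ} (hη : 0 < η) : ∃ N₀ : ℕ, ∀ (N : ℕ) [NeZero N], N₀ ≤ N →
      ∫ p, |f p - cellAvg N f (cells N p)| ≤ η := by
  obtain ⟨g, hg, hgi⟩ := hf.exists_boundedContinuous_integral_sub_le (ε := η / 3) (by positivity)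
  have huc := CompactSpace.uniformContinuous_of_continuous g.continuous
  obtain ⟨δ, hδ, hδ'⟩ := Metric.uniformContinuous_iff.1 huc (η / 3) (by positivity)
  obtain ⟨N₀, hN₀⟩ := exists_nat_gt (1 / δ)
  refine ⟨N₀, fun N _ hN => ?_⟩
  have hN' : (0 : ℝ) < N := Nat.cast_pos.2 (NeZero.pos N)
  have hNδ : 1 / (N : ℝ) < δ := by
    rw [div_lt_comm₀ hN' hδ]
    exact hN₀.trans_le (by exact_mod_cast hN)
  have hg1 : ∀ p, |g p - cellAvg N g (cells N p)| ≤ η / 3 := by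
    refine abs_sub_cellAvg_le hgi fun p q hpq => ?_
    refine (hδ' (lt_of_le_of_lt ?_ hNδ)).le
    rw [Prod.dist_eq]
    exact max_le (dist_le_of_cell_eq (congrArg Prod.fst hpq))
      (dist_le_of_cell_eq (congrArg Prod.snd hpq))
  have hi1 : Integrable fun p => |f p - g p| := (hf.sub hgi).abs
  have hi3 : Integrable fun p => |cellAvg N (fun p => f p - g p) (cells N p)| :=
    (integrable_comp_cells _).abs
  have hi2 : Integrable fun p => |f p - g p| + η / 3 := hi1.add (integrable_const _)
  calc ∫ p, |f p - cellAvg N f (cells N p)|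
      ≤ ∫ p, (|f p - g p| + η / 3 + |cellAvg N (fun p => f p - g p) (cells N p)|) := by
        refine integral_mono (hf.sub (integrable_comp_cells _)).abs
          (hi2.add hi3) fun p => ?_
        have h2 := hg1 p
        simp only [cellAvg_sub hf hgi]
        have := abs_add_three (f p - g p) (g p - cellAvg N g (cells N p))
          (cellAvg N g (cells N p) - cellAvg N f (cells N p))
        rw [abs_sub_comm (cellAvg N g _)] at this
        have h3 : f p - g p + (g p - cellAvg N g (cells N p)) +
          (cellAvg N g (cells N p) - cellAvg N f (cells N p)) = f p - cellAvg N f (cells N p) := by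
          ring
        rw [h3] at this
        change |f p - cellAvg N f (cells N p)| ≤ _
        linarith
    _ = (∫ p, |f p - g p|) + η / 3 + ∫ p, |cellAvg N (fun p => f p - g p) (cells N p)| := by
        rw [integral_add hi2 hi3, integral_add hi1 (integrable_const _)]
        simp
    _ ≤ η := by
        have h1 := integral_abs_cellAvg_le (N := N) (hf.sub hgi)
        have h2 : ∫ p, |f p - g p| ≤ η / 3 := hg
        have h4 : ∫ p, |cellAvg N (fun p => f p - g p) (cells N p)| ≤ η / 3 := h1.trans h2
        linarith

end CellAverage

section EdgeDensity

variable {I Ω : Type*} [Fintype I]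

lemma abs_prod_sub_prod_le {α : Type*} (s : Finset α) {f g : α → ℝ}
    (hf : ∀ a, f a ∈ Set.Icc (0 : ℝ) 1) (hg : ∀ a, g a ∈ Set.Icc (0 : ℝ) 1) :
    |∏ a ∈ s, f a - ∏ a ∈ s, g a| ≤ ∑ a ∈ s, |f a - g a| := by
  classical
  induction s using Finset.induction_on with
  | empty => simp
  | insert a s ha ih =>
    rw [Finset.prod_insert ha, Finset.prod_insert ha, Finset.sum_insert ha]
    have h1 : f a * ∏ a ∈ s, f a - g a * ∏ a ∈ s, g a =
        (f a - g a) * ∏ a ∈ s, f a + g a * (∏ a ∈ s, f a - ∏ a ∈ s, g a) := by ring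
    have h2 : |∏ a ∈ s, f a| ≤ 1 := by
      rw [abs_of_nonneg (Finset.prod_nonneg fun a _ => (hf a).1)]
      exact Finset.prod_le_one (fun a _ => (hf a).1) fun a _ => (hf a).2
    have h3 : |g a| ≤ 1 := by
      rw [abs_of_nonneg (hg a).1]
      exact (hg a).2
    rw [h1]
    refine (abs_add_le _ _).trans (add_le_add ?_ ?_)
    · rw [abs_mul]
      exact mul_le_of_le_one_right (abs_nonneg _) h2
    · rw [abs_mul]
      exact (mul_le_of_le_one_left (abs_nonneg _) h3).trans ih

lemma measurePreserving_pair {i j : I} (h : i ≠ j) :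
    MeasurePreserving (fun x : I → unitInterval => (x i, x j)) := by
  have hind := ProbabilityTheory.iIndepFun_pi (ι := I) (Ω := fun _ => unitInterval)
    (μ := fun _ => (volume : Measure unitInterval)) (X := fun _ x => x)
    (fun _ => aemeasurable_id)
  have hij := hind.indepFun h
  rw [ProbabilityTheory.indepFun_iff_map_prod_eq_prod_map_map
    (measurable_pi_apply i).aemeasurable (measurable_pi_apply j).aemeasurable] at hij
  refine ⟨(measurable_pi_apply i).prodMk (measurable_pi_apply j), ?_⟩
  have hi := (measurePreserving_eval (fun _ : I => (volume : Measure unitInterval)) i).map_eq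
  have hj := (measurePreserving_eval (fun _ : I => (volume : Measure unitInterval)) j).map_eq
  rw [volume_pi, hij, Measure.volume_eq_prod]
  congr 1

variable [DecidableEq I]

/-- The density of the complete directed graph whose edge `e` carries the function `p (b e)`. -/
def edgeDens (p : Ω → unitInterval × unitInterval → ℝ) (b : I × I → Ω) : ℝ :=
  ∫ x : I → unitInterval, ∏ e : I × I with e.1 ≠ e.2, p (b e) (x e.1, x e.2)

lemma integrable_edgeProd {p : Ω → unitInterval × unitInterval → ℝ} (hp : ∀ ω, Measurable (p ω))
    (hp1 : ∀ ω q, p ω q ∈ Set.Icc (0 : ℝ) 1) (b : I × I → Ω) :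
    Integrable fun x : I → unitInterval => ∏ e : I × I with e.1 ≠ e.2, p (b e) (x e.1, x e.2) := by
  refine Integrable.of_bound (Measurable.aestronglyMeasurable ?_) 1 (ae_of_all _ fun x => ?_)
  · exact Finset.measurable_prod _ fun e _ =>
      (hp _).comp ((measurable_pi_apply e.1).prodMk (measurable_pi_apply e.2))
  · rw [Real.norm_eq_abs, abs_of_nonneg (Finset.prod_nonneg fun e _ => (hp1 _ _).1)]
    exact Finset.prod_le_one (fun e _ => (hp1 _ _).1) fun e _ => (hp1 _ _).2

lemma abs_edgeDens_sub_le {p p' : Ω → unitInterval × unitInterval → ℝ}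
    (hp : ∀ ω, Measurable (p ω)) (hp' : ∀ ω, Measurable (p' ω))
    (hp1 : ∀ ω q, p ω q ∈ Set.Icc (0 : ℝ) 1) (hp1' : ∀ ω q, p' ω q ∈ Set.Icc (0 : ℝ) 1)
    {η : ℝ} (hη : 0 ≤ η) (h : ∀ ω, ∫ q, |p ω q - p' ω q| ≤ η) (b : I × I → Ω) :
    |edgeDens p b - edgeDens p' b| ≤ (Fintype.card I : ℝ) ^ 2 * η := by
  have hi : ∀ ω, Integrable fun q => |p ω q - p' ω q| := fun ω =>
    Integrable.of_bound ((hp ω).sub (hp' ω)).abs.aestronglyMeasurable 1 (ae_of_all _ fun q => by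
      have h1 := hp1 ω q
      have h2 := hp1' ω q
      rw [Real.norm_eq_abs, abs_abs, abs_le]
      constructor <;> linarith [h1.1, h1.2, h2.1, h2.2])
  have hmp : ∀ e ∈ Finset.univ.filter (fun e : I × I => e.1 ≠ e.2),
      MeasurePreserving (fun x : I → unitInterval => (x e.1, x e.2)) := fun e he =>
    measurePreserving_pair (by simpa using he)
  have hie : ∀ e ∈ Finset.univ.filter (fun e : I × I => e.1 ≠ e.2),
      Integrable fun x : I → unitInterval => |p (b e) (x e.1, x e.2) - p' (b e) (x e.1, x e.2)| :=
    fun e he => (hmp e he).integrable_comp_of_integrable (hi (b e))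
  rw [edgeDens, edgeDens, ← integral_sub (integrable_edgeProd hp hp1 b)
    (integrable_edgeProd hp' hp1' b)]
  calc |∫ x : I → unitInterval, ((∏ e : I × I with e.1 ≠ e.2, p (b e) (x e.1, x e.2)) -
          ∏ e : I × I with e.1 ≠ e.2, p' (b e) (x e.1, x e.2))|
      ≤ ∫ x : I → unitInterval, |(∏ e : I × I with e.1 ≠ e.2, p (b e) (x e.1, x e.2)) -
          ∏ e : I × I with e.1 ≠ e.2, p' (b e) (x e.1, x e.2)| := abs_integral_le_integral_abs
    _ ≤ ∫ x : I → unitInterval, ∑ e : I × I with e.1 ≠ e.2,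
          |p (b e) (x e.1, x e.2) - p' (b e) (x e.1, x e.2)| := by
        refine integral_mono ((integrable_edgeProd hp hp1 b).sub
          (integrable_edgeProd hp' hp1' b)).abs (integrable_finsetSum _ hie) fun x => ?_
        exact abs_prod_sub_prod_le _ (fun e => hp1 _ _) fun e => hp1' _ _
    _ = ∑ e : I × I with e.1 ≠ e.2, ∫ q, |p (b e) q - p' (b e) q| := by
        rw [integral_finsetSum _ hie]
        refine Finset.sum_congr rfl fun e he => ?_
        have := (hmp e he).map_eq
        rw [← this, integral_map (hmp e he).measurable.aemeasurable]
        exact ((hp _).sub (hp' _)).abs.aestronglyMeasurable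
    _ ≤ ∑ e : I × I with e.1 ≠ e.2, η := Finset.sum_le_sum fun e _ => h _
    _ ≤ ∑ _e : I × I, η :=
        Finset.sum_le_sum_of_subset_of_nonneg (Finset.filter_subset _ _) fun _ _ _ => hη
    _ = (Fintype.card I : ℝ) ^ 2 * η := by
        simp [Fintype.card_prod, sq]

lemma integral_comp_cell {N : ℕ} [NeZero N] (G : (I → Fin N) → ℝ) :
    ∫ x : I → unitInterval, G (fun i => cell N (x i)) = pE (unif I (Fin N)) G := by
  have hmp : MeasurePreserving (fun (x : I → unitInterval) i => cell N (x i)) volume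
      (Measure.pi fun _ => (volume : Measure unitInterval).map (cell N)) := by
    refine measurePreserving_pi _ _ fun i => ?_
    exact ⟨measurable_cell, rfl⟩
  have : IsProbabilityMeasure ((volume : Measure unitInterval).map (cell N)) :=
    Measure.isProbabilityMeasure_map measurable_cell.aemeasurable
  have h1 := integral_map (μ := (volume : Measure (I → unitInterval))) (f := G)
    hmp.measurable.aemeasurable (measurable_of_countable G).aestronglyMeasurable
  rw [← h1, hmp.map_eq, integral_fintype (.of_finite)]
  unfold pE
  refine Finset.sum_congr rfl fun z _ => ?_
  rw [smul_eq_mul]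
  congr 1
  rw [measureReal_def, Measure.pi_singleton, ENNReal.toReal_prod]
  refine Finset.prod_congr rfl fun i _ => ?_
  rw [Measure.map_apply measurable_cell (measurableSet_singleton _), ← measureReal_def,
    measureReal_cell]
  simp [unif]

lemma edgeDens_comp_cells {N : ℕ} [NeZero N] (u : Fin N → Fin N → Ω → ℝ) (b : I × I → Ω) :
    edgeDens (fun ω q => u (cell N q.1) (cell N q.2) ω) b = sampleProb u b := by
  unfold edgeDens sampleProb
  rw [← integral_comp_cell]

end EdgeDensity

section CellPermutation

lemma sum_abs_setIntegral_comp_cells_le {ι : Type*} [Fintype ι] {wt : ι → ℝ} {N : ℕ} [NeZero N]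
    (hwt : ∀ n, 0 ≤ wt n)
    (V : ι → Fin N → Fin N → ℝ) {S T : Set unitInterval} (hS : MeasurableSet S)
    (hT : MeasurableSet T) :
    ∑ n, wt n * |∫ p in S ×ˢ T, V n (cell N p.1) (cell N p.2)| ≤ cut wt V / (N : ℝ) ^ 2 := by
  have hN : (0 : ℝ) < N := Nat.cast_pos.2 (NeZero.pos N)
  let s : Set unitInterval → Fin N → ℝ := fun S z =>
    N * (volume : Measure unitInterval).real (S ∩ cell N ⁻¹' {z})
  have hs : ∀ S z, s S z ∈ Set.Icc (0 : ℝ) 1 := fun S z => by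
    refine ⟨by positivity, ?_⟩
    calc s S z ≤ N * (volume : Measure unitInterval).real (cell N ⁻¹' {z}) := by
          refine mul_le_mul_of_nonneg_left (measureReal_mono Set.inter_subset_right) hN.le
      _ = 1 := by rw [measureReal_cell]; field_simp
  rw [le_div_iff₀ (by positivity), Finset.sum_mul]
  refine le_trans (Finset.sum_le_sum fun n _ => ?_)
    (sum_abs_frac_le_cut hwt V (hs S) (hs T))
  rw [mul_assoc]
  refine mul_le_mul_of_nonneg_left (le_of_eq ?_) (hwt n)
  have h1 := setIntegral_comp_cells (fun a : Fin N × Fin N => V n a.1 a.2) (hS.prod hT)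
  simp only [cells] at h1
  rw [h1, ← abs_of_pos (show (0 : ℝ) < (N : ℝ) ^ 2 by positivity), ← abs_mul,
    Fintype.sum_prod_type, Finset.sum_mul]
  congr 1
  refine Finset.sum_congr rfl fun z _ => ?_
  rw [Finset.sum_mul]
  refine Finset.sum_congr rfl fun z' _ => ?_
  have h2 : S ×ˢ T ∩ cells N ⁻¹' {(z, z')} =
      (S ∩ cell N ⁻¹' {z}) ×ˢ (T ∩ cell N ⁻¹' {z'}) := by
    rw [cells_preimage, Set.prod_inter_prod]
  rw [h2, Measure.volume_eq_prod, measureReal_prod_prod]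
  simp only [s]
  ring

variable {ι I Ω : Type*} [Fintype ι] {wt : ι → ℝ} [Fintype I] [DecidableEq I] [Fintype Ω]

/-- A measurable family of laws on `Ω` indexed by the unit square. -/
structure IsLawField (p : Ω → unitInterval × unitInterval → ℝ) : Prop where
  measurable : ∀ ω, Measurable (p ω)
  nonneg : ∀ ω x, 0 ≤ p ω x
  sum_eq_one : ∀ x, ∑ ω, p ω x = 1

variable {p q : Ω → unitInterval × unitInterval → ℝ}

lemma IsLawField.mem_Icc (hp : IsLawField p) (ω : Ω) (x : unitInterval × unitInterval) :
    p ω x ∈ Set.Icc (0 : ℝ) 1 :=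
  ⟨hp.nonneg ω x, (Finset.single_le_sum (f := fun ω => p ω x) (fun ω _ => hp.nonneg ω x)
    (Finset.mem_univ ω)).trans_eq (hp.sum_eq_one x)⟩

lemma IsLawField.integrable (hp : IsLawField p) (ω : Ω) : Integrable (p ω) :=
  Integrable.of_bound (hp.measurable ω).aestronglyMeasurable 1 (ae_of_all _ fun x => by
    rw [Real.norm_eq_abs, abs_of_nonneg (hp.nonneg ω x)]
    exact (hp.mem_Icc ω x).2)

/-- The cell averages of a family of laws. -/
def cellLaw (N : ℕ) [NeZero N] (p : Ω → unitInterval × unitInterval → ℝ) (z z' : Fin N) (ω : Ω) :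
    ℝ :=
  cellAvg N (p ω) (z, z')

lemma IsLawField.isLaw_cellLaw (hp : IsLawField p) {N : ℕ} [NeZero N] (z : Fin N) :
    IsLaw (cellLaw N p z) := by
  refine ⟨fun z' ω => cellAvg_nonneg (hp.nonneg ω) _, fun z' => ?_⟩
  simp only [cellLaw]
  rw [cellAvg_sum hp.integrable]
  simp only [hp.sum_eq_one]
  exact cellAvg_const 1 _

lemma IsLawField.comp_cells (hp : IsLawField p) {N : ℕ} [NeZero N] :
    IsLawField fun ω x => cellLaw N p (cell N x.1) (cell N x.2) ω where
  measurable ω := (measurable_of_countable (cellAvg N (p ω))).comp measurable_cells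
  nonneg _ _ := (hp.isLaw_cellLaw _).1 _ _
  sum_eq_one _ := (hp.isLaw_cellLaw _).2 _

/-- The means of the test functions `h n` under the laws `p`. -/
def fieldMix (p : Ω → unitInterval × unitInterval → ℝ) (h : ι → Ω → ℝ) (n : ι)
    (x : unitInterval × unitInterval) : ℝ :=
  ∑ ω, p ω x * h n ω

omit [Fintype ι] in
lemma IsLawField.integrable_fieldMix (hp : IsLawField p) (h : ι → Ω → ℝ) (n : ι) :
    Integrable (fieldMix p h n) :=
  integrable_finsetSum _ fun ω _ => (hp.integrable ω).mul_const _

omit [Fintype ι] in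
lemma integral_abs_fieldMix_sub_le (hp : IsLawField p) (hq : IsLawField q) {h : ι → Ω → ℝ}
    (hh : ∀ n ω, h n ω ∈ Set.Icc (0 : ℝ) 1) {η : ℝ} (hpq : ∀ ω, ∫ x, |p ω x - q ω x| ≤ η) (n : ι) :
    ∫ x, |fieldMix p h n x - fieldMix q h n x| ≤ Fintype.card Ω * η := by
  have hi : ∀ ω, Integrable fun x => |p ω x - q ω x| := fun ω =>
    ((hp.integrable ω).sub (hq.integrable ω)).abs
  calc ∫ x, |fieldMix p h n x - fieldMix q h n x|
      ≤ ∫ x, ∑ ω, |p ω x - q ω x| := by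
        refine integral_mono ((hp.integrable_fieldMix h n).sub (hq.integrable_fieldMix h n)).abs
          (integrable_finsetSum _ fun ω _ => hi ω) fun x => ?_
        simp only [fieldMix]
        rw [← Finset.sum_sub_distrib]
        refine (Finset.abs_sum_le_sum_abs _ _).trans (Finset.sum_le_sum fun ω _ => ?_)
        rw [← sub_mul, abs_mul, abs_of_nonneg (hh n ω).1]
        exact mul_le_of_le_one_right (abs_nonneg _) (hh n ω).2
    _ = ∑ ω, ∫ x, |p ω x - q ω x| := integral_finsetSum _ fun ω _ => hi ω
    _ ≤ ∑ _ω : Ω, η := Finset.sum_le_sum fun ω _ => hpq ω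
    _ = Fintype.card Ω * η := by simp

/-- If two fields of laws have almost the same densities of complete decorated graphs, then they
are close in cut distance after a rearrangement of the interval. -/
theorem exists_perm_fieldMix_le [Nonempty I] [Nonempty Ω]
    (hwt : ∀ n, 0 ≤ wt n) (hwt1 : ∑ n, wt n ≤ 1) (hp : IsLawField p) (hq : IsLawField q)
    {h : ι → Ω → ℝ} (hh : ∀ n ω, h n ω ∈ Set.Icc (0 : ℝ) 1) {ε : ℝ} (hε : 0 < ε) {R : ℕ}
    (hR : 1 < (R + 1) * ε ^ 2) {τ : ℝ}
    (hτ : ∀ b : I × I → Ω, |edgeDens p b - edgeDens q b| ≤ τ) {δ : ℝ} (hδ : 0 < δ) :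
    ∃ φ : Equiv.Perm unitInterval, MeasurePreserving φ ∧
      ∀ S T : Set unitInterval, MeasurableSet S → MeasurableSet T →
        ∑ n, wt n * |∫ x in S ×ˢ T, (fieldMix p h n x - fieldMix q h n (φ x.1, φ x.2))| ≤
          2 * samplingErr ε R (Fintype.card I) + (Fintype.card Ω : ℝ) ^ (Fintype.card I ^ 2) * τ +
            δ := by
  set K : ℝ := (Fintype.card Ω : ℝ) ^ (Fintype.card I ^ 2) * (2 * (Fintype.card I : ℝ) ^ 2) +
    2 * Fintype.card Ω + 1 with hK
  have hKpos : 0 < K := by positivity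
  set η : ℝ := δ / K with hηdef
  have hη : 0 < η := by positivity
  choose Np hNp using fun ω => exists_integral_sub_cellAvg_le (hp.integrable ω) hη
  choose Nq hNq using fun ω => exists_integral_sub_cellAvg_le (hq.integrable ω) hη
  set M : ℕ := ∑ ω, (Np ω + Nq ω) + 1 with hM
  set N : ℕ := Fintype.card I * M with hN
  have hcard : 0 < Fintype.card I := Fintype.card_pos
  have : NeZero N := ⟨by positivity⟩
  have hMN : M ≤ N := Nat.le_mul_of_pos_left M hcard
  have hle : ∀ ω, Np ω + Nq ω ≤ N := fun ω => by
    have := Finset.single_le_sum (f := fun ω => Np ω + Nq ω) (fun _ _ => Nat.zero_le _)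
      (Finset.mem_univ ω)
    omega
  have hpη : ∀ ω, ∫ x, |p ω x - cellLaw N p (cell N x.1) (cell N x.2) ω| ≤ η := fun ω =>
    hNp ω N (by have := hle ω; omega)
  have hqη : ∀ ω, ∫ x, |q ω x - cellLaw N q (cell N x.1) (cell N x.2) ω| ≤ η := fun ω =>
    hNq ω N (by have := hle ω; omega)
  have hN0 : (0 : ℝ) < N := Nat.cast_pos.2 (NeZero.pos N)
  have hp' : IsLawField fun ω x => cellLaw N p (cell N x.1) (cell N x.2) ω := hp.comp_cells
  have hq' : IsLawField fun ω x => cellLaw N q (cell N x.1) (cell N x.2) ω := hq.comp_cells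
  have hτ' : ∀ b : I × I → Ω, |sampleProb (cellLaw N p) b - sampleProb (cellLaw N q) b| ≤
      τ + 2 * (Fintype.card I : ℝ) ^ 2 * η := fun b => by
    have h1 := abs_edgeDens_sub_le hp.measurable hp'.measurable hp.mem_Icc hp'.mem_Icc hη.le hpη b
    have h2 := abs_edgeDens_sub_le hq.measurable hq'.measurable hq.mem_Icc hq'.mem_Icc hη.le hqη b
    rw [edgeDens_comp_cells] at h1 h2
    have h3 := hτ b
    rw [abs_le] at h1 h2 h3 ⊢
    constructor <;> linarith [h1.1, h1.2, h2.1, h2.2, h3.1, h3.2]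
  have e₀ : Fin N ≃ I × Fin M := Fintype.equivOfCardEq (by simp [hN])
  obtain ⟨σ, hσ⟩ := exists_perm_cut_le hwt hwt1 (fun z => hp.isLaw_cellLaw z)
    (fun z => hq.isLaw_cellLaw z) hh e₀ hε hR hτ'
  have hφ := measurePreserving_cellPerm σ
  refine ⟨cellPerm σ, hφ, fun S T hS hT => ?_⟩
  have hφ2 : MeasurePreserving
      (fun x : unitInterval × unitInterval => (cellPerm σ x.1, cellPerm σ x.2)) := hφ.prod hφ
  set V : ι → Fin N → Fin N → ℝ := fun n z z' =>
    mix (cellLaw N p) h n z z' - mix (cellLaw N q) h n (σ z) (σ z') with hV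
  have hcut := sum_abs_setIntegral_comp_cells_le hwt V hS hT
  have hcells : ∀ᵐ x : unitInterval × unitInterval,
      cell N (cellPerm σ x.1) = σ (cell N x.1) ∧ cell N (cellPerm σ x.2) = σ (cell N x.2) := by
    have h1 := Measure.quasiMeasurePreserving_fst (μ := (volume : Measure unitInterval))
      (ν := (volume : Measure unitInterval)) |>.ae (cell_cellPerm_ae σ)
    have h2 := Measure.quasiMeasurePreserving_snd (μ := (volume : Measure unitInterval))
      (ν := (volume : Measure unitInterval)) |>.ae (cell_cellPerm_ae σ)
    exact h1.and h2
  have hbound : ∀ n, |∫ x in S ×ˢ T,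
      (fieldMix p h n x - fieldMix q h n (cellPerm σ x.1, cellPerm σ x.2))| ≤
      |∫ x in S ×ˢ T, V n (cell N x.1) (cell N x.2)| + 2 * (Fintype.card Ω * η) := fun n => by
    set f₁ : unitInterval × unitInterval → ℝ := fun x => fieldMix p h n x -
      fieldMix (fun ω x => cellLaw N p (cell N x.1) (cell N x.2) ω) h n x with hf₁
    set f₂ : unitInterval × unitInterval → ℝ := fun x => fieldMix q h n x -
      fieldMix (fun ω x => cellLaw N q (cell N x.1) (cell N x.2) ω) h n x with hf₂
    have hi1 : Integrable f₁ := (hp.integrable_fieldMix h n).sub (hp'.integrable_fieldMix h n)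
    have hi2 : Integrable f₂ := (hq.integrable_fieldMix h n).sub (hq'.integrable_fieldMix h n)
    have hi2' : Integrable fun x : unitInterval × unitInterval =>
      f₂ (cellPerm σ x.1, cellPerm σ x.2) := hφ2.integrable_comp_of_integrable hi2
    have hiV : Integrable fun x : unitInterval × unitInterval =>
      V n (cell N x.1) (cell N x.2) := integrable_comp_cells fun a => V n a.1 a.2
    have hiV1 : Integrable fun x : unitInterval × unitInterval =>
      V n (cell N x.1) (cell N x.2) + f₁ x := hiV.add hi1
    have hA : ∫ x in S ×ˢ T,
        (fieldMix p h n x - fieldMix q h n (cellPerm σ x.1, cellPerm σ x.2)) =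
        (∫ x in S ×ˢ T, V n (cell N x.1) (cell N x.2)) + (∫ x in S ×ˢ T, f₁ x) -
          ∫ x in S ×ˢ T, f₂ (cellPerm σ x.1, cellPerm σ x.2) := by
      rw [← integral_add hiV.integrableOn hi1.integrableOn,
        ← integral_sub hiV1.integrableOn hi2'.integrableOn]
      refine integral_congr_ae (ae_restrict_of_ae ?_)
      filter_upwards [hcells] with x hx
      simp only [hf₁, hf₂, hV, fieldMix, mix, hx.1, hx.2]
      ring
    have h1 : |∫ x in S ×ˢ T, f₁ x| ≤ Fintype.card Ω * η :=
      abs_integral_le_integral_abs.trans <| (setIntegral_le_integral hi1.abs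
        (ae_of_all _ fun _ => abs_nonneg _)).trans
          (integral_abs_fieldMix_sub_le hp hp' hh hpη n)
    have h2 : |∫ x in S ×ˢ T, f₂ (cellPerm σ x.1, cellPerm σ x.2)| ≤ Fintype.card Ω * η := by
      refine abs_integral_le_integral_abs.trans <| (setIntegral_le_integral hi2'.abs
        (ae_of_all _ fun _ => abs_nonneg _)).trans ?_
      have h3 := integral_map (f := fun x => |f₂ x|) hφ2.measurable.aemeasurable
        (by rw [hφ2.map_eq]; exact hi2.abs.aestronglyMeasurable)
      rw [hφ2.map_eq] at h3
      exact h3.symm.trans_le (integral_abs_fieldMix_sub_le hq hq' hh hqη n)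
    rw [hA]
    rw [abs_le] at h1 h2
    have h4 := neg_abs_le (∫ x in S ×ˢ T, V n (cell N x.1) (cell N x.2))
    have h5 := le_abs_self (∫ x in S ×ˢ T, V n (cell N x.1) (cell N x.2))
    rw [abs_le]
    constructor <;> linarith [h1.1, h1.2, h2.1, h2.2]
  have hfin : cut wt V / (N : ℝ) ^ 2 ≤ 2 * samplingErr ε R (Fintype.card I) +
      (Fintype.card Ω : ℝ) ^ (Fintype.card I ^ 2) * (τ + 2 * (Fintype.card I : ℝ) ^ 2 * η) := by
    rw [div_le_iff₀ (by positivity), mul_comm _ ((N : ℝ) ^ 2)]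
    rw [Fintype.card_fin] at hσ
    exact hσ
  have hKη : K * η = δ := by rw [hηdef]; field_simp
  calc ∑ n, wt n * |∫ x in S ×ˢ T,
        (fieldMix p h n x - fieldMix q h n (cellPerm σ x.1, cellPerm σ x.2))|
      ≤ ∑ n, wt n * (|∫ x in S ×ˢ T, V n (cell N x.1) (cell N x.2)| +
          2 * (Fintype.card Ω * η)) :=
        Finset.sum_le_sum fun n _ => mul_le_mul_of_nonneg_left (hbound n) (hwt n)
    _ = ∑ n, wt n * |∫ x in S ×ˢ T, V n (cell N x.1) (cell N x.2)| +
          (∑ n, wt n) * (2 * (Fintype.card Ω * η)) := by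
        rw [Finset.sum_mul, ← Finset.sum_add_distrib]
        exact Finset.sum_congr rfl fun n _ => mul_add _ _ _
    _ ≤ cut wt V / (N : ℝ) ^ 2 + 1 * (2 * (Fintype.card Ω * η)) := by gcongr
    _ ≤ _ := by
        have : (Fintype.card Ω : ℝ) ^ (Fintype.card I ^ 2) *
            (2 * (Fintype.card I : ℝ) ^ 2 * η) + 2 * (Fintype.card Ω * η) ≤ δ := by
          rw [← hKη, hK]
          nlinarith
        linarith

end CellPermutation

section Graphon

/-- A probability-graphon seen as a Markov kernel. -/
def IsProbGraphon.kernel {W : Sq → Measure Z} (hW : IsProbGraphon W) :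
    ProbabilityTheory.Kernel Sq Z :=
  ⟨W, Measure.measurable_of_measurable_coe W hW.1⟩

omit [TopologicalSpace Z] in
lemma IsProbGraphon.isMarkovKernel {W : Sq → Measure Z} (hW : IsProbGraphon W) :
    ProbabilityTheory.IsMarkovKernel hW.kernel :=
  ⟨hW.2⟩

omit [TopologicalSpace Z] in
lemma IsProbGraphon.relabel {W : Sq → Measure Z} (hW : IsProbGraphon W)
    {φ : unitInterval → unitInterval} (hφ : Measurable φ) : IsProbGraphon (relabel W φ) :=
  ⟨fun A hA => (hW.1 A hA).comp
    ((hφ.comp measurable_fst).prodMk (hφ.comp measurable_snd)), fun _ => hW.2 _⟩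

omit [TopologicalSpace Z] in
lemma IsProbGraphon.kernelInt_univ {W : Sq → Measure Z} (hW : IsProbGraphon W) (A : Set Sq) :
    kernelInt W A Set.univ = volume A := by
  rw [kernelInt, Measure.bind_apply MeasurableSet.univ
    (Measure.measurable_of_measurable_coe W hW.1).aemeasurable]
  have : ∀ x, W x Set.univ = 1 := fun x => (hW.2 x).measure_univ
  simp [this]

variable [BorelSpace Z]

lemma IsProbGraphon.measurable_integral {W : Sq → Measure Z} (hW : IsProbGraphon W)
    (f : BoundedContinuousFunction Z ℝ) : Measurable fun x => ∫ z, f z ∂(W x) := by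
  have := hW.isMarkovKernel
  exact (f.continuous.measurable.stronglyMeasurable.integral_kernel
    (κ := hW.kernel)).measurable

lemma IsProbGraphon.integrable {W : Sq → Measure Z} (hW : IsProbGraphon W)
    (f : BoundedContinuousFunction Z ℝ) (x : Sq) : Integrable f (W x) :=
  have := hW.2 x
  Integrable.of_bound f.continuous.measurable.aestronglyMeasurable ‖f‖
    (ae_of_all _ f.norm_coe_le_norm)

lemma IsProbGraphon.integral_mem_Icc {W : Sq → Measure Z} (hW : IsProbGraphon W)
    {f : BoundedContinuousFunction Z ℝ} (hf : ∀ z, f z ∈ Set.Icc (0 : ℝ) 1) (x : Sq) :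
    ∫ z, f z ∂(W x) ∈ Set.Icc (0 : ℝ) 1 := by
  have := hW.2 x
  refine ⟨integral_nonneg fun z => (hf z).1, ?_⟩
  calc ∫ z, f z ∂(W x) ≤ ∫ _, (1 : ℝ) ∂(W x) :=
        integral_mono (hW.integrable f x) (integrable_const _) fun z => (hf z).2
    _ = 1 := by simp

lemma IsProbGraphon.integral_kernelInt {W : Sq → Measure Z} (hW : IsProbGraphon W)
    (f : BoundedContinuousFunction Z ℝ) (A : Set Sq) :
    ∫ z, f z ∂(kernelInt W A) = ∫ x in A, ∫ z, f z ∂(W x) := by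
  have := hW.isMarkovKernel
  have h : kernelInt W A = (hW.kernel.comp
      (ProbabilityTheory.Kernel.const Unit ((volume : Measure Sq).restrict A))) () := by
    rw [ProbabilityTheory.Kernel.comp_apply]
    rfl
  rw [h, ProbabilityTheory.Kernel.integral_comp]
  · rfl
  · rw [← h]
    have : IsFiniteMeasure (kernelInt W A) := ⟨by
      rw [hW.kernelInt_univ]; exact measure_lt_top _ _⟩
    exact Integrable.of_bound f.continuous.measurable.aestronglyMeasurable ‖f‖
      (ae_of_all _ f.norm_coe_le_norm)

omit [BorelSpace Z] in
lemma Fdist_nonneg (F : ℕ → BoundedContinuousFunction Z ℝ) (μ ν : Measure Z) :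
    0 ≤ Fdist F μ ν :=
  tsum_nonneg fun _ => by positivity

omit [BorelSpace Z] in
lemma cutDistF_nonneg (F : ℕ → BoundedContinuousFunction Z ℝ) (U W : Sq → Measure Z) :
    0 ≤ cutDistF F U W :=
  Real.iSup_nonneg fun _ => Fdist_nonneg _ _ _

omit [BorelSpace Z] in
lemma deltaCut_le (F : ℕ → BoundedContinuousFunction Z ℝ) (U W : Sq → Measure Z)
    {φ : Equiv.Perm unitInterval} (hφ : MeasurePreserving φ) :
    deltaCut (cutDistF F) U W ≤ cutDistF F U (relabel W φ) :=
  ciInf_le (f := fun φ : {φ : unitInterval → unitInterval // IsMP φ ∧ Function.Bijective φ} =>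
    cutDistF F U (relabel W φ.val))
    ⟨0, by rintro _ ⟨φ, rfl⟩; exact cutDistF_nonneg _ _ _⟩ ⟨φ, hφ, φ.bijective⟩

lemma Fdist_kernelInt_le {F : ℕ → BoundedContinuousFunction Z ℝ} (hF0 : F 0 = 1)
    (hF : ∀ n z, F n z ∈ Set.Icc (0 : ℝ) 1) {U W : Sq → Measure Z} (hU : IsProbGraphon U)
    (hW : IsProbGraphon W) (A : Set Sq) (m : ℕ) :
    Fdist F (kernelInt U A) (kernelInt W A) ≤ ∑ n : Fin m, (1 / 2 : ℝ) ^ ((n : ℕ) + 1) *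
      |∫ x in A, ((∫ z, F (n + 1) z ∂(U x)) - ∫ z, F (n + 1) z ∂(W x))| + (1 / 2 : ℝ) ^ m := by
  have hi : ∀ {W : Sq → Measure Z}, IsProbGraphon W → ∀ n,
      IntegrableOn (fun x => ∫ z, F n z ∂(W x)) A := fun hW n =>
    Integrable.of_bound (hW.measurable_integral _).aestronglyMeasurable 1 (ae_of_all _ fun x => by
      have h := hW.integral_mem_Icc (hF n) x
      rw [Real.norm_eq_abs, abs_of_nonneg h.1]
      exact h.2)
  set a : ℕ → ℝ := fun n => |∫ x in A, ((∫ z, F n z ∂(U x)) - ∫ z, F n z ∂(W x))| with ha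
  have ha0 : a 0 = 0 := by
    have h1 : ∀ x, ∫ z, F 0 z ∂(U x) - ∫ z, F 0 z ∂(W x) = 0 := fun x => by
      have := hU.2 x
      have := hW.2 x
      simp [hF0]
    simp [ha, h1]
  have ha1 : ∀ n, a n ≤ 1 := fun n => by
    have h1 : ∀ x ∈ A, ‖(∫ z, F n z ∂(U x)) - ∫ z, F n z ∂(W x)‖ ≤ 1 := fun x _ => by
      have h1 := hU.integral_mem_Icc (hF n) x
      have h2 := hW.integral_mem_Icc (hF n) x
      rw [Real.norm_eq_abs, abs_le]
      constructor <;> linarith [h1.1, h1.2, h2.1, h2.2]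
    refine (norm_setIntegral_le_of_norm_le_const (measure_lt_top volume A) h1).trans ?_
    rw [one_mul]
    exact measureReal_le_one
  have hFd : Fdist F (kernelInt U A) (kernelInt W A) = ∑' n, (1 / 2 : ℝ) ^ n * a n := by
    unfold Fdist
    refine tsum_congr fun n => ?_
    rw [hU.integral_kernelInt, hW.integral_kernelInt, ← integral_sub (hi hU n) (hi hW n)]
  have hg : Summable fun n : ℕ => (1 / 2 : ℝ) ^ n :=
    summable_geometric_of_lt_one (by norm_num) (by norm_num)
  have hs : Summable fun n => (1 / 2 : ℝ) ^ n * a n :=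
    Summable.of_nonneg_of_le (fun n => mul_nonneg (by positivity) (abs_nonneg _))
      (fun n => mul_le_of_le_one_right (by positivity) (ha1 n)) hg
  rw [hFd, ← hs.sum_add_tsum_nat_add (m + 1), Finset.sum_range_succ', ha0, mul_zero, add_zero,
    ← Fin.sum_univ_eq_sum_range (fun n => (1 / 2 : ℝ) ^ (n + 1) * a (n + 1)) m]
  refine add_le_add le_rfl ?_
  have h2 : ∑' n : ℕ, (1 / 2 : ℝ) ^ (m + 1) * (1 / 2 : ℝ) ^ n = (1 / 2 : ℝ) ^ m := by
    rw [tsum_mul_left, tsum_geometric_of_lt_one (by norm_num) (by norm_num), pow_succ]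
    norm_num
    ring
  rw [← h2]
  refine ((summable_nat_add_iff (m + 1)).2 hs).tsum_le_tsum (fun n => ?_) (hg.mul_left _)
  rw [← pow_add, add_comm (m + 1) n]
  exact mul_le_of_le_one_right (by positivity) (ha1 _)

/-- The product of the functions `F (n + 1)` for `n ∈ ω` and `1 - F (n + 1)` for `n ∉ ω`. -/
def pattern (F : ℕ → BoundedContinuousFunction Z ℝ) {m : ℕ} (ω : Finset (Fin m)) :
    BoundedContinuousFunction Z ℝ :=
  (∏ n ∈ ω, F (n + 1)) * ∏ n ∈ ωᶜ, (1 - F (n + 1))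

omit [MeasurableSpace Z] [BorelSpace Z] in
lemma pattern_apply (F : ℕ → BoundedContinuousFunction Z ℝ) {m : ℕ} (ω : Finset (Fin m)) (z : Z) :
    pattern F ω z = (∏ n ∈ ω, F (n + 1) z) * ∏ n ∈ ωᶜ, (1 - F (n + 1) z) := by
  simp [pattern]

omit [MeasurableSpace Z] [BorelSpace Z] in
lemma sum_pattern (F : ℕ → BoundedContinuousFunction Z ℝ) (m : ℕ) (z : Z) :
    ∑ ω : Finset (Fin m), pattern F ω z = 1 := by
  simp only [pattern_apply]
  rw [← Fintype.prod_add]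
  simp

omit [MeasurableSpace Z] [BorelSpace Z] in
lemma sum_pattern_mul_mem (F : ℕ → BoundedContinuousFunction Z ℝ) {m : ℕ} (n : Fin m) (z : Z) :
    ∑ ω : Finset (Fin m), pattern F ω z * (if n ∈ ω then 1 else 0) = F (n + 1) z := by
  have h := Fintype.prod_add (fun n : Fin m => F (n + 1) z)
    (fun i => if i = n then 0 else 1 - F (i + 1) z)
  rw [Finset.prod_eq_single n (fun i _ hi => by simp [hi]) (by simp)] at h
  rw [if_pos rfl, add_zero] at h
  rw [h]
  refine Finset.sum_congr rfl fun ω _ => ?_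
  rw [pattern_apply]
  split_ifs with hn
  · rw [mul_one]
    congr 1
    refine Finset.prod_congr rfl fun i hi => ?_
    rw [if_neg]
    rintro rfl
    exact Finset.mem_compl.1 hi hn
  · have h0 : ∏ i ∈ ωᶜ, (if i = n then (0 : ℝ) else 1 - F (i + 1) z) = 0 :=
      Finset.prod_eq_zero (Finset.mem_compl.2 hn) (if_pos rfl)
    rw [mul_zero, h0, mul_zero]

omit [MeasurableSpace Z] [BorelSpace Z] in
lemma pattern_nonneg {F : ℕ → BoundedContinuousFunction Z ℝ}
    (hF : ∀ n z, F n z ∈ Set.Icc (0 : ℝ) 1) {m : ℕ} (ω : Finset (Fin m)) (z : Z) :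
    0 ≤ pattern F ω z := by
  rw [pattern_apply]
  exact mul_nonneg (Finset.prod_nonneg fun n _ => (hF _ z).1)
    (Finset.prod_nonneg fun n _ => sub_nonneg.2 (hF _ z).2)

/-- The means of the functions `pattern F ω` under a probability-graphon. -/
def patternLaw (F : ℕ → BoundedContinuousFunction Z ℝ) (m : ℕ) (W : Sq → Measure Z)
    (ω : Finset (Fin m)) (x : Sq) : ℝ :=
  ∫ z, pattern F ω z ∂(W x)

lemma isLawField_patternLaw {F : ℕ → BoundedContinuousFunction Z ℝ}
    (hF : ∀ n z, F n z ∈ Set.Icc (0 : ℝ) 1) {W : Sq → Measure Z} (hW : IsProbGraphon W) (m : ℕ) :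
    IsLawField (patternLaw F m W) where
  measurable _ := hW.measurable_integral _
  nonneg ω _ := integral_nonneg (pattern_nonneg hF ω)
  sum_eq_one x := by
    have := hW.2 x
    simp only [patternLaw]
    rw [← integral_finsetSum _ fun ω _ => hW.integrable _ x]
    simp [sum_pattern]

lemma fieldMix_patternLaw (F : ℕ → BoundedContinuousFunction Z ℝ)
    {W : Sq → Measure Z} (hW : IsProbGraphon W) {m : ℕ} (n : Fin m) (x : Sq) :
    fieldMix (patternLaw F m W) (fun n ω => if n ∈ ω then 1 else 0) n x =
      ∫ z, F (n + 1) z ∂(W x) := by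
  simp only [fieldMix, patternLaw]
  simp_rw [← integral_mul_const]
  rw [← integral_finsetSum _ fun ω _ => (hW.integrable _ x).mul_const _]
  simp only [sum_pattern_mul_mem]

omit [BorelSpace Z] in
lemma homDensity_pattern (F : ℕ → BoundedContinuousFunction Z ℝ) {m k : ℕ} (W : Sq → Measure Z)
    (b : Fin k × Fin k → Finset (Fin m)) :
    homDensity (completeEdges k) (fun e => (∏ i ∈ (b e).map ⟨fun n : Fin m => (n : ℕ) + 1,
        fun i j h => by ext; simpa using h⟩, F i) *
      ∏ i ∈ (b e)ᶜ.map ⟨fun n : Fin m => (n : ℕ) + 1, fun i j h => by ext; simpa using h⟩,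
        (1 - F i)) W = edgeDens (patternLaw F m W) b := by
  simp only [Finset.prod_map]
  rfl

end Graphon

section Assembly

/-- The choice `ε = 4 / √L`, `R = ⌊L / 16⌋` with `L = log k` in the sampling error. -/
lemma exists_samplingErr_le {k : ℕ} (hk : 1936 < Real.log k) :
    ∃ (ε : ℝ) (R : ℕ), 0 < ε ∧ 1 < (R + 1) * ε ^ 2 ∧
      2 * samplingErr ε R k + (1 / 2 : ℝ) ^ k < 44 / √(Real.log k) := by
  have hk0 : 0 < k := Nat.pos_of_ne_zero fun h => by simp [h] at hk; linarith
  have hk0' : (0 : ℝ) < k := Nat.cast_pos.2 hk0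
  set L := Real.log k with hL
  have hL0 : 0 < L := by linarith
  have hkL : Real.exp L = k := Real.exp_log hk0'
  set s := √L with hs
  have hs2 : s ^ 2 = L := Real.sq_sqrt hL0.le
  have hs44 : 44 < s := Real.lt_sqrt (by norm_num) |>.2 (by linarith)
  have hs0 : 0 < s := by linarith
  refine ⟨4 / s, ⌊L / 16⌋₊, by positivity, ?_, ?_⟩
  · have := Nat.lt_floor_add_one (L / 16)
    rw [div_pow, hs2, mul_div_assoc', lt_div_iff₀ hL0]
    linarith
  set R := ⌊L / 16⌋₊ with hR
  have hRL : (R : ℝ) ≤ L / 16 := Nat.floor_le (by positivity)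
  have h4 : (4 : ℝ) ^ R ≤ Real.exp (L / 8) := by
    have h2 : (4 : ℝ) ≤ Real.exp 2 := by
      have := Real.add_one_le_exp (1 : ℝ)
      have h3 : Real.exp 2 = Real.exp 1 * Real.exp 1 := by rw [← Real.exp_add]; norm_num
      nlinarith
    calc (4 : ℝ) ^ R ≤ Real.exp 2 ^ R := by gcongr
      _ = Real.exp (R * 2) := by rw [← Real.exp_nat_mul]
      _ ≤ Real.exp (L / 8) := Real.exp_le_exp.2 (by linarith)
  have hsq : √(k : ℝ) = Real.exp (L / 8) * Real.exp (3 * L / 8) := by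
    rw [← Real.exp_add, ← hkL, ← Real.exp_half]
    congr 1
    ring
  have h6 : (3 * L / 8) ^ 3 / 6 ≤ Real.exp (3 * L / 8) := by
    have := Real.pow_div_factorial_le_exp (3 * L / 8) (by positivity) 3
    norm_num [Nat.factorial] at this ⊢
    exact this
  have hA : 90 * (R + 1) * 4 ^ R / √(k : ℝ) ≤ 6 / L := by
    rw [hsq, div_le_div_iff₀ (by positivity) hL0]
    have h7 : 15 * L ^ 2 ≤ Real.exp (3 * L / 8) := by
      refine le_trans ?_ h6
      nlinarith [sq_nonneg L, mul_pos hL0 hL0]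
    calc 90 * ((R : ℝ) + 1) * 4 ^ R * L ≤ 90 * L * Real.exp (L / 8) * L := by
          gcongr
          linarith
      _ = 6 * (Real.exp (L / 8) * (15 * L ^ 2)) := by ring
      _ ≤ _ := by gcongr
  have hB : (1 / 2 : ℝ) ^ k ≤ 1 / L := by
    have h1 : (k : ℝ) ≤ 2 ^ k := by exact_mod_cast Nat.lt_two_pow_self.le
    have h2 : L ≤ k := by
      rw [← hkL]
      linarith [Real.add_one_le_exp L]
    rw [one_div_pow]
    exact one_div_le_one_div_of_le hL0 (h2.trans h1)
  have hC : 7 / L < 4 / s := by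
    rw [← hs2, div_lt_div_iff₀ (by positivity) hs0]
    nlinarith
  calc 2 * samplingErr (4 / s) R k + (1 / 2 : ℝ) ^ k
      = 40 / s + 90 * (R + 1) * 4 ^ R / √(k : ℝ) + (1 / 2 : ℝ) ^ k := by
        rw [samplingErr]
        ring
    _ ≤ 40 / s + 6 / L + 1 / L := by gcongr
    _ = 40 / s + 7 / L := by ring
    _ < 40 / s + 4 / s := by gcongr
    _ = 44 / s := by ring

variable [BorelSpace Z]

lemma cutDistF_le_one {F : ℕ → BoundedContinuousFunction Z ℝ} (hF0 : F 0 = 1)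
    (hF : ∀ n z, F n z ∈ Set.Icc (0 : ℝ) 1) {U W : Sq → Measure Z} (hU : IsProbGraphon U)
    (hW : IsProbGraphon W) : cutDistF F U W ≤ 1 :=
  Real.iSup_le (fun ST => by
    simpa using Fdist_kernelInt_le hF0 hF hU hW (ST.val.1 ×ˢ ST.val.2) 0) zero_le_one

lemma sum_half_pow_succ_le_one (m : ℕ) : ∑ n : Fin m, (1 / 2 : ℝ) ^ ((n : ℕ) + 1) ≤ 1 := by
  rw [Fin.sum_univ_eq_sum_range (fun n => (1 / 2 : ℝ) ^ (n + 1)) m]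
  simp_rw [pow_succ]
  rw [← Finset.sum_mul, geom_sum_eq (by norm_num),
    show ((1 / 2 : ℝ) ^ m - 1) / (1 / 2 - 1) * (1 / 2) = 1 - (1 / 2) ^ m by ring]
  have : (0 : ℝ) ≤ (1 / 2) ^ m := by positivity
  linarith

/-- If the densities of all patterns of `F 1, …, F m` agree up to `τ` on `k` vertices, then
the unlabeled cut distance is controlled by the sampling error. -/
lemma deltaCut_le_samplingErr {F : ℕ → BoundedContinuousFunction Z ℝ} (hF0 : F 0 = 1)
    (hF : ∀ n z, F n z ∈ Set.Icc (0 : ℝ) 1) {U W : Sq → Measure Z} (hU : IsProbGraphon U)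
    (hW : IsProbGraphon W) {k m : ℕ} (hk : 0 < k) {ε τ : ℝ} {R : ℕ} (hε : 0 < ε)
    (hR : 1 < (R + 1) * ε ^ 2)
    (hτ : ∀ b : Fin k × Fin k → Finset (Fin m),
      |edgeDens (patternLaw F m U) b - edgeDens (patternLaw F m W) b| ≤ τ) :
    deltaCut (cutDistF F) U W ≤
      2 * samplingErr ε R k + ((2 : ℝ) ^ m) ^ k ^ 2 * τ + (1 / 2 : ℝ) ^ m := by
  refine le_of_forall_pos_le_add fun δ hδ => ?_
  have := Fin.pos_iff_nonempty.1 hk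
  obtain ⟨φ, hφ, h⟩ := exists_perm_fieldMix_le
    (wt := fun n : Fin m => (1 / 2 : ℝ) ^ ((n : ℕ) + 1)) (I := Fin k)
    (h := fun n (ω : Finset (Fin m)) => if n ∈ ω then (1 : ℝ) else 0)
    (fun n => by positivity) (sum_half_pow_succ_le_one m) (isLawField_patternLaw hF hU m)
    (isLawField_patternLaw hF hW m) (fun n ω => by split_ifs <;> simp) hε hR hτ hδ
  simp only [Fintype.card_fin, Fintype.card_finset, Nat.cast_pow, Nat.cast_ofNat,
    fieldMix_patternLaw F hU, fieldMix_patternLaw F hW] at h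
  have h0 := h ∅ ∅ .empty .empty
  simp only [Set.empty_prod, Measure.restrict_empty, integral_zero_measure, abs_zero, mul_zero,
    Finset.sum_const_zero] at h0
  have hm : (0 : ℝ) ≤ (1 / 2) ^ m := by positivity
  refine (deltaCut_le F U W hφ).trans (Real.iSup_le (fun ST => ?_) (by linarith))
  have h1 := Fdist_kernelInt_le hF0 hF hU (hW.relabel hφ.measurable) (ST.val.1 ×ˢ ST.val.2) m
  have h2 := h _ _ ST.2.1 ST.2.2
  simp only [relabel] at h1
  linarith

end Assembly

/-- **Inverse Counting Lemma.**
Let `F = (f_n)` be a convergence determining sequence, let `U, W` be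
probability-graphons, `k ≥ 2` and `n₀ ≥ 1`.  Assume that
`|t(F^g, U) − t(F^g, W)| ≤ 2^{−k−n₀k²}` for every complete directed graph on `k`
vertices whose edges are decorated by products, without repetition of factors, of
functions among `f₁, …, f_{n₀}, 1−f₁, …, 1−f_{n₀}` (such a decoration is encoded by
the sets `A e, B e ⊆ {1, …, n₀}` of indices of the factors `f_i`, resp. `1−f_i`,
appearing in `g_e`).  Then `δ_{□,F}(U, W) ≤ 44/√(log k) + 2^{−n₀}`. -/
theorem inverse_counting_lemma
    {Z : Type*} [MeasurableSpace Z] [TopologicalSpace Z] [PolishSpace Z] [BorelSpace Z]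
    (F : ℕ → BoundedContinuousFunction Z ℝ) (hF : IsConvDet F)
    (U W : Sq → Measure Z) (hU : IsProbGraphon U) (hW : IsProbGraphon W)
    (k n₀ : ℕ) (hk : 2 ≤ k) (hn₀ : 1 ≤ n₀)
    (hclose : ∀ A B : Fin k × Fin k → Finset ℕ,
      (∀ e, A e ⊆ Finset.Icc 1 n₀) → (∀ e, B e ⊆ Finset.Icc 1 n₀) →
      |homDensity (completeEdges k)
          (fun e => (∏ i ∈ A e, F i) * ∏ i ∈ B e, (1 - F i)) U -
        homDensity (completeEdges k)
          (fun e => (∏ i ∈ A e, F i) * ∏ i ∈ B e, (1 - F i)) W| ≤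
        (1/2 : ℝ) ^ (k + n₀ * k ^ 2)) :
    deltaCut (cutDistF F) U W ≤ 44 / Real.sqrt (Real.log k) + (1/2 : ℝ) ^ n₀ := by
  obtain ⟨hF0, hF1, -⟩ := hF
  rcases le_or_gt (Real.log k) 1936 with hL | hL
  · have hL0 : 0 < Real.log k := Real.log_pos (by exact_mod_cast hk)
    have h44 : √(Real.log k) ≤ 44 := Real.sqrt_le_iff.2 ⟨by norm_num, by linarith⟩
    have h1 : 1 ≤ 44 / √(Real.log k) := (one_le_div (Real.sqrt_pos.2 hL0)).2 h44
    have h2 : (0 : ℝ) ≤ (1 / 2) ^ n₀ := by positivity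
    have h3 := (deltaCut_le F U W (φ := Equiv.refl _) (MeasurePreserving.id _)).trans
      (cutDistF_le_one hF0 hF1 hU (hW.relabel measurable_id))
    linarith
  · obtain ⟨ε, R, hε, hR, hlt⟩ := exists_samplingErr_le hL
    have hmap : ∀ s : Finset (Fin n₀), s.map ⟨fun n : Fin n₀ => (n : ℕ) + 1,
        fun i j h => by ext; simpa using h⟩ ⊆ Finset.Icc 1 n₀ := fun s i hi => by
      obtain ⟨n, -, rfl⟩ := Finset.mem_map.1 hi
      exact Finset.mem_Icc.2 ⟨Nat.le_add_left 1 _, n.2⟩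
    have h := deltaCut_le_samplingErr hF0 hF1 hU hW (by omega : 0 < k) hε hR
      (τ := (1 / 2 : ℝ) ^ (k + n₀ * k ^ 2)) fun b => by
        rw [← homDensity_pattern, ← homDensity_pattern]
        exact hclose _ _ (fun e => hmap _) fun e => hmap _
    have hpow : ((2 : ℝ) ^ n₀) ^ k ^ 2 * (1 / 2 : ℝ) ^ (k + n₀ * k ^ 2) = (1 / 2 : ℝ) ^ k := by
      rw [← pow_mul, pow_add, mul_left_comm, ← mul_pow]
      norm_num
    rw [hpow] at h
    linarith

end PG
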